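/- arXiv:2508.00302 — 8 statements merged into one kernel-verified Lean document; each statement's English description precedes it below -/
import Mathlib

section
/- Let A be the adjacency matrix of a connected, non-complete, inhomogeneous, 6-regular and 4 net-regular strongly regular signed graph with parameters (n, 6, a, b, c) lying in the class C1 ∪ C4 ∪ C5. Then A contains no unbalanced triangle: for every triple of pairwise adjacent vertices i, j, k one has A i j · A j k · A i k = 1. -/
/-- The positive neighbours of `i` in the signed graph with adjacency matrix `A`. -/
def posNbr {n : ℕ} (A : Matrix (Fin n) (Fin n) ℤ) (i : Fin n) : Finset (Fin n) :=
  Finset.univ.filter fun j => A i j = 1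

theorem mem_posNbr {n : ℕ} {A : Matrix (Fin n) (Fin n) ℤ} {i j : Fin n} :
    j ∈ posNbr A i ↔ A i j = 1 := by
  simp [posNbr]

/-- An entry of a signed adjacency matrix is the difference of the indicators of its two signs. -/
theorem entry_eq_sub {n : ℕ} {A : Matrix (Fin n) (Fin n) ℤ}
    (hent : ∀ i j, A i j = -1 ∨ A i j = 0 ∨ A i j = 1) (i j : Fin n) :
    A i j = (if A i j = 1 then 1 else 0) - (if A i j = -1 then 1 else 0) := by
  rcases hent i j with h | h | h <;> simp [h]

/-- In a 6-regular and 4 net-regular signed graph every vertex has five positive neighbours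
and one negative neighbour. -/
theorem card_pos_neg {n : ℕ} {A : Matrix (Fin n) (Fin n) ℤ}
    (hent : ∀ i j, A i j = -1 ∨ A i j = 0 ∨ A i j = 1)
    (hreg : ∀ i, (Finset.univ.filter (fun j => A i j ≠ 0)).card = 6)
    (hnet : ∀ i, ∑ j, A i j = 4) (i : Fin n) :
    (posNbr A i).card = 5 ∧ (Finset.univ.filter (fun j => A i j = -1)).card = 1 := by
  have h1 : ((posNbr A i).card : ℤ) - (Finset.univ.filter (fun j => A i j = -1)).card = 4 := by
    rw [← hnet i, posNbr, Finset.card_filter, Finset.card_filter]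
    push_cast
    rw [← Finset.sum_sub_distrib]
    exact Finset.sum_congr rfl fun j _ => (entry_eq_sub hent i j).symm
  have h2 : ((posNbr A i).card : ℤ) + (Finset.univ.filter (fun j => A i j = -1)).card = 6 := by
    have h := hreg i
    rw [Finset.card_filter] at h
    zify at h
    rw [← h, posNbr, Finset.card_filter, Finset.card_filter]
    push_cast
    rw [← Finset.sum_add_distrib]
    refine Finset.sum_congr rfl fun j _ => ?_
    rcases hent i j with h | h | h <;> simp [h]
  omega

/-- The unique negative neighbours form an involution of the vertices. -/
theorem exists_negative_mate {n : ℕ} {A : Matrix (Fin n) (Fin n) ℤ}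
    (hsymm : ∀ i j, A i j = A j i)
    (hcard : ∀ i, (Finset.univ.filter (fun j => A i j = -1)).card = 1) :
    ∃ σ : Fin n → Fin n, (∀ i j, A i j = -1 ↔ j = σ i) ∧ ∀ i, σ (σ i) = i := by
  choose σ hσ using fun i => Finset.card_eq_one.mp (hcard i)
  have hmem : ∀ i j, A i j = -1 ↔ j = σ i := fun i j => by
    have := Finset.ext_iff.mp (hσ i) j
    simpa using this
  refine ⟨σ, hmem, fun i => ?_⟩
  exact ((hmem (σ i) i).mp (by rw [hsymm]; exact (hmem i _).mpr rfl)).symm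

/-- The entries of `A * A` count common positive neighbours, corrected by the negative mates. -/
theorem mul_self_apply_eq {n : ℕ} {A : Matrix (Fin n) (Fin n) ℤ} {σ : Fin n → Fin n}
    (hsymm : ∀ i j, A i j = A j i)
    (hent : ∀ i j, A i j = -1 ∨ A i j = 0 ∨ A i j = 1)
    (hσ : ∀ i j, A i j = -1 ↔ j = σ i) (hσσ : ∀ i, σ (σ i) = i) {i j : Fin n} (hij : i ≠ j) :
    (A * A) i j = (posNbr A i ∩ posNbr A j).card - (if A (σ i) j = 1 then 1 else 0)
      - (if A i (σ j) = 1 then 1 else 0) := by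
  have hne : σ i ≠ σ j := fun h => hij (by rw [← hσσ i, h, hσσ])
  have key : ∀ k, A i k * A k j = (if k ∈ posNbr A i ∩ posNbr A j then 1 else 0)
      - (if k = σ i then (if A k j = 1 then 1 else 0) else 0)
      - (if k = σ j then (if A i k = 1 then 1 else 0) else 0) := by
    intro k
    have hd : ¬(k = σ i ∧ k = σ j) := fun h => hne (h.1.symm.trans h.2)
    rw [← hσ, ← hσ, hsymm j k] at hd
    simp only [← hσ, Finset.mem_inter, mem_posNbr, hsymm j k]
    rcases hent i k with h | h | h <;> rcases hent k j with h' | h' | h' <;>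
      simp [h, h'] at hd ⊢
  rw [Matrix.mul_apply, Finset.sum_congr rfl fun k _ => key k, Finset.sum_sub_distrib,
    Finset.sum_sub_distrib, ← Finset.sum_filter, Finset.filter_univ_mem]
  simp

/-- The square of `A` as a combination of the identity, the two indicators and the all-ones
matrix. -/
theorem mul_self_apply_eq_combination {n : ℕ} {A : Matrix (Fin n) (Fin n) ℤ} {a b c : ℤ}
    (hdiag : ∀ i, A i i = 0)
    (hent : ∀ i j, A i j = -1 ∨ A i j = 0 ∨ A i j = 1)
    (hAA : ∀ i, (A * A) i i = 6)
    (hpos : ∀ i j, A i j = 1 → (A * A) i j = a)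
    (hneg : ∀ i j, A i j = -1 → (A * A) i j = b)
    (hnon : ∀ i j, i ≠ j → A i j = 0 → (A * A) i j = c) (i j : Fin n) :
    (A * A) i j = (6 - c) * (if i = j then 1 else 0) + (a - c) * A i j
      + (a + b - 2 * c) * (if A i j = -1 then 1 else 0) + c := by
  by_cases hij : i = j
  · subst hij
    simp [hAA, hdiag]
  · rcases hent i j with h | h | h
    · simp [hneg i j h, h, hij]; ring
    · simp [hnon i j hij h, h, hij]
    · simp [hpos i j h, h, hij]

/-- Outside the excluded classes, passing to negative mates is a symmetry of `A`. -/
theorem mate_comm {n : ℕ} {A : Matrix (Fin n) (Fin n) ℤ} {a b c : ℤ} {σ : Fin n → Fin n}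
    (hsymm : ∀ i j, A i j = A j i)
    (hdiag : ∀ i, A i i = 0)
    (hent : ∀ i j, A i j = -1 ∨ A i j = 0 ∨ A i j = 1)
    (hnet : ∀ i, ∑ j, A i j = 4)
    (hAA : ∀ i, (A * A) i i = 6)
    (hpos : ∀ i j, A i j = 1 → (A * A) i j = a)
    (hneg : ∀ i j, A i j = -1 → (A * A) i j = b)
    (hnon : ∀ i j, i ≠ j → A i j = 0 → (A * A) i j = c)
    (hne : a + b - 2 * c ≠ 0)
    (hσ : ∀ i j, A i j = -1 ↔ j = σ i) (i j : Fin n) :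
    A (σ i) j = A i (σ j) := by
  have hcomb := mul_self_apply_eq_combination hdiag hent hAA hpos hneg hnon
  have hassoc : (A * A * A) i j = (A * (A * A)) i j := by rw [Matrix.mul_assoc]
  have hsq : ∑ k, A i k * A k j = (A * A) i j := (Matrix.mul_apply ..).symm
  have hcol : ∑ k, A k j = 4 := by rw [← hnet j]; exact Finset.sum_congr rfl fun k _ => hsymm k j
  have hl : (A * A * A) i j = (6 - c) * A i j + (a - c) * (A * A) i j
      + (a + b - 2 * c) * A (σ i) j + c * 4 := by
    rw [Matrix.mul_apply, ← hsq, ← hcol]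
    simp_rw [hcomb, hσ, add_mul, Finset.sum_add_distrib, Finset.mul_sum]
    congr 1
    congr 1
    congr 1
    · simp
    · exact Finset.sum_congr rfl fun k _ => by ring
    · simp
  have hr : (A * (A * A)) i j = (6 - c) * A i j + (a - c) * (A * A) i j
      + (a + b - 2 * c) * A i (σ j) + c * 4 := by
    have hσ' : ∀ k, A k j = -1 ↔ k = σ j := fun k => by rw [hsymm, hσ]
    rw [Matrix.mul_apply, ← hsq, ← hnet i]
    simp_rw [hcomb, hσ', mul_add, Finset.sum_add_distrib, Finset.mul_sum]
    congr 1
    congr 1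
    congr 1
    · simp [mul_comm]
    · exact Finset.sum_congr rfl fun k _ => by ring
    · simp [mul_comm]
    · exact Finset.sum_congr rfl fun k _ => by ring
  exact mul_left_cancel₀ hne (by linarith)

/-- Summing a row of `A * A` relates the parameters. -/
theorem parameter_identity {n : ℕ} {A : Matrix (Fin n) (Fin n) ℤ} {a b c : ℤ} {σ : Fin n → Fin n}
    (hdiag : ∀ i, A i i = 0)
    (hent : ∀ i j, A i j = -1 ∨ A i j = 0 ∨ A i j = 1)
    (hnet : ∀ i, ∑ j, A i j = 4)
    (hAA : ∀ i, (A * A) i i = 6)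
    (hpos : ∀ i j, A i j = 1 → (A * A) i j = a)
    (hneg : ∀ i j, A i j = -1 → (A * A) i j = b)
    (hnon : ∀ i j, i ≠ j → A i j = 0 → (A * A) i j = c)
    (hσ : ∀ i j, A i j = -1 ↔ j = σ i) (i : Fin n) :
    5 * a + b + (n - 7) * c = 10 := by
  have hl : ∑ j, (A * A) i j = 16 := by
    simp_rw [Matrix.mul_apply]
    rw [Finset.sum_comm]
    simp_rw [← Finset.mul_sum, hnet, ← Finset.sum_mul, hnet]
    norm_num
  simp_rw [mul_self_apply_eq_combination hdiag hent hAA hpos hneg hnon, hσ,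
    Finset.sum_add_distrib, ← Finset.mul_sum, hnet] at hl
  simp at hl
  linarith

/-- A finset stable under a fixed-point free involution has even cardinality. -/
theorem even_card_of_fixedPointFree {α : Type*} {s : Finset α} {σ : α → α}
    (hs : ∀ x ∈ s, σ x ∈ s) (hσσ : ∀ x, σ (σ x) = x) (hfix : ∀ x, σ x ≠ x) : Even s.card := by
  have h : ∑ _x ∈ s, (1 : ZMod 2) = 0 :=
    Finset.sum_involution (fun x _ => σ x) (fun _ _ => by decide) (fun x _ _ => hfix x)
      hs (fun x _ => hσσ x)
  rw [Finset.sum_const, nsmul_one] at h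
  exact even_iff_two_dvd.mpr ((ZMod.natCast_eq_zero_iff _ _).mp h)

/-- No vertex is positively adjacent to both ends of a negative edge. -/
theorem posNbr_inter_mate_eq_empty {n : ℕ} {A : Matrix (Fin n) (Fin n) ℤ} {a b c : ℤ}
    {σ : Fin n → Fin n}
    (hn : 7 ≤ n)
    (hsymm : ∀ i j, A i j = A j i)
    (hdiag : ∀ i, A i i = 0)
    (hent : ∀ i j, A i j = -1 ∨ A i j = 0 ∨ A i j = 1)
    (hcard : ∀ i, (posNbr A i).card = 5)
    (hpos : ∀ i j, A i j = 1 → (A * A) i j = a)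
    (hneg : ∀ i j, A i j = -1 → (A * A) i j = b)
    (hnon : ∀ i j, i ≠ j → A i j = 0 → (A * A) i j = c)
    (hσ : ∀ i j, A i j = -1 ↔ j = σ i) (hσσ : ∀ i, σ (σ i) = i)
    (hcomm : ∀ i j, A (σ i) j = A i (σ j))
    (hsum : 5 * a + b + (n - 7) * c = 10) (i : Fin n) :
    posNbr A i ∩ posNbr A (σ i) = ∅ := by
  have hmate : ∀ x, A x (σ x) = -1 := fun x => (hσ x _).mpr rfl
  have hfix : ∀ x, σ x ≠ x := fun x h => by
    have := hmate x
    rw [h, hdiag] at this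
    norm_num at this
  have hsq : ∀ {x y}, x ≠ y → (A * A) x y =
      (posNbr A x ∩ posNbr A y).card - 2 * (if A (σ x) y = 1 then 1 else 0) := by
    intro x y hxy
    rw [mul_self_apply_eq hsymm hent hσ hσσ hxy, ← hcomm x y]
    ring
  have hb : ((posNbr A i ∩ posNbr A (σ i)).card : ℤ) = b := by
    rw [← hneg i (σ i) (hmate i), hsq (hfix i).symm, hdiag]
    simp
  have hstable : ∀ x ∈ posNbr A i ∩ posNbr A (σ i), σ x ∈ posNbr A i ∩ posNbr A (σ i) := by
    intro x hx
    simp only [Finset.mem_inter, mem_posNbr] at hx ⊢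
    rw [hcomm, hσσ, ← hcomm]
    exact hx.symm
  have heven := even_card_of_fixedPointFree hstable hσσ hfix
  have hle : (posNbr A i ∩ posNbr A (σ i)).card ≤ 5 :=
    hcard i ▸ Finset.card_le_card Finset.inter_subset_left
  have hsplit : (posNbr A i \ posNbr A (σ i)).card
      + (posNbr A i ∩ posNbr A (σ i)).card = 5 := by
    rw [Finset.card_sdiff_add_card_inter, hcard]
  have hsplit' : (posNbr A (σ i) \ posNbr A i).card
      + (posNbr A i ∩ posNbr A (σ i)).card = 5 := by
    rw [Finset.inter_comm, Finset.card_sdiff_add_card_inter, hcard]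
  obtain ⟨k, hk⟩ : (posNbr A i \ posNbr A (σ i)).Nonempty := by
    rw [← Finset.card_pos]
    rcases heven with ⟨m, hm⟩
    omega
  have hk' := hk
  simp only [Finset.mem_sdiff, mem_posNbr] at hk'
  obtain ⟨hik, hσik⟩ := hk'
  have hik_ne : i ≠ k := fun h => by
    rw [← h, hdiag] at hik
    norm_num at hik
  have ha : a = (posNbr A i ∩ posNbr A k).card := by
    rw [← hpos i k hik, hsq hik_ne, if_neg hσik]
    ring
  by_contra hempty
  obtain ⟨j, hj⟩ := Finset.nonempty_iff_ne_empty.mpr hempty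
  have hcases : (posNbr A i ∩ posNbr A (σ i)).card = 2 ∨
      (posNbr A i ∩ posNbr A (σ i)).card = 4 := by
    have := Finset.card_pos.mpr ⟨j, hj⟩
    rcases heven with ⟨m, hm⟩
    omega
  rcases hcases with h2 | h4
  · have hj' := hj
    simp only [Finset.mem_inter, mem_posNbr] at hj'
    obtain ⟨hij, hσij⟩ := hj'
    have hcommon : ∀ {x}, A x j = 1 → A (σ x) j = 1 →
        ((posNbr A x ∩ posNbr A j).card : ℤ) = a + 2 := by
      intro x hx hx'
      have hxj : x ≠ j := fun h => by
        rw [h, hdiag] at hx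
        norm_num at hx
      rw [← hpos x j hx, hsq hxj, if_pos hx']
      ring
    have h1 := hcommon hij hσij
    have h1' := hcommon hσij (by rwa [hσσ])
    have hsub : (posNbr A i ∩ posNbr A j) ∪ (posNbr A (σ i) ∩ posNbr A j)
        ⊆ ((posNbr A j).erase i).erase (σ i) := by
      intro x hx
      simp only [Finset.mem_union, Finset.mem_inter, Finset.mem_erase, mem_posNbr] at hx ⊢
      have := hmate i
      have := hsymm i (σ i)
      have := hdiag i
      have := hdiag (σ i)
      refine ⟨?_, ?_, ?_⟩
      · rintro rfl
        omega
      · rintro rfl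
        omega
      · tauto
    have hcardle := Finset.card_le_card hsub
    rw [Finset.card_erase_of_mem, Finset.card_erase_of_mem, hcard] at hcardle
    rotate_left
    · rw [mem_posNbr, hsymm, hij]
    · rw [Finset.mem_erase, mem_posNbr, hsymm, hσij]
      exact ⟨hfix i, rfl⟩
    have hui := Finset.card_union_add_card_inter (posNbr A i ∩ posNbr A j)
      (posNbr A (σ i) ∩ posNbr A j)
    obtain ⟨x, hx⟩ : ((posNbr A i ∩ posNbr A j) ∩ (posNbr A (σ i) ∩ posNbr A j)).Nonempty := by
      rw [← Finset.card_pos]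
      omega
    simp only [Finset.mem_inter, mem_posNbr] at hx
    have hxj : x ≠ j := fun h => by
      have := hx.1.2
      rw [h, hdiag] at this
      norm_num at this
    have hxσj : x ≠ σ j := fun h => by
      have := hx.1.2
      rw [h, hmate] at this
      norm_num at this
    have hthree : ({x, j, σ j} : Finset (Fin n)) ⊆ posNbr A i ∩ posNbr A (σ i) := by
      intro y hy
      simp only [Finset.mem_insert, Finset.mem_singleton] at hy
      rcases hy with rfl | rfl | rfl
      · simp only [Finset.mem_inter, mem_posNbr]
        exact ⟨hx.1.1, hx.2.1⟩
      · exact hj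
      · exact hstable j hj
    have := Finset.card_le_card hthree
    rw [Finset.card_eq_three.mpr ⟨x, j, σ j, hxj, hxσj, (hfix j).symm, rfl⟩] at this
    omega
  · have hσk : σ k ∈ posNbr A (σ i) \ posNbr A i := by
      simp only [Finset.mem_sdiff, mem_posNbr]
      rw [hcomm, hσσ, ← hcomm]
      exact ⟨hik, hσik⟩
    have huniq : ∀ x, A i x = 1 → x ≠ k → A (σ i) x = 1 := by
      intro x hx hxk
      by_contra hx'
      exact hxk (Finset.card_le_one.mp (by omega) x
        (Finset.mem_sdiff.mpr ⟨mem_posNbr.mpr hx, fun h => hx' (mem_posNbr.mp h)⟩) k hk)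
    have huniq' : ∀ x, A (σ i) x = 1 → x ≠ σ k → A i x = 1 := by
      intro x hx hxk
      by_contra hx'
      exact hxk (Finset.card_le_one.mp (by omega) x
        (Finset.mem_sdiff.mpr ⟨mem_posNbr.mpr hx, fun h => hx' (mem_posNbr.mp h)⟩) (σ k) hσk)
    have heq : posNbr A (σ i) ∩ posNbr A k = posNbr A i ∩ posNbr A k := by
      ext x
      simp only [Finset.mem_inter, mem_posNbr]
      refine and_congr_left fun hkx => ⟨fun h => huniq' x h ?_, fun h => huniq x h ?_⟩
      · rintro rfl
        rw [hmate] at hkx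
        norm_num at hkx
      · rintro rfl
        rw [hdiag] at hkx
        norm_num at hkx
    have hzero : A (σ i) k = 0 := by
      rcases hent (σ i) k with h | h | h
      · exact absurd ((hσ _ _).mp h) (by rw [hσσ]; exact hik_ne.symm)
      · exact h
      · exact absurd h hσik
    have hne : σ i ≠ k := fun h => by
      rw [← h, hmate] at hik
      norm_num at hik
    have hc : c = a - 2 := by
      rw [← hnon _ _ hne hzero, hsq hne, heq, hσσ, if_pos hik, ha]
      ring
    have hn' : (7 : ℤ) ≤ n := by exact_mod_cast hn
    have hb4 : b = 4 := by rw [← hb, h4]; norm_num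
    subst hc hb4
    rcases le_or_gt 2 a with h | h <;> nlinarith


theorem stmt1 {n : ℕ} (A : Matrix (Fin n) (Fin n) ℤ) (a b c : ℤ)
    (hsymm : ∀ i j, A i j = A j i)
    (hdiag : ∀ i, A i i = 0)
    (hent : ∀ i j, A i j = -1 ∨ A i j = 0 ∨ A i j = 1)
    (hconn : (SimpleGraph.fromRel (fun i j => A i j ≠ 0)).Connected)
    (hncomp : ¬ ∀ i j : Fin n, i ≠ j → A i j ≠ 0)
    (hinhom : (∃ i j, A i j = 1) ∧ (∃ i j, A i j = -1))
    (hreg : ∀ i, (Finset.univ.filter (fun j => A i j ≠ 0)).card = 6)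
    (hnet : ∀ i, ∑ j, A i j = 4)
    (hAA : ∀ i, (A * A) i i = 6)
    (hpos : ∀ i j, A i j = 1 → (A * A) i j = a)
    (hneg : ∀ i j, A i j = -1 → (A * A) i j = b)
    (hnon : ∀ i j, i ≠ j → A i j = 0 → (A * A) i j = c)
    (hclass : ¬(a = -b ∧ c = 0) ∧ ¬(a ≠ -b ∧ 2 * c = a + b)) :
    ∀ i j k : Fin n, A i j ≠ 0 → A j k ≠ 0 → A i k ≠ 0 → A i j * A j k * A i k = 1 := by
  have hne : a + b - 2 * c ≠ 0 := by
    intro h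
    by_cases h0 : a = -b
    · exact hclass.1 ⟨h0, by linarith⟩
    · exact hclass.2 ⟨h0, by linarith⟩
  have hcards := card_pos_neg hent hreg hnet
  obtain ⟨σ, hσ, hσσ⟩ := exists_negative_mate hsymm fun i => (hcards i).2
  have hcomm := mate_comm hsymm hdiag hent hnet hAA hpos hneg hnon hne hσ
  have hn : ∀ _ : Fin n, 7 ≤ n := fun i => by
    have h : (Finset.univ.filter (fun j => A i j ≠ 0)).card < (Finset.univ : Finset (Fin n)).card :=
      Finset.card_lt_card (Finset.filter_ssubset.mpr ⟨i, Finset.mem_univ i, by simp [hdiag]⟩)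
    rw [hreg, Finset.card_fin] at h
    exact h
  have hnone : ∀ i j k, A i j = -1 → A i k ≠ 0 → A j k ≠ 0 → False := by
    intro i j k hij hik hjk
    have hji : i = σ j := by rwa [← hσ, hsymm]
    have hik1 : A i k = 1 := by
      rcases hent i k with h | h | h
      · rw [(hσ _ _).mp h, ← (hσ _ _).mp hij, hdiag] at hjk
        exact absurd rfl hjk
      · exact absurd h hik
      · exact h
    have hjk1 : A j k = 1 := by
      rcases hent j k with h | h | h
      · rw [(hσ _ _).mp h, ← hji, hdiag] at hik
        exact absurd rfl hik
      · exact absurd h hjk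
      · exact h
    have hempty := posNbr_inter_mate_eq_empty (hn i) hsymm hdiag hent (fun i => (hcards i).1)
      hpos hneg hnon hσ hσσ hcomm
      (parameter_identity hdiag hent hnet hAA hpos hneg hnon hσ i) i
    rw [← (hσ _ _).mp hij] at hempty
    exact Finset.notMem_empty k (hempty ▸ Finset.mem_inter.mpr
      ⟨mem_posNbr.mpr hik1, mem_posNbr.mpr hjk1⟩)
  intro i j k hij hjk hik
  have h1 : A i j = 1 := by
    rcases hent i j with h | h | h
    · exact (hnone i j k h hik hjk).elim
    · exact absurd h hij
    · exact h
  have h2 : A j k = 1 := by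
    rcases hent j k with h | h | h
    · exact (hnone j k i h (hsymm i j ▸ hij) (hsymm i k ▸ hik)).elim
    · exact absurd h hjk
    · exact h
  have h3 : A i k = 1 := by
    rcases hent i k with h | h | h
    · exact (hnone i k j h hij (hsymm j k ▸ hjk)).elim
    · exact absurd h hik
    · exact h
  rw [h1, h2, h3]
  norm_num
end

section
/- Let A be the adjacency matrix of a connected, non-complete, inhomogeneous, 6-regular and 4 net-regular strongly regular signed graph with parameters (n, 6, a, b, c) lying in the class C1 ∪ C4 ∪ C5. Then b = 0, any two negatively adjacent vertices have no common neighbours (if A i j = -1 then there is no vertex k adjacent to both i and j), and a ∈ {0, 1, 2, 3, 4}. -/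
open Finset

/-- A finite set preserved by a fixed-point-free involution has even cardinality. -/
theorem Finset.even_card_of_involutive {V : Type*} {s : Finset V} {m : V → V}
    (hm : Function.Involutive m) (hne : ∀ i, m i ≠ i) (hs : ∀ i ∈ s, m i ∈ s) :
    Even #s := by
  have h : ∑ _i ∈ s, (1 : ZMod 2) = 0 :=
    Finset.sum_involution (fun i _ => m i) (fun _ _ => by decide) (fun i _ _ => hne i)
      hs (fun i _ => hm i)
  rw [← ZMod.natCast_eq_zero_iff_even]
  simpa using h

/-- `N i` is the set of positive neighbours of `i` and `m i` is its unique negative neighbour, in a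
strongly regular signed graph of degree 6 and net-degree 4 whose negative matching is an
automorphism. -/
structure IsMatchedSRSG {V : Type*} [Fintype V] [DecidableEq V] (N : V → Finset V) (m : V → V)
    (a b c : ℤ) : Prop where
  involutive : Function.Involutive m
  ne_self : ∀ i, m i ≠ i
  symm : ∀ {i j}, j ∈ N i → i ∈ N j
  notMem_self : ∀ i, i ∉ N i
  notMem_match : ∀ i, m i ∉ N i
  mem_match : ∀ {i j}, j ∈ N (m i) ↔ m j ∈ N i
  card_eq : ∀ i, #(N i) = 5
  card_inter_pos : ∀ {i j}, j ∈ N i → (#(N i ∩ N j) : ℤ) = a + if m j ∈ N i then 2 else 0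
  card_inter_neg : ∀ i, (#(N i ∩ N (m i)) : ℤ) = b
  card_inter_non : ∀ {i j}, j ≠ i → j ≠ m i → j ∉ N i →
    (#(N i ∩ N j) : ℤ) = c + if m j ∈ N i then 2 else 0
  row_sum : 5 * a + b + ((Fintype.card V : ℤ) - 7) * c = 10

namespace IsMatchedSRSG

variable {V : Type*} [Fintype V] [DecidableEq V] {N : V → Finset V} {m : V → V} {a b c : ℤ}

/-- The vertices not adjacent to `i`. -/
def nonNeighbors (N : V → Finset V) (m : V → V) (i : V) : Finset V :=
  univ \ insert i (insert (m i) (N i))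

theorem mem_nonNeighbors {i j : V} :
    j ∈ nonNeighbors N m i ↔ j ≠ i ∧ j ≠ m i ∧ j ∉ N i := by
  simp [nonNeighbors]

theorem card_nonNeighbors (h : IsMatchedSRSG N m a b c) (i : V) :
    #(nonNeighbors N m i) + 7 = Fintype.card V := by
  have h₁ : #(insert i (insert (m i) (N i))) = 7 := by
    rw [card_insert_of_notMem, card_insert_of_notMem (h.notMem_match i), h.card_eq]
    simp [h.notMem_self i, (h.ne_self i).symm]
  have h₂ := card_sdiff_add_card_eq_card (subset_univ (insert i (insert (m i) (N i))))
  rw [h₁, card_univ] at h₂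
  exact h₂

theorem odd_card_nonNeighbors (h : IsMatchedSRSG N m a b c) (i : V) :
    Odd #(nonNeighbors N m i) := by
  have h₁ := h.card_nonNeighbors i
  have h₂ : Even #(univ : Finset V) :=
    even_card_of_involutive h.involutive h.ne_self fun i _ => mem_univ (m i)
  rw [card_univ] at h₂
  grind

theorem mem_inter_match (h : IsMatchedSRSG N m a b c) {i j : V} (hj : j ∈ N i ∩ N (m i)) :
    m j ∈ N i ∩ N (m i) := by
  rw [mem_inter, h.mem_match] at hj ⊢
  rw [h.involutive]
  exact hj.symm

theorem even_b (h : IsMatchedSRSG N m a b c) (i : V) : Even b := by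
  rw [← h.card_inter_neg i]
  exact_mod_cast even_card_of_involutive h.involutive h.ne_self fun j hj => h.mem_inter_match hj

theorem b_nonneg (h : IsMatchedSRSG N m a b c) (i : V) : 0 ≤ b := by
  rw [← h.card_inter_neg i]
  positivity

theorem b_le (h : IsMatchedSRSG N m a b c) (i : V) : b ≤ 4 := by
  have h₁ : #(N i ∩ N (m i)) ≤ 5 := (card_le_card inter_subset_left).trans_eq (h.card_eq i)
  have h₂ := h.card_inter_neg i
  have h₃ := h.even_b i
  grind

theorem card_sdiff_match (h : IsMatchedSRSG N m a b c) (i : V) :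
    (#(N (m i) \ N i) : ℤ) = 5 - b := by
  have h₁ := card_sdiff_add_card_inter (N (m i)) (N i)
  have h₂ := h.card_inter_neg i
  rw [inter_comm, h.card_eq] at h₁
  lia

theorem sdiff_match_subset (h : IsMatchedSRSG N m a b c) (i : V) :
    N (m i) \ N i ⊆ nonNeighbors N m i := by
  intro j hj
  rw [mem_sdiff] at hj
  refine mem_nonNeighbors.2 ⟨?_, ?_, hj.2⟩
  · rintro rfl
    exact h.notMem_match j (h.mem_match.1 hj.1)
  · rintro rfl
    exact h.notMem_self _ hj.1

theorem le_card_nonNeighbors (h : IsMatchedSRSG N m a b c) (i : V) :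
    5 - b ≤ #(nonNeighbors N m i) := by
  rw [← h.card_sdiff_match i]
  exact_mod_cast card_le_card (h.sdiff_match_subset i)

theorem exists_mem_match_notMem (h : IsMatchedSRSG N m a b c) (i : V) :
    ∃ x ∈ N i, m x ∉ N i := by
  have h₁ := h.card_sdiff_match i
  have h₂ := h.b_le i
  obtain ⟨y, hy⟩ : (N (m i) \ N i).Nonempty := by
    rw [← card_pos]
    lia
  rw [mem_sdiff, h.mem_match] at hy
  exact ⟨m y, hy.1, by rw [h.involutive]; exact hy.2⟩

theorem neg_two_le_c (h : IsMatchedSRSG N m a b c) (i : V) : -2 ≤ c := by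
  have h₁ := h.le_card_nonNeighbors i
  have h₂ := h.b_le i
  obtain ⟨j, hj⟩ : (nonNeighbors N m i).Nonempty := by
    rw [← card_pos]
    lia
  obtain ⟨hj₁, hj₂, hj₃⟩ := mem_nonNeighbors.1 hj
  have := h.card_inter_non hj₁ hj₂ hj₃
  split_ifs at this <;> lia

theorem card_nonNeighbors_of_c_neg (h : IsMatchedSRSG N m a b c) (hc : c < 0) (i : V) :
    (#(nonNeighbors N m i) : ℤ) = 5 - b := by
  rw [← h.card_sdiff_match i, (h.sdiff_match_subset i).antisymm]
  intro j hj
  obtain ⟨hj₁, hj₂, hj₃⟩ := mem_nonNeighbors.1 hj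
  have := h.card_inter_non hj₁ hj₂ hj₃
  rw [mem_sdiff, h.mem_match]
  refine ⟨?_, hj₃⟩
  by_contra hmj
  rw [if_neg hmj] at this
  lia

theorem a_nonneg (h : IsMatchedSRSG N m a b c) (i : V) : 0 ≤ a := by
  obtain ⟨x, hx, hmx⟩ := h.exists_mem_match_notMem i
  have := h.card_inter_pos hx
  rw [if_neg hmx] at this
  lia

theorem a_le (h : IsMatchedSRSG N m a b c) (i : V) : a ≤ 4 := by
  obtain ⟨x, hx, hmx⟩ := h.exists_mem_match_notMem i
  have h₁ := h.card_inter_pos hx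
  have h₂ : #(N i ∩ N x) ≤ #((N i).erase x) := card_le_card fun k hk => by
    rw [mem_inter] at hk
    refine mem_erase.2 ⟨?_, hk.1⟩
    rintro rfl
    exact h.notMem_self _ hk.2
  rw [card_erase_of_mem hx, h.card_eq] at h₂
  rw [if_neg hmx] at h₁
  lia

theorem five_le_card_nonNeighbors (h : IsMatchedSRSG N m a b c) (ha : a = 0) (i : V) :
    5 ≤ #(nonNeighbors N m i) := by
  obtain ⟨x, hx, hmx⟩ := h.exists_mem_match_notMem i
  have h₁ := h.card_inter_pos hx
  rw [if_neg hmx, ha, add_zero, Nat.cast_eq_zero, card_eq_zero] at h₁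
  have hno : ∀ k ∈ N i, k ∉ N x := fun k hk hkx => by
    have : k ∈ N i ∩ N x := mem_inter.2 ⟨hk, hkx⟩
    simp [h₁] at this
  have hdisj : Disjoint (N i ∩ N (m i)) (N (m x) \ N x) := by
    rw [disjoint_left]
    intro k hk hk'
    exact hno _ (mem_inter.1 (h.mem_inter_match hk)).1 (h.mem_match.1 (mem_sdiff.1 hk').1)
  have hsub : (N i ∩ N (m i)) ∪ (N (m x) \ N x) ⊆ nonNeighbors N m x := by
    refine union_subset (fun k hk => ?_) (h.sdiff_match_subset x)
    obtain ⟨hk₁, hk₂⟩ := mem_inter.1 hk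
    refine mem_nonNeighbors.2 ⟨?_, ?_, hno k hk₁⟩
    · rintro rfl
      exact hmx (h.mem_match.1 hk₂)
    · rintro rfl
      exact hmx hk₁
  have h₂ := card_le_card hsub
  rw [card_union_of_disjoint hdisj] at h₂
  have h₃ := h.card_inter_neg i
  have h₄ := h.card_sdiff_match x
  have h₅ := h.card_nonNeighbors i
  have h₆ := h.card_nonNeighbors x
  lia

theorem card_nonNeighbors_ne (h : IsMatchedSRSG N m a b c) (ha : a = 1) (hb : 0 < b) (i : V) :
    (#(nonNeighbors N m i) : ℤ) ≠ 5 - b := by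
  intro hcard
  have hcover : ∀ x y, y ≠ x → y ≠ m x → y ∈ N x ∨ m y ∈ N x := by
    intro x y hy₁ hy₂
    have heq : N (m x) \ N x = nonNeighbors N m x := by
      refine eq_of_subset_of_card_le (h.sdiff_match_subset x) ?_
      have h₁ := h.card_sdiff_match x
      have h₂ := h.card_nonNeighbors i
      have h₃ := h.card_nonNeighbors x
      lia
    by_contra! hy
    have : y ∈ N (m x) \ N x := heq ▸ mem_nonNeighbors.2 ⟨hy₁, hy₂, hy.1⟩
    exact hy.2 (h.mem_match.1 (mem_sdiff.1 this).1)
  have hmeet : ∀ x y, y ∈ N x → m y ∉ N x → ∃ k ∈ N x ∩ N (m x), k ∈ N y := by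
    intro x y hy hmy
    have h₁ := h.card_inter_neg x
    obtain ⟨k, hk⟩ : (N x ∩ N (m x)).Nonempty := by
      rw [← card_pos]
      lia
    obtain ⟨hk₁, hk₂⟩ := mem_inter.1 hk
    have hky₁ : k ≠ y := by
      rintro rfl
      exact hmy (h.mem_match.1 hk₂)
    have hky₂ : k ≠ m y := by
      rintro rfl
      exact hmy hk₁
    rcases hcover y k hky₁ hky₂ with hky | hky
    · exact ⟨k, hk, hky⟩
    · exact ⟨m k, h.mem_inter_match hk, hky⟩
  obtain ⟨x, hx, hmx⟩ := h.exists_mem_match_notMem i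
  obtain ⟨k, hk, hkx⟩ := hmeet i x hx hmx
  obtain ⟨u, hu, hui⟩ := hmeet x i (h.symm hx)
    fun hmi => hmx (h.mem_match.1 (h.symm hmi))
  have h₁ := h.card_inter_pos hx
  rw [if_neg hmx, ha, add_zero, Nat.cast_eq_one, card_eq_one] at h₁
  obtain ⟨w, hw⟩ := h₁
  have huniq : ∀ z, z ∈ N i → z ∈ N x → z = w := fun z hz hz' =>
    mem_singleton.1 (hw ▸ mem_inter.2 ⟨hz, hz'⟩)
  have hkw := huniq k (mem_inter.1 hk).1 hkx
  have huw := huniq u hui (mem_inter.1 hu).1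
  obtain rfl : k = u := hkw.trans huw.symm
  have hmw := huniq (m k) (mem_inter.1 (h.mem_inter_match hk)).1
    (mem_inter.1 (h.mem_inter_match hu)).1
  exact h.ne_self k (hmw.trans hkw.symm)

theorem b_eq_zero (h : IsMatchedSRSG N m a b c) (i : V) : b = 0 := by
  by_contra hb
  have hb₀ := h.b_nonneg i
  have hb₄ := h.b_le i
  have heven := h.even_b i
  have hodd := h.odd_card_nonNeighbors i
  have hsum := h.row_sum
  have hcard := h.card_nonNeighbors i
  have hle := h.le_card_nonNeighbors i
  have ha := h.a_nonneg i
  have hc := h.neg_two_le_c i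
  have hcneg := fun hc => h.card_nonNeighbors_of_c_neg hc i
  have ha₀ := fun ha => h.five_le_card_nonNeighbors ha i
  have ha₁ := fun ha => h.card_nonNeighbors_ne ha (by lia) i
  have hn : (Fintype.card V : ℤ) - 7 = #(nonNeighbors N m i) := by lia
  rw [hn] at hsum
  generalize #(nonNeighbors N m i) = d at *
  obtain ⟨e, rfl⟩ := hodd
  rcases lt_or_ge c 0 with hc₀ | hc₀
  · have hd := hcneg hc₀
    rw [hd] at hsum
    obtain rfl | rfl : b = 2 ∨ b = 4 := by grind
    all_goals lia
  · have hc₁ : c ≠ 0 := by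
      rintro rfl
      grind
    have hed : ((2 * e + 1 : ℕ) : ℤ) ≤ ((2 * e + 1 : ℕ) : ℤ) * c :=
      le_mul_of_one_le_right (by positivity) (by lia)
    have he : e ≤ 4 := by lia
    obtain rfl | rfl : b = 2 ∨ b = 4 := by grind
    all_goals
      obtain rfl | rfl : a = 0 ∨ a = 1 := by lia
      all_goals interval_cases e <;> simp at * <;> lia

end IsMatchedSRSG

section SignedGraph

variable {n : ℕ} {A : Matrix (Fin n) (Fin n) ℤ}

/-- The positive neighbours of `i` in the signed graph with adjacency matrix `A`. -/
def posNeighbors (A : Matrix (Fin n) (Fin n) ℤ) (i : Fin n) : Finset (Fin n) :=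
  {k | A i k = 1}

theorem mem_posNeighbors {i k : Fin n} : k ∈ posNeighbors A i ↔ A i k = 1 := by
  simp [posNeighbors]

theorem card_pos_neg_neighbors (hent : ∀ i j, A i j = -1 ∨ A i j = 0 ∨ A i j = 1)
    (hreg : ∀ i, #{j | A i j ≠ 0} = 6) (hnet : ∀ i, ∑ j, A i j = 4) (i : Fin n) :
    #{j | A i j = 1} = 5 ∧ #{j | A i j = -1} = 1 := by
  have h₁ : (∑ j, if A i j ≠ 0 then (1 : ℤ) else 0)
      = (∑ j, if A i j = 1 then (1 : ℤ) else 0) + ∑ j, if A i j = -1 then (1 : ℤ) else 0 := by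
    rw [← sum_add_distrib]
    refine sum_congr rfl fun j _ => ?_
    rcases hent i j with h | h | h <;> simp [h]
  have h₂ : ∑ j, A i j
      = (∑ j, if A i j = 1 then (1 : ℤ) else 0) - ∑ j, if A i j = -1 then (1 : ℤ) else 0 := by
    rw [← sum_sub_distrib]
    refine sum_congr rfl fun j _ => ?_
    rcases hent i j with h | h | h <;> simp [h]
  rw [hnet] at h₂
  rw [sum_boole, hreg] at h₁
  rw [sum_boole, sum_boole] at h₁ h₂
  lia

theorem exists_match (hent : ∀ i j, A i j = -1 ∨ A i j = 0 ∨ A i j = 1)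
    (hreg : ∀ i, #{j | A i j ≠ 0} = 6) (hnet : ∀ i, ∑ j, A i j = 4) :
    ∃ m : Fin n → Fin n, ∀ i j, A i j = -1 ↔ j = m i := by
  choose m hm using fun i => card_eq_one.1 (card_pos_neg_neighbors hent hreg hnet i).2
  refine ⟨m, fun i j => ?_⟩
  have := congrArg (j ∈ ·) (hm i)
  simpa using this

/-- The square of the adjacency matrix as a combination of `1`, `A`, the permutation matrix of the
negative matching and the all-ones matrix. -/
theorem sq_apply_eq {a b c : ℤ} {m : Fin n → Fin n} (hm : ∀ i j, A i j = -1 ↔ j = m i)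
    (hdiag : ∀ i, A i i = 0)
    (hent : ∀ i j, A i j = -1 ∨ A i j = 0 ∨ A i j = 1)
    (hAA : ∀ i, (A * A) i i = 6)
    (hpos : ∀ i j, A i j = 1 → (A * A) i j = a)
    (hneg : ∀ i j, A i j = -1 → (A * A) i j = b)
    (hnon : ∀ i j, i ≠ j → A i j = 0 → (A * A) i j = c) (i j : Fin n) :
    (A * A) i j = (if j = i then 6 - c else 0) + (a - c) * A i j
      + (if j = m i then a + b - 2 * c else 0) + c := by
  rcases eq_or_ne j i with rfl | hij
  · have : j ≠ m j := fun h => by simpa [hdiag] using (hm j j).2 h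
    simp [hAA, hdiag, this]
  · rcases hent i j with h | h | h
    · rw [hneg i j h, h, if_neg hij, if_pos ((hm i j).1 h)]
      ring
    · have : j ≠ m i := fun h' => by simpa [h] using (hm i j).2 h'
      simp [hnon i j hij.symm h, hij, h, this]
    · have : j ≠ m i := fun h' => by simpa [h] using (hm i j).2 h'
      simp [hpos i j h, hij, h, this]

theorem sq_apply_eq_card {m : Fin n → Fin n} (hm : ∀ i j, A i j = -1 ↔ j = m i)
    (hsymm : ∀ i j, A i j = A j i)
    (hent : ∀ i j, A i j = -1 ∨ A i j = 0 ∨ A i j = 1)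
    (hauto : ∀ i j, A i (m j) = A (m i) j) (hinv : Function.Involutive m)
    {i j : Fin n} (hij : i ≠ j) :
    (#(posNeighbors A i ∩ posNeighbors A j) : ℤ) = (A * A) i j + if A i (m j) = 1 then 2 else 0 := by
  have hdecomp : ∀ i k, A i k = (if A i k = 1 then 1 else 0) - if k = m i then 1 else 0 := by
    intro i k
    simp only [← hm i k]
    rcases hent i k with h | h | h <;> simp [h]
  have hcard : (#(posNeighbors A i ∩ posNeighbors A j) : ℤ)
      = ∑ k, (if A i k = 1 then 1 else 0) * if A j k = 1 then 1 else 0 := by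
    rw [posNeighbors, posNeighbors, ← filter_and, ← sum_boole]
    refine sum_congr rfl fun k _ => ?_
    rw [ite_zero_mul_ite_zero, one_mul]
  have hji : A j (m i) = A i (m j) := by rw [hauto, hsymm]
  have hterm : ∀ k, A i k * A k j
      = (if A i k = 1 then 1 else 0) * (if A j k = 1 then 1 else 0)
        - (if k = m j then (if A i k = 1 then 1 else 0) else 0)
        - if k = m i then (if A j k = 1 then 1 else 0) else 0 := by
    intro k
    rw [hsymm k j]
    by_cases hi : k = m i
    · have hj : k ≠ m j := fun hj => hij (hinv.injective (hi.symm.trans hj))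
      have hA := (hm i k).2 hi
      have := hdecomp j k
      grind
    · have := hdecomp i k
      have := hdecomp j k
      grind
  rw [hcard, Matrix.mul_apply, sum_congr rfl fun k _ => hterm k]
  simp only [sum_sub_distrib, sum_ite_eq', mem_univ, if_true, hji]
  split_ifs <;> ring

theorem isMatchedSRSG {a b c : ℤ} {m : Fin n → Fin n} (hm : ∀ i j, A i j = -1 ↔ j = m i)
    (hsymm : ∀ i j, A i j = A j i)
    (hdiag : ∀ i, A i i = 0)
    (hent : ∀ i j, A i j = -1 ∨ A i j = 0 ∨ A i j = 1)
    (hreg : ∀ i, #{j | A i j ≠ 0} = 6)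
    (hnet : ∀ i, ∑ j, A i j = 4)
    (hAA : ∀ i, (A * A) i i = 6)
    (hpos : ∀ i j, A i j = 1 → (A * A) i j = a)
    (hneg : ∀ i j, A i j = -1 → (A * A) i j = b)
    (hnon : ∀ i j, i ≠ j → A i j = 0 → (A * A) i j = c)
    (habc : a + b - 2 * c ≠ 0) (i₀ : Fin n) :
    IsMatchedSRSG (posNeighbors A) m a b c := by
  have hmatch : ∀ i, A i (m i) = -1 := fun i => (hm i _).2 rfl
  have hinv : Function.Involutive m := fun i => ((hm (m i) i).1 (hsymm _ _ ▸ hmatch i)).symm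
  have hne : ∀ i, m i ≠ i := fun i h => by
    have := hmatch i
    rw [h, hdiag] at this
    lia
  have hsq := sq_apply_eq hm hdiag hent hAA hpos hneg hnon
  have hcol : ∀ j, ∑ k, A k j = 4 := fun j => by simp_rw [hsymm _ j, hnet]
  have hauto : ∀ i j, A i (m j) = A (m i) j := by
    intro i j
    have hassoc : ∑ k, A i k * (A * A) k j = ∑ k, (A * A) i k * A k j := by
      rw [← Matrix.mul_apply, ← Matrix.mul_apply, mul_assoc]
    have hswap : ∀ k, (j = m k) = (k = m j) := fun k =>
      propext ⟨fun h => h ▸ (hinv k).symm, fun h => h ▸ (hinv j).symm⟩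
    have hl : ∑ k, A i k * (A * A) k j = (6 - c) * A i j + (a - c) * ∑ k, A i k * A k j
        + (a + b - 2 * c) * A i (m j) + c * 4 := by
      simp_rw [hsq, hswap, mul_add, sum_add_distrib, mul_ite, mul_zero, sum_ite_eq,
        sum_ite_eq', mem_univ, if_true, ← sum_mul, hnet, mul_sum]
      simp_rw [mul_left_comm]
      ring
    have hr : ∑ k, (A * A) i k * A k j = (6 - c) * A i j + (a - c) * ∑ k, A i k * A k j
        + (a + b - 2 * c) * A (m i) j + c * 4 := by
      simp_rw [hsq, add_mul, sum_add_distrib, ite_mul, zero_mul, sum_ite_eq',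
        mem_univ, if_true, ← mul_sum, hcol, mul_assoc, ← mul_sum]
    rw [hl, hr] at hassoc
    exact mul_left_cancel₀ habc (by linarith)
  have hcard := @sq_apply_eq_card n A m hm hsymm hent hauto hinv
  refine ⟨hinv, hne, ?_, ?_, ?_, ?_, ?_, ?_, ?_, ?_, ?_⟩
  · intro i j
    simp [mem_posNeighbors, hsymm i j]
  · simp [mem_posNeighbors, hdiag]
  · simp [mem_posNeighbors, hmatch]
  · simp [mem_posNeighbors, hauto]
  · exact fun i => (card_pos_neg_neighbors hent hreg hnet i).1
  · intro i j hj
    simp only [mem_posNeighbors] at hj ⊢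
    rw [hcard, hpos i j hj]
    rintro rfl
    simp [hdiag] at hj
  · intro i
    rw [hcard (hne i).symm, hneg i _ (hmatch i), hinv, hdiag]
    simp
  · intro i j hji hjm hj
    simp only [mem_posNeighbors] at hj ⊢
    rw [hcard hji.symm, hnon i j hji.symm]
    rcases hent i j with h | h | h
    · exact absurd ((hm i j).1 h) hjm
    · exact h
    · exact absurd h hj
  · have h₁ : ∑ j, (A * A) i₀ j = 16 := by
      simp_rw [Matrix.mul_apply]
      rw [sum_comm]
      simp_rw [← mul_sum, hnet, ← sum_mul, hnet]
      norm_num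
    simp_rw [hsq, sum_add_distrib, ← mul_sum, hnet, sum_ite_eq', mem_univ, if_true] at h₁
    simp at h₁ ⊢
    linarith

end SignedGraph


theorem stmt2 {n : ℕ} (A : Matrix (Fin n) (Fin n) ℤ) (a b c : ℤ)
    (hsymm : ∀ i j, A i j = A j i)
    (hdiag : ∀ i, A i i = 0)
    (hent : ∀ i j, A i j = -1 ∨ A i j = 0 ∨ A i j = 1)
    (hconn : (SimpleGraph.fromRel (fun i j => A i j ≠ 0)).Connected)
    (hncomp : ¬ ∀ i j : Fin n, i ≠ j → A i j ≠ 0)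
    (hinhom : (∃ i j, A i j = 1) ∧ (∃ i j, A i j = -1))
    (hreg : ∀ i, (Finset.univ.filter (fun j => A i j ≠ 0)).card = 6)
    (hnet : ∀ i, ∑ j, A i j = 4)
    (hAA : ∀ i, (A * A) i i = 6)
    (hpos : ∀ i j, A i j = 1 → (A * A) i j = a)
    (hneg : ∀ i j, A i j = -1 → (A * A) i j = b)
    (hnon : ∀ i j, i ≠ j → A i j = 0 → (A * A) i j = c)
    (hclass : ¬(a = -b ∧ c = 0) ∧ ¬(a ≠ -b ∧ 2 * c = a + b)) :
    b = 0 ∧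
    (∀ i j k : Fin n, A i j = -1 → ¬(A i k ≠ 0 ∧ A j k ≠ 0)) ∧
    (a = 0 ∨ a = 1 ∨ a = 2 ∨ a = 3 ∨ a = 4) := by
  obtain ⟨i₀, -⟩ := hinhom.1
  obtain ⟨m, hm⟩ := exists_match hent hreg hnet
  have habc : a + b - 2 * c ≠ 0 := by
    intro h
    have h₁ := hclass.1
    have h₂ := hclass.2
    lia
  have h := isMatchedSRSG hm hsymm hdiag hent hreg hnet hAA hpos hneg hnon habc i₀
  have hb := h.b_eq_zero i₀
  refine ⟨hb, ?_, ?_⟩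
  · rintro i j k hij ⟨hik, hjk⟩
    have hcard := h.card_inter_neg i
    rw [hb, Nat.cast_eq_zero, card_eq_zero, ← (hm i j).1 hij] at hcard
    have hk : ∀ x y, A x y = -1 → A x k ≠ 0 → A y k ≠ 0 → A x k = 1 := by
      intro x y hxy hxk hyk
      rcases hent x k with h' | h' | h'
      · rw [(hm x k).1 h', ← (hm x y).1 hxy, hdiag] at hyk
        exact absurd rfl hyk
      · exact absurd h' hxk
      · exact h'
    have : k ∈ posNeighbors A i ∩ posNeighbors A j := by
      simp [mem_posNeighbors, hk i j hij hik hjk, hk j i (hsymm i j ▸ hij) hjk hik]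
    simp [hcard] at this
  · have h₁ := h.a_nonneg i₀
    have h₂ := h.a_le i₀
    lia
end

section
/- Let A be the adjacency matrix of a connected, 6-regular and 4 net-regular strongly regular signed graph with parameters (12, 6, 0, 0, 2). Then the underlying simple graph of A (with adjacency relation A i j ≠ 0) is isomorphic to the complete bipartite graph K_{6,6}. -/
open Finset in
/-- A triangle-free `d`-regular graph on `2 * d` vertices with `d ≠ 0` is complete bipartite. -/
theorem SimpleGraph.nonempty_iso_completeBipartiteGraph {V : Type*} [Fintype V] [DecidableEq V]
    (G : SimpleGraph V) [DecidableRel G.Adj] {d : ℕ} (hd : d ≠ 0)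
    (hcard : Fintype.card V = 2 * d) (hreg : G.IsRegularOfDegree d)
    (htri : ∀ i j k, G.Adj i j → G.Adj j k → ¬ G.Adj i k) :
    Nonempty (G ≃g completeBipartiteGraph (Fin d) (Fin d)) := by
  have : Nonempty V := Fintype.card_pos_iff.mp (by lia)
  obtain ⟨v⟩ := this
  have hdeg (u : V) : #(G.neighborFinset u) = d := hreg u
  have hcompl : #(G.neighborFinset v)ᶜ = d := by
    rw [card_compl, hdeg, hcard]; lia
  have hin (u : V) (hu : G.Adj v u) : G.neighborFinset u = (G.neighborFinset v)ᶜ := by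
    refine eq_of_subset_of_card_le (fun w hw => ?_) (by rw [hcompl, hdeg])
    simp only [mem_compl, SimpleGraph.mem_neighborFinset] at hw ⊢
    exact htri v u w hu hw
  have hout (w : V) (hw : ¬ G.Adj v w) : G.neighborFinset v = G.neighborFinset w := by
    refine eq_of_subset_of_card_le (fun u hu => ?_) (by rw [hdeg, hdeg])
    rw [SimpleGraph.mem_neighborFinset] at hu ⊢
    have : w ∈ G.neighborFinset u := by simpa [hin u hu] using hw
    exact ((G.mem_neighborFinset u w).mp this).symm
  have hadj (i j : V) : G.Adj i j ↔ ¬ (G.Adj v i ↔ G.Adj v j) := by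
    by_cases hi : G.Adj v i
    · have := congrArg (j ∈ ·) (hin i hi)
      simp only [mem_compl, SimpleGraph.mem_neighborFinset, eq_iff_iff] at this
      tauto
    · have := congrArg (j ∈ ·) (hout i hi)
      simp only [SimpleGraph.mem_neighborFinset, eq_iff_iff] at this
      tauto
  have hcardAdj : Fintype.card {u // G.Adj v u} = d := by
    rw [← hdeg v, Fintype.card_subtype, SimpleGraph.neighborFinset_eq_filter]
  have hcardNot : Fintype.card {u // ¬ G.Adj v u} = d := by
    rw [Fintype.card_subtype_compl, hcardAdj, hcard]; lia
  let e : Fin d ⊕ Fin d ≃ V :=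
    (Equiv.sumCongr (Fintype.equivFinOfCardEq hcardAdj).symm
      (Fintype.equivFinOfCardEq hcardNot).symm).trans (Equiv.sumCompl (G.Adj v))
  have hl (x : Fin d) : G.Adj v (e (.inl x)) :=
    ((Fintype.equivFinOfCardEq hcardAdj).symm x).2
  have hr (x : Fin d) : ¬ G.Adj v (e (.inr x)) :=
    ((Fintype.equivFinOfCardEq hcardNot).symm x).2
  refine ⟨(SimpleGraph.Iso.symm ⟨e, fun {x y} => ?_⟩)⟩
  rw [hadj]
  rcases x with x | x <;> rcases y with y | y <;> simp [hl, hr]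

/-- If the diagonal of `A ^ 2` exceeds the row sums by less than four, every row of a symmetric
`{-1, 0, 1}`-matrix has at most one entry `-1`. -/
theorem eq_of_entry_eq_neg_one {V : Type*} [Fintype V] [DecidableEq V] {A : Matrix V V ℤ}
    (hsymm : ∀ i j, A i j = A j i) {i j k : V}
    (hrow : (A * A) i i - ∑ l, A i l < 4) (hj : A i j = -1) (hk : A i k = -1) : j = k := by
  by_contra hjk
  have hnonneg (l : V) : 0 ≤ A i l * A l i - A i l := by
    rw [hsymm l i]
    rcases le_or_gt (A i l) 0 with h | h <;> nlinarith
  have hle := Finset.sum_le_sum_of_subset_of_nonneg (Finset.subset_univ {j, k})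
    (f := fun l => A i l * A l i - A i l) fun l _ _ => hnonneg l
  rw [Finset.sum_pair hjk, Finset.sum_sub_distrib, ← Matrix.mul_apply, hsymm j i, hsymm k i,
    hj, hk] at hle
  lia

/-- A signed graph with at most one negative edge at each vertex, in which `A ^ 2` vanishes on
adjacent pairs, has no triangles. -/
theorem entry_eq_zero_of_mul_self_eq_zero {V : Type*} [Fintype V] {A : Matrix V V ℤ}
    (hsymm : ∀ i j, A i j = A j i) (hdiag : ∀ i, A i i = 0)
    (hent : ∀ i j, A i j = -1 ∨ A i j = 0 ∨ A i j = 1)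
    (huniq : ∀ i j k, A i j = -1 → A i k = -1 → j = k)
    (hadj : ∀ i j, A i j ≠ 0 → (A * A) i j = 0)
    {i j k : V} (hij : A i j ≠ 0) (hjk : A j k ≠ 0) : A i k = 0 := by
  have hzero {i j : V} (hij : A i j ≠ 0) (hnonneg : ∀ k, 0 ≤ A i k * A k j) (k : V) :
      A i k * A k j = 0 := by
    have h := hadj i j hij
    rw [Matrix.mul_apply, Finset.sum_eq_zero_iff_of_nonneg fun k _ => hnonneg k] at h
    exact h k (Finset.mem_univ k)
  have hneg {i j : V} (hij : A i j = -1) : ∀ k, A i k * A k j = 0 := by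
    refine hzero (by simp [hij]) fun k => ?_
    by_cases hik : A i k = -1
    · simp [huniq i k j hik hij, hdiag]
    by_cases hkj : A k j = -1
    · simp [huniq j k i (by rw [hsymm, hkj]) (by rw [hsymm, hij]), hdiag]
    rcases hent i k with h | h | h <;> rcases hent k j with h' | h' | h' <;> simp_all
  have hall {i j : V} (hij : A i j ≠ 0) : ∀ k, A i k * A k j = 0 := by
    refine hzero hij fun k => ?_
    rcases hent i k with h | h | h <;> rcases hent k j with h' | h' | h' <;>
      simp only [h, h'] <;> norm_num
    · have := hneg h j
      rw [hsymm j k, h'] at this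
      lia
    · have := hneg h' i
      rw [hsymm k i, h] at this
      lia
  by_contra hik
  have h := hall hik j
  simp_all


theorem stmt3 (A : Matrix (Fin 12) (Fin 12) ℤ)
    (hsymm : ∀ i j, A i j = A j i)
    (hdiag : ∀ i, A i i = 0)
    (hent : ∀ i j, A i j = -1 ∨ A i j = 0 ∨ A i j = 1)
    (hconn : (SimpleGraph.fromRel (fun i j => A i j ≠ 0)).Connected)
    (hreg : ∀ i, (Finset.univ.filter (fun j => A i j ≠ 0)).card = 6)
    (hnet : ∀ i, ∑ j, A i j = 4)
    (hAA : ∀ i, (A * A) i i = 6)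
    (hpos : ∀ i j, A i j = 1 → (A * A) i j = 0)
    (hneg : ∀ i j, A i j = -1 → (A * A) i j = 0)
    (hnon : ∀ i j, i ≠ j → A i j = 0 → (A * A) i j = 2) :
    Nonempty ((SimpleGraph.fromRel (fun i j => A i j ≠ 0)) ≃g
      completeBipartiteGraph (Fin 6) (Fin 6)) := by
  classical
  have huniq (i j k : Fin 12) : A i j = -1 → A i k = -1 → j = k :=
    eq_of_entry_eq_neg_one hsymm (by rw [hAA, hnet]; norm_num)
  have hadj (i j : Fin 12) (hij : A i j ≠ 0) : (A * A) i j = 0 := by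
    rcases hent i j with h | h | h
    exacts [hneg i j h, absurd h hij, hpos i j h]
  have hfromRel (i j : Fin 12) :
      (SimpleGraph.fromRel fun i j => A i j ≠ 0).Adj i j ↔ A i j ≠ 0 := by
    rw [SimpleGraph.fromRel_adj, hsymm j i, or_self, and_iff_right_iff_imp]
    rintro h rfl
    exact h (hdiag i)
  refine SimpleGraph.nonempty_iso_completeBipartiteGraph _ (by norm_num) (by simp) (fun i => ?_)
    fun i j k => ?_
  · rw [← SimpleGraph.card_neighborFinset_eq_degree, SimpleGraph.neighborFinset_eq_filter,
      ← hreg i]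
    simp only [hfromRel]
  · simp only [hfromRel, not_not]
    exact entry_eq_zero_of_mul_self_eq_zero hsymm hdiag hent huniq hadj
end

section
/- Let A be the adjacency matrix of a connected, non-complete, inhomogeneous, 6-regular and 2 net-regular strongly regular signed graph with parameters (n, 6, a, b, c) lying in the class C1 ∪ C4 ∪ C5. Then: (1) a ≠ -3; (2) if a = -4 then n = 8, b = 4 and c = 6; (3) b ≠ 5; (4) if b = 4 then a = -4. -/
open Finset

/-- Positive and negative neighbourhoods of a signed graph with positive degree `4` and negative
degree `2` whose positive and negative adjacency matrices commute. -/
structure CommutingNeighborhoods {V : Type*} [DecidableEq V] (P N : V → Finset V) : Prop where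
  symm_pos : ∀ i j, j ∈ P i → i ∈ P j
  symm_neg : ∀ i j, j ∈ N i → i ∈ N j
  irrefl_pos : ∀ i, i ∉ P i
  irrefl_neg : ∀ i, i ∉ N i
  disj : ∀ i, Disjoint (P i) (N i)
  card_pos : ∀ i, #(P i) = 4
  card_neg : ∀ i, #(N i) = 2
  comm : ∀ i j, #(P i ∩ N j) = #(N i ∩ P j)

/-- The entry of the squared adjacency matrix, in terms of signed neighbourhoods. -/
def walkSum {V : Type*} [DecidableEq V] (P N : V → Finset V) (i j : V) : ℤ :=
  #(P i ∩ P j) + #(N i ∩ N j) - #(P i ∩ N j) - #(N i ∩ P j)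

theorem Finset.subset_of_card_le_card_inter {V : Type*} [DecidableEq V] {X Y : Finset V}
    (h : #X ≤ #(X ∩ Y)) : X ⊆ Y :=
  inter_eq_left.1 (eq_of_subset_of_card_le inter_subset_left h)

namespace CommutingNeighborhoods

variable {V : Type*} [DecidableEq V] {P N : V → Finset V}

theorem nonempty_pos (h : CommutingNeighborhoods P N) (i : V) : (P i).Nonempty :=
  Finset.card_pos.1 (by rw [h.card_pos]; norm_num)

theorem card_inter_add_card_inter_le (h : CommutingNeighborhoods P N) (X : Finset V) (j : V) :
    #(X ∩ P j) + #(X ∩ N j) ≤ #(X.erase j) := by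
  rw [← card_union_of_disjoint
    ((h.disj j).mono inter_subset_right inter_subset_right)]
  refine card_le_card fun x hx => ?_
  have := h.irrefl_pos j
  have := h.irrefl_neg j
  simp only [mem_union, mem_inter, mem_erase] at hx ⊢
  refine ⟨?_, by tauto⟩
  rintro rfl
  tauto

theorem bounds_of_mem_pos (h : CommutingNeighborhoods P N) {i j : V} (hij : j ∈ P i) :
    #(P i ∩ P j) + #(P i ∩ N j) ≤ 3 ∧ #(N i ∩ P j) + #(N i ∩ N j) ≤ 2 := by
  have h1 := h.card_inter_add_card_inter_le (P i) j
  have h2 := h.card_inter_add_card_inter_le (N i) j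
  rw [card_erase_of_mem hij, h.card_pos] at h1
  exact ⟨h1, h2.trans ((card_erase_le).trans (h.card_neg i).le)⟩

theorem bounds_of_mem_neg (h : CommutingNeighborhoods P N) {i j : V} (hij : j ∈ N i) :
    #(P i ∩ P j) + #(P i ∩ N j) ≤ 4 ∧ #(N i ∩ P j) + #(N i ∩ N j) ≤ 1 := by
  have h1 := h.card_inter_add_card_inter_le (P i) j
  have h2 := h.card_inter_add_card_inter_le (N i) j
  rw [card_erase_of_mem hij, h.card_neg] at h2
  exact ⟨h1.trans ((card_erase_le).trans (h.card_pos i).le), h2⟩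

theorem pos_eq_of_card (h : CommutingNeighborhoods P N) {i j : V} (hc : 4 ≤ #(P i ∩ P j)) :
    P i = P j :=
  eq_of_subset_of_card_le (subset_of_card_le_card_inter (by rw [h.card_pos]; exact hc))
    (by rw [h.card_pos, h.card_pos])

theorem card_eq_of_walkSum_eq_neg_three (h : CommutingNeighborhoods P N) {i j : V}
    (hij : j ∈ P i) (hw : walkSum P N i j = -3) :
    #(P i ∩ P j) = 1 ∧ #(P i ∩ N j) = 2 ∧ #(N i ∩ P j) = 2 := by
  have := h.bounds_of_mem_pos hij
  have := h.comm i j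
  unfold walkSum at hw
  omega

theorem card_eq_of_walkSum_eq_neg_four (h : CommutingNeighborhoods P N) {i j : V}
    (hij : j ∈ P i) (hw : walkSum P N i j = -4) :
    #(P i ∩ P j) = 0 ∧ #(P i ∩ N j) = 2 ∧ #(N i ∩ P j) = 2 := by
  have := h.bounds_of_mem_pos hij
  have := h.comm i j
  unfold walkSum at hw
  omega

theorem card_eq_of_walkSum_eq_five (h : CommutingNeighborhoods P N) {i j : V}
    (hij : j ∈ N i) (hw : walkSum P N i j = 5) :
    #(P i ∩ P j) = 4 ∧ #(N i ∩ N j) = 1 := by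
  have := h.bounds_of_mem_neg hij
  have := h.comm i j
  unfold walkSum at hw
  omega

theorem card_eq_of_walkSum_eq_four (h : CommutingNeighborhoods P N) {i j : V}
    (hij : j ∈ N i) (hw : walkSum P N i j = 4) :
    #(P i ∩ P j) + #(N i ∩ N j) = 4 ∧ #(N i ∩ N j) ≤ 1 ∧ #(P i ∩ N j) = 0 := by
  have := h.bounds_of_mem_neg hij
  have := h.comm i j
  unfold walkSum at hw
  omega

theorem neg_subset (h : CommutingNeighborhoods P N) {i : V} {X : Finset V}
    (hc : #(N i ∩ X) = 2) : N i ⊆ X :=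
  subset_of_card_le_card_inter (by rw [h.card_neg, hc])

/-- If `N i ⊆ P u`, then `N u ⊆ P i`. -/
theorem neg_subset_pos_symm (h : CommutingNeighborhoods P N) {i u : V} (hs : N i ⊆ P u) :
    N u ⊆ P i := by
  refine h.neg_subset ?_
  rw [← h.comm u i, inter_eq_right.2 hs, h.card_neg]

theorem adj_of_walkSum_neg_three (h : CommutingNeighborhoods P N)
    (hconn : ∀ S : Set V, S.Nonempty → (∀ w ∈ S, ∀ x, x ∈ P w ∪ N w → x ∈ S) → S = Set.univ)
    (hw : ∀ i, ∀ j ∈ P i, walkSum P N i j = -3) (i j : V) (hij : i ≠ j) :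
    j ∈ P i ∪ N i := by
  set C : V → Finset V := fun v => insert v (P v ∪ N v) with hC
  have cardC (v : V) : #(C v) = 7 := by
    rw [hC, card_insert_of_notMem, card_union_of_disjoint (h.disj v), h.card_pos, h.card_neg]
    simp [h.irrefl_pos, h.irrefl_neg]
  have hpos {v u : V} (hu : u ∈ P v) : C v = C u := by
    obtain ⟨h1, h2, h3⟩ := h.card_eq_of_walkSum_eq_neg_three hu (hw v u hu)
    have hP : (P v).erase u ⊆ P u ∪ N u := by
      refine subset_of_card_le_card_inter ?_
      rw [inter_union_distrib_left, card_union_of_disjoint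
        ((h.disj u).mono inter_subset_right inter_subset_right), card_erase_of_mem hu,
        h.card_pos, erase_inter, erase_inter, erase_eq_of_notMem, erase_eq_of_notMem, h1, h2]
      · simp [h.irrefl_neg]
      · simp [h.irrefl_pos]
    have hN : N v ⊆ P u := h.neg_subset h3
    refine eq_of_subset_of_card_le (fun x hx => ?_) (by rw [cardC, cardC])
    have hvu := h.symm_pos v u hu
    simp only [hC, mem_insert, mem_union] at hx ⊢
    rcases hx with rfl | hx | hx
    · exact Or.inr (Or.inl hvu)
    · by_cases hxu : x = u
      · exact Or.inl hxu
      · exact Or.inr (mem_union.1 (hP (mem_erase.2 ⟨hxu, hx⟩)))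
    · exact Or.inr (Or.inl (hN hx))
  have hneg {v u : V} (hu : u ∈ N v) : C v = C u := by
    obtain ⟨x, hx⟩ : (P v).Nonempty := h.nonempty_pos v
    have h3 := (h.card_eq_of_walkSum_eq_neg_three hx (hw v x hx)).2.2
    rw [hpos hx, hpos (h.neg_subset h3 hu)]
  have huniv := hconn {w | C w = C i} ⟨i, rfl⟩ fun w hwi x hx => by
    rcases mem_union.1 hx with hx | hx
    · exact (hpos hx).symm.trans hwi
    · exact (hneg hx).symm.trans hwi
  have hj : C j = C i := by
    have : j ∈ {w | C w = C i} := huniv ▸ Set.mem_univ j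
    exact this
  have : j ∈ C i := hj ▸ mem_insert_self j _
  exact (mem_insert.1 this).resolve_left hij.symm

theorem false_of_walkSum_five (h : CommutingNeighborhoods P N) (i : V)
    (hw : ∀ i, ∀ j ∈ N i, walkSum P N i j = 5) : False := by
  have hP {v u : V} (hu : u ∈ N v) : P v = P u :=
    h.pos_eq_of_card (h.card_eq_of_walkSum_eq_five hu (hw v u hu)).1.ge
  have hsub {v u : V} (hu : u ∈ P v) : N u ⊆ P v :=
    h.neg_subset_pos_symm fun j hj => h.symm_pos _ _ (hP hj ▸ hu)
  obtain ⟨u, hu⟩ : (P i).Nonempty := h.nonempty_pos i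
  obtain ⟨w₁, w₂, hne, hN⟩ := card_eq_two.1 (h.card_neg u)
  have hw₁ : w₁ ∈ N u := by simp [hN]
  have hw₂ : w₂ ∈ N u := by simp [hN]
  have hw₁₂ : w₂ ∈ N w₁ := by
    have hc := (h.card_eq_of_walkSum_eq_five hw₁ (hw u w₁ hw₁)).2
    obtain ⟨y, hy⟩ := Finset.card_pos.1 (hc ▸ one_pos)
    rw [mem_inter, hN, mem_insert, mem_singleton] at hy
    rcases hy with ⟨rfl | rfl, hy⟩
    · exact absurd hy (h.irrefl_neg _)
    · exact hy
  have hclosed (v) (hv : v ∈ N u ∨ v = u) : N v ⊆ {u, w₁, w₂} := by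
    have huw₁ := h.symm_neg _ _ hw₁
    have huw₂ := h.symm_neg _ _ hw₂
    have hw₂₁ := h.symm_neg _ _ hw₁₂
    have key {v x y : V} (hxy : x ≠ y) (hx : x ∈ N v) (hy : y ∈ N v) : N v = {x, y} :=
      (eq_of_subset_of_card_le (by simp [insert_subset_iff, hx, hy])
        (by rw [h.card_neg, card_pair hxy])).symm
    have hu₁ : u ≠ w₁ := fun e => h.irrefl_neg u (e ▸ hw₁)
    have hu₂ : u ≠ w₂ := fun e => h.irrefl_neg u (e ▸ hw₂)
    rw [hN, mem_insert, mem_singleton] at hv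
    rcases hv with (rfl | rfl) | rfl
    · rw [key hu₂ huw₁ hw₁₂]; grind
    · rw [key hu₁ huw₂ hw₂₁]; grind
    · rw [hN]; grind
  set T : Finset V := {u, w₁, w₂} with hT
  have hTN (v) (hv : v ∈ T) : v ∈ N u ∨ v = u := by
    rw [hN]; simp only [hT, mem_insert, mem_singleton] at hv ⊢; tauto
  have hTP : T ⊆ P i := by
    have h1 := hsub hu hw₁
    have h2 := hsub hu hw₂
    simp [hT, insert_subset_iff, hu, h1, h2]
  obtain ⟨x, hx, hxT⟩ := exists_mem_notMem_of_card_lt_card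
    (s := T) (t := P i) (by rw [h.card_pos]; exact card_le_three.trans_lt (by norm_num))
  have hlt : #(N x) ≤ #(((P i) \ T).erase x) := by
    refine card_le_card fun y hy => mem_erase.2 ⟨?_, mem_sdiff.2 ⟨hsub hx hy, fun hyT => ?_⟩⟩
    · rintro rfl; exact h.irrefl_neg _ hy
    · exact hxT (hclosed y (hTN y hyT) (h.symm_neg _ _ hy))
  have hT3 : #T = 3 := by
    refine card_eq_three.2 ⟨u, w₁, w₂, ?_, ?_, hne, rfl⟩
    · rintro rfl; exact h.irrefl_neg _ hw₁
    · rintro rfl; exact h.irrefl_neg _ hw₂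
  rw [card_erase_of_mem (mem_sdiff.2 ⟨hx, hxT⟩), card_sdiff_of_subset hTP, hT3, h.card_pos,
    h.card_neg] at hlt
  omega

/-- When `b = 4`, negative triangles are impossible. -/
theorem card_neg_inter_eq_zero (h : CommutingNeighborhoods P N) {a : ℤ}
    (ha : ∀ i, ∀ j ∈ P i, walkSum P N i j = a) (hw : ∀ i, ∀ j ∈ N i, walkSum P N i j = 4)
    {i j : V} (hij : j ∈ N i) : #(N i ∩ N j) = 0 := by
  by_contra hne
  obtain ⟨k, hk⟩ := Finset.card_pos.1 (Nat.pos_of_ne_zero hne)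
  obtain ⟨hki, hkj⟩ := mem_inter.1 hk
  have hjk : j ≠ k := fun e => h.irrefl_neg j (e ▸ hkj)
  have hNi : {j, k} = N i :=
    eq_of_subset_of_card_le (by simp [insert_subset_iff, hij, hki])
      (by rw [h.card_neg, card_pair hjk])
  have hmixed {v w u : V} (hvw : w ∈ N v) (hu : u ∈ P v) : u ∉ N w := fun hu' => by
    have := (h.card_eq_of_walkSum_eq_four hvw (hw v w hvw)).2.2
    exact (Finset.card_pos.2 ⟨u, mem_inter.2 ⟨hu, hu'⟩⟩).ne' this
  have hm {u : V} (hu : u ∈ P i) : #(N i ∩ N u) = 0 := by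
    refine card_eq_zero.2 (eq_empty_of_forall_notMem fun x hx => ?_)
    obtain ⟨hx, hxu⟩ := mem_inter.1 hx
    exact hmixed hx hu (h.symm_neg _ _ hxu)
  have hPj : #(P i ∩ P j) = 3 := by
    have := h.card_eq_of_walkSum_eq_four hij (hw i j hij)
    omega
  have hPk : 3 ≤ #(P i ∩ P k) := by
    have := h.card_eq_of_walkSum_eq_four hki (hw i k hki)
    omega
  obtain ⟨u, hu, huj⟩ : ∃ u ∈ P i, u ∉ P j := by
    obtain ⟨u, hu, hu'⟩ := exists_mem_notMem_of_card_lt_card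
      (s := P i ∩ P j) (t := P i) (by rw [h.card_pos, hPj]; norm_num)
    exact ⟨u, hu, fun hj => hu' (mem_inter.2 ⟨hu, hj⟩)⟩
  obtain ⟨v, hv⟩ : ((P i ∩ P j) ∩ (P i ∩ P k)).Nonempty := by
    refine Finset.card_pos.1 ?_
    have h1 := card_union_add_card_inter (P i ∩ P j) (P i ∩ P k)
    have h2 : #((P i ∩ P j) ∪ (P i ∩ P k)) ≤ 4 := by
      rw [← h.card_pos i]
      exact card_le_card (union_subset inter_subset_left inter_subset_left)
    omega
  simp only [mem_inter] at hv
  obtain ⟨⟨hvi, hvj⟩, -, hvk⟩ := hv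
  have htu : #(N i ∩ P u) ≤ 1 := by
    have : N i ∩ P u ⊆ {k} := fun x hx => by
      rw [mem_inter, ← hNi, mem_insert, mem_singleton] at hx
      rcases hx with ⟨rfl | rfl, hx⟩
      · exact absurd (h.symm_pos _ _ hx) huj
      · simp
    simpa using card_le_card this
  have htv : #(N i ∩ P v) = 2 := by
    rw [inter_eq_left.2, h.card_neg]
    rw [← hNi, insert_subset_iff, singleton_subset_iff]
    exact ⟨h.symm_pos _ _ hvj, h.symm_pos _ _ hvk⟩
  have hu' := ha i u hu
  have hv' := ha i v hvi
  have hbv := h.bounds_of_mem_pos hvi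
  have := h.comm i u
  have := h.comm i v
  have := hm hu
  have := hm hvi
  unfold walkSum at hu' hv'
  omega

theorem eq_neg_three_or_neg_four (h : CommutingNeighborhoods P N) (i : V) {a : ℤ}
    (ha : ∀ i, ∀ j ∈ P i, walkSum P N i j = a) (hw : ∀ i, ∀ j ∈ N i, walkSum P N i j = 4) :
    a = -3 ∨ a = -4 := by
  obtain ⟨u, hu⟩ : (P i).Nonempty := h.nonempty_pos i
  have hP {j : V} (hj : j ∈ N i) : P i = P j := by
    refine h.pos_eq_of_card ?_
    have := h.card_neg_inter_eq_zero ha hw hj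
    have := (h.card_eq_of_walkSum_eq_four hj (hw i j hj)).1
    omega
  have ht : #(N i ∩ P u) = 2 := by
    rw [inter_eq_left.2, h.card_neg]
    exact fun j hj => h.symm_pos _ _ (hP hj ▸ hu)
  have := ha i u hu
  have := h.bounds_of_mem_pos hu
  have := h.comm i u
  unfold walkSum at *
  omega

theorem pos_eq_of_walkSum_neg_four (h : CommutingNeighborhoods P N)
    (hw : ∀ i, ∀ j ∈ P i, walkSum P N i j = -4) {i j : V} (hij : j ∈ N i) : P i = P j := by
  refine eq_of_subset_of_card_le (fun u hu => ?_) (by rw [h.card_pos, h.card_pos])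
  have := (h.card_eq_of_walkSum_eq_neg_four hu (hw i u hu)).2.2
  exact h.symm_pos _ _ (h.neg_subset this hij)

theorem walkSum_neg_of_walkSum_neg_four (h : CommutingNeighborhoods P N)
    (hw : ∀ i, ∀ j ∈ P i, walkSum P N i j = -4) {i j : V} (hij : j ∈ N i) :
    walkSum P N i j = 4 ∨ walkSum P N i j = 5 := by
  have hP : #(P i ∩ P j) = 4 := by
    rw [← h.pos_eq_of_walkSum_neg_four hw hij, inter_self, h.card_pos]
  have := h.bounds_of_mem_neg hij
  have := h.comm i j
  unfold walkSum
  omega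

theorem neg_subset_pos_of_walkSum_neg_four (h : CommutingNeighborhoods P N)
    (hw : ∀ i, ∀ j ∈ P i, walkSum P N i j = -4) {v x : V} (hx : x ∈ P v) : N x ⊆ P v :=
  h.neg_subset_pos_symm (h.neg_subset (h.card_eq_of_walkSum_eq_neg_four hx (hw v x hx)).2.2)

/-- When `a = -4`, all positive neighbours of a vertex have the same positive neighbourhood. -/
theorem pos_eq_of_mem_pos (h : CommutingNeighborhoods P N)
    (hw : ∀ i, ∀ j ∈ P i, walkSum P N i j = -4) {u i l : V} (hi : i ∈ P u) (hl : l ∈ P u) :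
    P l = P i := by
  by_cases hli : l = i
  · rw [hli]
  by_cases hlN : l ∈ N i
  · exact (h.pos_eq_of_walkSum_neg_four hw hlN).symm
  have hiN : i ∉ N l := fun hil => hlN (h.symm_neg _ _ hil)
  have hcap : (N l ∩ N i).Nonempty := by
    have hun : N l ∪ N i ⊆ ((P u).erase i).erase l := fun x hx => by
      have hxP : x ∈ P u := (mem_union.1 hx).elim
        (fun k => h.neg_subset_pos_of_walkSum_neg_four hw hl k)
        (fun k => h.neg_subset_pos_of_walkSum_neg_four hw hi k)
      refine mem_erase.2 ⟨?_, mem_erase.2 ⟨?_, hxP⟩⟩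
      · rintro rfl
        exact (mem_union.1 hx).elim (h.irrefl_neg _) hlN
      · rintro rfl
        exact (mem_union.1 hx).elim hiN (h.irrefl_neg _)
    have h1 := card_le_card hun
    rw [card_erase_of_mem (mem_erase.2 ⟨hli, hl⟩), card_erase_of_mem hi, h.card_pos] at h1
    have h2 := card_union_add_card_inter (N l) (N i)
    rw [h.card_neg, h.card_neg] at h2
    exact Finset.card_pos.1 (by omega)
  obtain ⟨x, hx⟩ := hcap
  rw [mem_inter] at hx
  rw [h.pos_eq_of_walkSum_neg_four hw hx.1, h.pos_eq_of_walkSum_neg_four hw hx.2]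

theorem card_eq_eight [Fintype V] (h : CommutingNeighborhoods P N)
    (hconn : ∀ S : Set V, S.Nonempty → (∀ w ∈ S, ∀ x, x ∈ P w ∪ N w → x ∈ S) → S = Set.univ)
    (hw : ∀ i, ∀ j ∈ P i, walkSum P N i j = -4) (i : V) : Fintype.card V = 8 := by
  obtain ⟨u, hu⟩ : (P i).Nonempty := h.nonempty_pos i
  have hiu := h.symm_pos _ _ hu
  have huniv := hconn {w | w ∈ P i ∪ P u} ⟨u, mem_union_left _ hu⟩ fun w hwS x hx => by
    simp only [Set.mem_ofPred_eq, mem_union] at hwS hx ⊢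
    rcases hwS with hwi | hwu
    · rcases hx with hx | hx
      · exact Or.inr (h.pos_eq_of_mem_pos hw hu hwi ▸ hx)
      · exact Or.inl (h.neg_subset_pos_of_walkSum_neg_four hw hwi hx)
    · rcases hx with hx | hx
      · exact Or.inl (h.pos_eq_of_mem_pos hw hiu hwu ▸ hx)
      · exact Or.inr (h.neg_subset_pos_of_walkSum_neg_four hw hwu hx)
  have huniv' : P i ∪ P u = univ := eq_univ_of_forall fun x => by
    have : x ∈ {w | w ∈ P i ∪ P u} := huniv ▸ Set.mem_univ x
    exact this
  have hdisj := (h.card_eq_of_walkSum_eq_neg_four hu (hw i u hu)).1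
  have := card_union_add_card_inter (P i) (P u)
  rw [huniv', hdisj, h.card_pos, h.card_pos, card_univ] at this
  exact this

end CommutingNeighborhoods

section SignedMatrix

variable {n : ℕ} (A : Matrix (Fin n) (Fin n) ℤ)

/-- Indices of the entries equal to `s` in a row. -/
def signNbrs (s : ℤ) (i : Fin n) : Finset (Fin n) := univ.filter fun j => A i j = s

/-- The adjacency matrix of the underlying graph of a signed graph. -/
def underlying : Matrix (Fin n) (Fin n) ℤ := fun i j => A i j ^ 2

variable {A}

theorem mem_signNbrs {s : ℤ} {i j : Fin n} : j ∈ signNbrs A s i ↔ A i j = s := by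
  simp [signNbrs]

theorem card_inter_signNbrs (s t : ℤ) (i j : Fin n) :
    (#(signNbrs A s i ∩ signNbrs A t j) : ℤ) = ∑ k, if A i k = s ∧ A j k = t then 1 else 0 := by
  rw [sum_boole, signNbrs, signNbrs, ← filter_and]

theorem mul_self_apply_eq_walkSum (hsymm : ∀ i j, A i j = A j i)
    (hent : ∀ i j, A i j = -1 ∨ A i j = 0 ∨ A i j = 1)
    (i j : Fin n) :
    (A * A) i j = walkSum (signNbrs A 1) (signNbrs A (-1)) i j := by
  simp only [walkSum, card_inter_signNbrs, ← sum_add_distrib, ← sum_sub_distrib, Matrix.mul_apply]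
  refine sum_congr rfl fun k _ => ?_
  rw [hsymm k j]
  rcases hent i k with h | h | h <;> rcases hent j k with h' | h' | h' <;> simp [h, h']

theorem mul_underlying_sub_underlying_mul_apply (hsymm : ∀ i j, A i j = A j i)
    (hent : ∀ i j, A i j = -1 ∨ A i j = 0 ∨ A i j = 1)
    (i j : Fin n) :
    (A * underlying A) i j - (underlying A * A) i j =
      2 * (#(signNbrs A 1 i ∩ signNbrs A (-1) j) - #(signNbrs A (-1) i ∩ signNbrs A 1 j)) := by
  simp only [card_inter_signNbrs, ← sum_sub_distrib, Matrix.mul_apply, mul_sum, underlying]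
  refine sum_congr rfl fun k _ => ?_
  rw [hsymm k j]
  rcases hent i k with h | h | h <;> rcases hent j k with h' | h' | h' <;> simp [h, h']

/-- Outside the case `2 * c = a + b`, the matrix of the underlying graph is a polynomial in `A`
and the all-ones matrix, so it commutes with `A`. -/
theorem commute_underlying (hsymm : ∀ i j, A i j = A j i)
    (hent : ∀ i j, A i j = -1 ∨ A i j = 0 ∨ A i j = 1)
    {a b c ρ : ℤ} (hdiag : ∀ i, A i i = 0) (hnet : ∀ i, ∑ j, A i j = ρ)
    (r : ℤ) (hAA : ∀ i, (A * A) i i = r)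
    (hpos : ∀ i j, A i j = 1 → (A * A) i j = a)
    (hneg : ∀ i j, A i j = -1 → (A * A) i j = b)
    (hnon : ∀ i j, i ≠ j → A i j = 0 → (A * A) i j = c) (hc : 2 * c ≠ a + b) :
    A * underlying A = underlying A * A := by
  set J : Matrix (Fin n) (Fin n) ℤ := Matrix.of fun _ _ => 1 with hJ
  have hAJ : Commute A J := by
    ext i j
    simp only [Matrix.mul_apply, hJ, Matrix.of_apply, mul_one, one_mul, hnet]
    simp_rw [fun k => hsymm k j, hnet]
  have hU : (a + b - 2 * c) • underlying A =
      (2 : ℤ) • (A * A) - (a - b) • A - (2 * c) • J - (2 * (r - c)) • 1 := by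
    ext i j
    simp only [Matrix.sub_apply, Matrix.smul_apply, smul_eq_mul, underlying, hJ, Matrix.of_apply,
      Matrix.one_apply]
    by_cases hij : i = j
    · subst hij
      simp only [hdiag, hAA, if_true]; ring
    · rcases hent i j with h | h | h
      · rw [hneg i j h, h, if_neg hij]; ring
      · rw [hnon i j hij h, h, if_neg hij]; ring
      · rw [hpos i j h, h, if_neg hij]; ring
  have hcomm : Commute A ((a + b - 2 * c) • underlying A) := by
    rw [hU]
    have hA := Commute.refl A
    exact ((((hA.mul_right hA).smul_right _).sub_right (hA.smul_right _)).sub_right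
      (hAJ.smul_right _)).sub_right ((Commute.one_right A).smul_right _)
  have hcomm' : A * ((a + b - 2 * c) • underlying A) = (a + b - 2 * c) • underlying A * A := hcomm
  rw [mul_smul_comm, smul_mul_assoc] at hcomm'
  ext i j
  have := congrFun (congrFun hcomm' i) j
  simp only [Matrix.smul_apply, smul_eq_mul] at this
  exact mul_left_cancel₀ (fun h => hc (by linarith)) this

theorem card_signNbrs (hent : ∀ i j, A i j = -1 ∨ A i j = 0 ∨ A i j = 1) (i : Fin n)
    (hreg : (univ.filter (fun j => A i j ≠ 0)).card = 6) (hnet : ∑ j, A i j = 2) :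
    #(signNbrs A 1 i) = 4 ∧ #(signNbrs A (-1) i) = 2 := by
  have hsum : (#(signNbrs A 1 i) : ℤ) + #(signNbrs A (-1) i) = 6 := by
    rw [← Nat.cast_ofNat (n := 6), ← hreg, signNbrs, signNbrs, ← sum_boole, ← sum_boole,
      ← sum_boole, ← sum_add_distrib]
    refine sum_congr rfl fun k _ => ?_
    rcases hent i k with h | h | h <;> simp [h]
  have hdiff : (#(signNbrs A 1 i) : ℤ) - #(signNbrs A (-1) i) = 2 := by
    rw [← hnet, signNbrs, signNbrs, ← sum_boole, ← sum_boole, ← sum_sub_distrib]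
    refine sum_congr rfl fun k _ => ?_
    rcases hent i k with h | h | h <;> simp [h]
  omega

theorem commutingNeighborhoods_signNbrs (hsymm : ∀ i j, A i j = A j i)
    (hent : ∀ i j, A i j = -1 ∨ A i j = 0 ∨ A i j = 1)
    (hdiag : ∀ i, A i i = 0)
    (hreg : ∀ i, (univ.filter (fun j => A i j ≠ 0)).card = 6) (hnet : ∀ i, ∑ j, A i j = 2)
    (hcomm : A * underlying A = underlying A * A) :
    CommutingNeighborhoods (signNbrs A 1) (signNbrs A (-1)) where
  symm_pos i j := by simp only [mem_signNbrs, hsymm i j, imp_self]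
  symm_neg i j := by simp only [mem_signNbrs, hsymm i j, imp_self]
  irrefl_pos i := by simp [mem_signNbrs, hdiag]
  irrefl_neg i := by simp [mem_signNbrs, hdiag]
  disj i := disjoint_left.2 fun j hj hj' => by
    rw [mem_signNbrs] at hj hj'
    omega
  card_pos i := (card_signNbrs hent i (hreg i) (hnet i)).1
  card_neg i := (card_signNbrs hent i (hreg i) (hnet i)).2
  comm i j := by
    have := mul_underlying_sub_underlying_mul_apply hsymm hent i j
    rw [hcomm, sub_self] at this
    omega

theorem row_sum_mul_self {ρ : ℤ} (hnet : ∀ i, ∑ j, A i j = ρ) (i : Fin n) :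
    ∑ j, (A * A) i j = ρ * ρ := by
  simp only [Matrix.mul_apply]
  rw [sum_comm]
  simp only [← mul_sum, hnet, ← sum_mul]

end SignedMatrix

theorem SimpleGraph.Connected.eq_univ_of_adj_closed {V : Type*} {G : SimpleGraph V}
    (hG : G.Connected) {S : Set V} (hne : S.Nonempty)
    (hS : ∀ w ∈ S, ∀ x, G.Adj w x → x ∈ S) : S = Set.univ := by
  obtain ⟨s, hs⟩ := hne
  refine Set.eq_univ_of_forall fun x => ?_
  obtain ⟨p⟩ := hG.preconnected s x
  induction p with
  | nil => exact hs
  | cons hadj _ ih => exact ih (hS _ hs _ hadj)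

theorem stmt5 {n : ℕ} (A : Matrix (Fin n) (Fin n) ℤ) (a b c : ℤ)
    (hsymm : ∀ i j, A i j = A j i)
    (hdiag : ∀ i, A i i = 0)
    (hent : ∀ i j, A i j = -1 ∨ A i j = 0 ∨ A i j = 1)
    (hconn : (SimpleGraph.fromRel (fun i j => A i j ≠ 0)).Connected)
    (hncomp : ¬ ∀ i j : Fin n, i ≠ j → A i j ≠ 0)
    (hinhom : (∃ i j, A i j = 1) ∧ (∃ i j, A i j = -1))
    (hreg : ∀ i, (Finset.univ.filter (fun j => A i j ≠ 0)).card = 6)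
    (hnet : ∀ i, ∑ j, A i j = 2)
    (hAA : ∀ i, (A * A) i i = 6)
    (hpos : ∀ i j, A i j = 1 → (A * A) i j = a)
    (hneg : ∀ i j, A i j = -1 → (A * A) i j = b)
    (hnon : ∀ i j, i ≠ j → A i j = 0 → (A * A) i j = c)
    (hclass : ¬(a = -b ∧ c = 0) ∧ ¬(a ≠ -b ∧ 2 * c = a + b)) :
    a ≠ -3 ∧
    (a = -4 → n = 8 ∧ b = 4 ∧ c = 6) ∧
    b ≠ 5 ∧
    (b = 4 → a = -4) := by
  obtain ⟨-, i₀, j₀, hij₀⟩ := hinhom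
  have hN := commutingNeighborhoods_signNbrs hsymm hent hdiag hreg hnet
    (commute_underlying hsymm hent hdiag hnet 6 hAA hpos hneg hnon (by omega))
  have hP (i) (j) (hj : j ∈ signNbrs A 1 i) :
      walkSum (signNbrs A 1) (signNbrs A (-1)) i j = a := by
    rw [← mul_self_apply_eq_walkSum hsymm hent, hpos i j (mem_signNbrs.1 hj)]
  have hM (i) (j) (hj : j ∈ signNbrs A (-1) i) :
      walkSum (signNbrs A 1) (signNbrs A (-1)) i j = b := by
    rw [← mul_self_apply_eq_walkSum hsymm hent, hneg i j (mem_signNbrs.1 hj)]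
  have hadj {i j : Fin n} : j ∈ signNbrs A 1 i ∪ signNbrs A (-1) i ↔ A i j ≠ 0 := by
    have := hent i j
    rw [mem_union, mem_signNbrs, mem_signNbrs]
    omega
  have hcl (S : Set (Fin n)) (hS : S.Nonempty)
      (h : ∀ w ∈ S, ∀ x, x ∈ signNbrs A 1 w ∪ signNbrs A (-1) w → x ∈ S) : S = Set.univ := by
    refine hconn.eq_univ_of_adj_closed hS fun w hw x hx => h w hw x (hadj.2 ?_)
    rw [SimpleGraph.fromRel_adj, hsymm x w, or_self] at hx
    exact hx.2
  have h3 : a ≠ -3 := by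
    rintro rfl
    exact hncomp fun i j hij => hadj.1 (hN.adj_of_walkSum_neg_three hcl hP i j hij)
  have h5 : b ≠ 5 := by
    rintro rfl
    exact hN.false_of_walkSum_five i₀ hM
  refine ⟨h3, ?_, h5, ?_⟩
  · rintro rfl
    have hn : n = 8 := by simpa using hN.card_eq_eight hcl hP i₀
    have hij₀' := mem_signNbrs.2 hij₀
    have hb : b = 4 := by
      have := hN.walkSum_neg_of_walkSum_neg_four hP hij₀'
      rw [hM i₀ j₀ hij₀'] at this
      omega
    refine ⟨hn, hb, ?_⟩
    have hsum := row_sum_mul_self hnet i₀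
    have hrow : ∑ j, (A * A) i₀ j = ∑ j, ((if i₀ = j then 6 - c else 0)
        + (-4 - c) * (if A i₀ j = 1 then 1 else 0)
        + (b - c) * (if A i₀ j = -1 then 1 else 0) + c) := by
      refine sum_congr rfl fun j _ => ?_
      by_cases hij : i₀ = j
      · subst hij
        simp [hAA, hdiag]
      · rcases hent i₀ j with h | h | h
        · simp [hneg _ _ h, h, hij]
        · simp [hnon _ _ hij h, h, hij]
        · simp [hpos _ _ h, h, hij]
    have hc1 := hN.card_pos i₀
    have hc2 := hN.card_neg i₀
    rw [signNbrs] at hc1 hc2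
    rw [hsum, sum_add_distrib, sum_add_distrib, sum_add_distrib, ← mul_sum, ← mul_sum,
      sum_boole, sum_boole, hc1, hc2] at hrow
    simp only [sum_ite_eq, mem_univ, if_true, sum_const, card_univ, Fintype.card_fin,
      nsmul_eq_mul, hn, hb] at hrow
    push_cast at hrow
    linarith
  · rintro rfl
    exact (hN.eq_neg_three_or_neg_four i₀ hP hM).resolve_left h3
end

section
/- Let A be the adjacency matrix of a connected, non-complete, inhomogeneous, 6-regular and 2 net-regular strongly regular signed graph with parameters (n, 6, a, b, c) lying in the class C1 ∪ C4 ∪ C5. If A contains an unbalanced triangle of the first type, then a ∈ {-4, -2, -1, 0}. -/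
/-- The number of columns in which rows `u` and `v` of `A` have entries `s` and `t`. -/
def pairCount {n : ℕ} (A : Matrix (Fin n) (Fin n) ℤ) (u v : Fin n) (s t : ℤ) : ℕ :=
  (Finset.univ.filter (fun k => A u k = s ∧ A v k = t)).card

lemma pairCount_pos {n : ℕ} {A : Matrix (Fin n) (Fin n) ℤ} {u v : Fin n} {s t : ℤ} :
    0 < pairCount A u v s t ↔ ∃ k, A u k = s ∧ A v k = t := by
  simp [pairCount, Finset.card_pos, Finset.Nonempty]

lemma eq_of_pairCount_eq_one {n : ℕ} {A : Matrix (Fin n) (Fin n) ℤ} {u v : Fin n} {s t : ℤ}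
    (h : pairCount A u v s t = 1) {k l : Fin n} (hk : A u k = s ∧ A v k = t)
    (hl : A u l = s ∧ A v l = t) : k = l :=
  Finset.card_le_one.mp h.le k (by simpa using hk) l (by simpa using hl)

lemma sum_eq_pairCount {n : ℕ} {A : Matrix (Fin n) (Fin n) ℤ}
    (hent : ∀ i j, A i j = -1 ∨ A i j = 0 ∨ A i j = 1) (u v : Fin n) (f : ℤ → ℤ → ℤ) :
    ∑ k, f (A u k) (A v k) =
      pairCount A u v 1 1 * f 1 1 + pairCount A u v 1 0 * f 1 0 +
      pairCount A u v 1 (-1) * f 1 (-1) + pairCount A u v 0 1 * f 0 1 +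
      pairCount A u v 0 0 * f 0 0 + pairCount A u v 0 (-1) * f 0 (-1) +
      pairCount A u v (-1) 1 * f (-1) 1 + pairCount A u v (-1) 0 * f (-1) 0 +
      pairCount A u v (-1) (-1) * f (-1) (-1) := by
  simp only [pairCount, Finset.card_filter, Nat.cast_sum, Finset.sum_mul,
    ← Finset.sum_add_distrib]
  refine Finset.sum_congr rfl fun k _ => ?_
  rcases hent u k with h | h | h <;> rcases hent v k with h' | h' | h' <;> simp [h, h']

/-- If `2c ≠ a + b`, the square-entry matrix commutes with `A`. -/
lemma sum_mul_sq_comm {n : ℕ} {A : Matrix (Fin n) (Fin n) ℤ} {a b c r ρ : ℤ}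
    (hsymm : ∀ i j, A i j = A j i) (hdiag : ∀ i, A i i = 0)
    (hent : ∀ i j, A i j = -1 ∨ A i j = 0 ∨ A i j = 1)
    (hnet : ∀ i, ∑ j, A i j = ρ) (hAA : ∀ i, (A * A) i i = r)
    (hpos : ∀ i j, A i j = 1 → (A * A) i j = a) (hneg : ∀ i j, A i j = -1 → (A * A) i j = b)
    (hnon : ∀ i j, i ≠ j → A i j = 0 → (A * A) i j = c) (habc : a + b - 2 * c ≠ 0)
    (u v : Fin n) : ∑ k, A u k * A v k ^ 2 = ∑ k, A u k ^ 2 * A v k := by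
  let H : Matrix (Fin n) (Fin n) ℤ := Matrix.of fun i j => A i j ^ 2
  let J : Matrix (Fin n) (Fin n) ℤ := Matrix.of fun _ _ => 1
  have hdecomp : (2 : ℤ) • (A * A) = (2 * (r - c)) • (1 : Matrix (Fin n) (Fin n) ℤ) +
      (a - b) • A + (a + b - 2 * c) • H + (2 * c) • J := by
    ext i j
    by_cases hij : i = j
    · subst hij
      simp [H, J, hAA, hdiag, -zsmul_eq_mul, -zsmul_one]
      ring
    · rcases hent i j with h | h | h
      · simp [H, J, hneg i j h, h, hij, -zsmul_eq_mul, -zsmul_one]; ring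
      · simp [H, J, hnon i j hij h, h, hij, -zsmul_eq_mul, -zsmul_one]
      · simp [H, J, hpos i j h, h, hij, -zsmul_eq_mul, -zsmul_one]; ring
  have hJ : A * J = J * A := by
    ext i j
    simp only [Matrix.mul_apply, J, Matrix.of_apply, mul_one, one_mul, hnet]
    rw [← hnet j]
    exact Finset.sum_congr rfl fun k _ => hsymm j k
  have hcomm : (a + b - 2 * c) • (A * H) = (a + b - 2 * c) • (H * A) := by
    have h : A * ((2 : ℤ) • (A * A)) = ((2 : ℤ) • (A * A)) * A := by
      rw [Matrix.mul_smul, Matrix.smul_mul, Matrix.mul_assoc]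
    rw [hdecomp] at h
    simpa [mul_add, add_mul, hJ, -zsmul_eq_mul, -zsmul_one] using h
  have h := congrFun (congrFun (smul_right_injective _ habc hcomm) u) v
  simpa [Matrix.mul_apply, H, hsymm v] using h

lemma pairCount_relations {n : ℕ} {A : Matrix (Fin n) (Fin n) ℤ} {a : ℤ}
    (hsymm : ∀ i j, A i j = A j i) (hdiag : ∀ i, A i i = 0)
    (hent : ∀ i j, A i j = -1 ∨ A i j = 0 ∨ A i j = 1)
    (hnet : ∀ i, ∑ j, A i j = 2) (hAA : ∀ i, (A * A) i i = 6)
    (hpos : ∀ i j, A i j = 1 → (A * A) i j = a)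
    (hcomm : ∀ u v, ∑ k, A u k * A v k ^ 2 = ∑ k, A u k ^ 2 * A v k)
    {u v : Fin n} (huv : A u v = 1) :
    pairCount A u v 1 1 + pairCount A u v 1 0 + pairCount A u v 1 (-1) = 4 ∧
    pairCount A u v (-1) 1 + pairCount A u v (-1) 0 + pairCount A u v (-1) (-1) = 2 ∧
    pairCount A u v 1 1 + pairCount A u v 0 1 + pairCount A u v (-1) 1 = 4 ∧
    pairCount A u v 1 (-1) + pairCount A u v 0 (-1) + pairCount A u v (-1) (-1) = 2 ∧
    pairCount A u v 1 (-1) = pairCount A u v (-1) 1 ∧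
    (pairCount A u v 1 1 + pairCount A u v (-1) (-1) : ℤ) - 2 * pairCount A u v (-1) 1 = a ∧
    0 < pairCount A u v 1 0 ∧ 0 < pairCount A u v 0 1 := by
  have hsq : ∀ i, ∑ j, A i j ^ 2 = 6 := fun i => by
    rw [← hAA i, Matrix.mul_apply]
    exact Finset.sum_congr rfl fun k _ => by rw [hsymm k i, sq]
  have hprod : ∑ k, A u k * A v k = a := by
    rw [← hpos u v huv, Matrix.mul_apply]
    exact Finset.sum_congr rfl fun k _ => by rw [hsymm k v]
  have e1 := sum_eq_pairCount hent u v fun s _ => s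
  have e2 := sum_eq_pairCount hent u v fun s _ => s ^ 2
  have e3 := sum_eq_pairCount hent u v fun _ t => t
  have e4 := sum_eq_pairCount hent u v fun _ t => t ^ 2
  have e5 := sum_eq_pairCount hent u v fun s t => s * t
  have e6 := sum_eq_pairCount hent u v fun s t => s * t ^ 2
  have e7 := sum_eq_pairCount hent u v fun s t => s ^ 2 * t
  have h10 : 0 < pairCount A u v 1 0 := pairCount_pos.2 ⟨v, huv, hdiag v⟩
  have h01 : 0 < pairCount A u v 0 1 := pairCount_pos.2 ⟨u, hdiag u, by rw [hsymm, huv]⟩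
  rw [hnet] at e1 e3
  rw [hsq] at e2 e4
  rw [hprod] at e5
  rw [hcomm] at e6
  norm_num at e1 e2 e3 e4 e5 e6 e7
  refine ⟨?_, ?_, ?_, ?_, ?_, ?_, h10, h01⟩ <;> omega

/-- Rows with no unmatched entries other than the ones forced by the edge `uv` have equal closed
neighbourhoods. -/
lemma closed_neighborhood_eq {n : ℕ} {A : Matrix (Fin n) (Fin n) ℤ}
    (hsymm : ∀ i j, A i j = A j i) (hdiag : ∀ i, A i i = 0)
    (hent : ∀ i j, A i j = -1 ∨ A i j = 0 ∨ A i j = 1) {u v : Fin n} (huv : A u v = 1)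
    (h10 : pairCount A u v 1 0 = 1) (h01 : pairCount A u v 0 1 = 1)
    (h20 : pairCount A u v (-1) 0 = 0) (h02 : pairCount A u v 0 (-1) = 0) (w : Fin n) :
    (w = u ∨ A u w ≠ 0) ↔ (w = v ∨ A v w ≠ 0) := by
  have hvu : A v u = 1 := by rw [hsymm, huv]
  have n20 : ¬ (A u w = -1 ∧ A v w = 0) := fun h => by
    have := pairCount_pos.2 ⟨w, h⟩
    omega
  have n02 : ¬ (A u w = 0 ∧ A v w = -1) := fun h => by
    have := pairCount_pos.2 ⟨w, h⟩
    omega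
  constructor
  · rintro (rfl | h)
    · right; omega
    · by_contra! hc
      have h1 : A u w = 1 := by have := hent u w; tauto
      exact hc.1 (eq_of_pairCount_eq_one h10 ⟨h1, hc.2⟩ ⟨huv, hdiag v⟩)
  · rintro (rfl | h)
    · right; omega
    · by_contra! hc
      have h1 : A v w = 1 := by have := hent v w; tauto
      exact hc.1 (eq_of_pairCount_eq_one h01 ⟨hc.2, h1⟩ ⟨hdiag u, hvu⟩)

/-- A connected symmetric matrix in which adjacent vertices share closed neighbourhoods is
complete. -/
lemma complete_of_closed_neighborhood_eq {n : ℕ} {A : Matrix (Fin n) (Fin n) ℤ}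
    (hsymm : ∀ i j, A i j = A j i)
    (hconn : (SimpleGraph.fromRel (fun i j => A i j ≠ 0)).Connected)
    (h : ∀ i j, A i j ≠ 0 → ∀ w, (w = i ∨ A i w ≠ 0) ↔ (w = j ∨ A j w ≠ 0))
    (i j : Fin n) (hij : i ≠ j) : A i j ≠ 0 := by
  obtain ⟨p⟩ := hconn.preconnected i j
  have key : ∀ w, (w = i ∨ A i w ≠ 0) ↔ (w = j ∨ A j w ≠ 0) := by
    clear hij
    induction p with
    | nil => exact fun _ => Iff.rfl
    | @cons x y z hadj _ ih =>
      have hxy : A x y ≠ 0 := by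
        rcases ((SimpleGraph.fromRel_adj _ _ _).1 hadj).2 with h' | h'
        · exact h'
        · rwa [hsymm]
      exact fun w => (h x y hxy w).trans (ih w)
  exact ((key j).2 (Or.inl rfl)).resolve_left hij.symm

lemma eq_or_eq_of_neg {n : ℕ} {A : Matrix (Fin n) (Fin n) ℤ} {i x y z : Fin n}
    (h : (Finset.univ.filter fun j => A i j = -1).card = 2)
    (hx : A i x = -1) (hy : A i y = -1) (hz : A i z = -1) (hxy : x ≠ y) : z = x ∨ z = y := by
  by_contra! hc
  have hs : ({x, y, z} : Finset (Fin n)) ⊆ Finset.univ.filter fun j => A i j = -1 := by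
    intro k hk
    simp only [Finset.mem_insert, Finset.mem_singleton] at hk
    rcases hk with rfl | rfl | rfl <;> simpa
  have h3 : ({x, y, z} : Finset (Fin n)).card = 3 :=
    Finset.card_eq_three.2 ⟨x, y, z, hxy, hc.1.symm, hc.2.symm, rfl⟩
  have := Finset.card_le_card hs
  omega

lemma card_neg_eq_two {n : ℕ} {A : Matrix (Fin n) (Fin n) ℤ}
    (hsymm : ∀ i j, A i j = A j i) (hent : ∀ i j, A i j = -1 ∨ A i j = 0 ∨ A i j = 1)
    (hnet : ∀ i, ∑ j, A i j = 2) (hAA : ∀ i, (A * A) i i = 6) (i : Fin n) :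
    (Finset.univ.filter fun j => A i j = -1).card = 2 := by
  have hsq : ∑ j, (A i j ^ 2 - A i j) = 4 := by
    rw [Finset.sum_sub_distrib, hnet i]
    have := hAA i
    rw [Matrix.mul_apply] at this
    simp only [hsymm _ i, ← sq] at this
    omega
  have h2 : ∑ j, (A i j ^ 2 - A i j) =
      2 * ((Finset.univ.filter fun j => A i j = -1).card : ℤ) := by
    rw [Finset.card_filter, Nat.cast_sum, Finset.mul_sum]
    refine Finset.sum_congr rfl fun j _ => ?_
    rcases hent i j with h | h | h <;> simp [h]
  omega

/-- If every positive edge in a triangle with exactly one negative edge has the neighbourhood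
pattern forced by `a = 1`, then no such triangle exists. -/
lemma false_of_rigid_triangle {n : ℕ} {A : Matrix (Fin n) (Fin n) ℤ}
    (hsymm : ∀ i j, A i j = A j i) (hdiag : ∀ i, A i i = 0)
    (hent : ∀ i j, A i j = -1 ∨ A i j = 0 ∨ A i j = 1)
    (hcard : ∀ i, (Finset.univ.filter fun j => A i j = -1).card = 2)
    (hrigid : ∀ u v w, A u v = 1 → A u w = -1 → A v w = 1 →
      (∀ x, (x = u ∨ A u x ≠ 0) ↔ (x = v ∨ A v x ≠ 0)) ∧
      (∃ x, A u x = -1 ∧ A v x = -1) ∧ (∃ x, A u x = 1 ∧ A v x = -1) ∧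
      (∃ x, A u x = 1 ∧ A v x = 1))
    {u v s : Fin n} (huv : A u v = 1) (hus : A u s = -1) (hvs : A v s = 1) : False := by
  have hvu : A v u = 1 := by rw [hsymm, huv]
  obtain ⟨-, ⟨q, huq, hvq⟩, ⟨t, hut, hvt⟩, ⟨x, hux, hvx⟩⟩ := hrigid u v s huv hus hvs
  have ne_of : ∀ {i y z}, A i y ≠ A i z → y ≠ z := fun h e => h (by rw [e])
  have huvne : u ≠ v := ne_of (i := u) (by rw [hdiag, huv]; decide)
  have hsq : s ≠ q := ne_of (i := v) (by rw [hvs, hvq]; decide)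
  have htq : t ≠ q := ne_of (i := u) (by rw [hut, huq]; decide)
  have htu : t ≠ u := ne_of (i := u) (by rw [hut, hdiag]; decide)
  have htv : t ≠ v := ne_of (i := v) (by rw [hvt, hdiag]; decide)
  have hqu := (hsymm q u).trans huq
  have hqv := (hsymm q v).trans hvq
  have htv' := (hsymm t v).trans hvt
  have hsu' := (hsymm s u).trans hus
  have hq : ∀ y, y ≠ u → y ≠ v → A y q ≠ -1 := fun y hyu hyv hy =>
    (eq_or_eq_of_neg (hcard q) hqu hqv ((hsymm q y).trans hy) huvne).elim hyu hyv
  obtain ⟨htN, ⟨y, hty, huy⟩, -, -⟩ := hrigid t u v ((hsymm t u).trans hut) htv' huv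
  have hst : A t s = -1 := by
    rcases eq_or_eq_of_neg (hcard u) hus huq huy hsq with rfl | rfl
    · exact hty
    · exact absurd hty (hq t htu htv)
  have hst' := (hsymm s t).trans hst
  obtain ⟨hsN, -, -, -⟩ := hrigid s v u ((hsymm s v).trans hvs) hsu' hvu
  have hxu : x ≠ u := ne_of (i := u) (by rw [hux, hdiag]; decide)
  have hxv : x ≠ v := ne_of (i := v) (by rw [hvx, hdiag]; decide)
  have hxt : x ≠ t := ne_of (i := v) (by rw [hvx, hvt]; decide)
  have hxs : x ≠ s := ne_of (i := u) (by rw [hux, hus]; decide)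
  have hsx : A s x = 1 := by
    rcases hent s x with h | h | h
    · exact ((eq_or_eq_of_neg (hcard s) hsu' hst' h htu.symm).elim hxu hxt).elim
    · exact absurd h (((hsN x).2 (Or.inr (by omega))).resolve_left hxs)
    · exact h
  obtain ⟨-, ⟨y, huy, hxy⟩, -, -⟩ := hrigid u x s hux hus ((hsymm x s).trans hsx)
  rcases eq_or_eq_of_neg (hcard u) hus huq huy hsq with rfl | rfl
  · rw [hsymm, hsx] at hxy
    omega
  · exact hq x hxu hxv hxy


theorem stmt6 {n : ℕ} (A : Matrix (Fin n) (Fin n) ℤ) (a b c : ℤ)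
    (hsymm : ∀ i j, A i j = A j i)
    (hdiag : ∀ i, A i i = 0)
    (hent : ∀ i j, A i j = -1 ∨ A i j = 0 ∨ A i j = 1)
    (hconn : (SimpleGraph.fromRel (fun i j => A i j ≠ 0)).Connected)
    (hncomp : ¬ ∀ i j : Fin n, i ≠ j → A i j ≠ 0)
    (hinhom : (∃ i j, A i j = 1) ∧ (∃ i j, A i j = -1))
    (hreg : ∀ i, (Finset.univ.filter (fun j => A i j ≠ 0)).card = 6)
    (hnet : ∀ i, ∑ j, A i j = 2)
    (hAA : ∀ i, (A * A) i i = 6)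
    (hpos : ∀ i j, A i j = 1 → (A * A) i j = a)
    (hneg : ∀ i j, A i j = -1 → (A * A) i j = b)
    (hnon : ∀ i j, i ≠ j → A i j = 0 → (A * A) i j = c)
    (hclass : ¬(a = -b ∧ c = 0) ∧ ¬(a ≠ -b ∧ 2 * c = a + b))
    (htri1 : ∃ i j k : Fin n,
      (A i j = -1 ∧ A j k = 1 ∧ A i k = 1) ∨
      (A i j = 1 ∧ A j k = -1 ∧ A i k = 1) ∨
      (A i j = 1 ∧ A j k = 1 ∧ A i k = -1)) :
    a = -4 ∨ a = -2 ∨ a = -1 ∨ a = 0 := by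
  have habc : a + b - 2 * c ≠ 0 := by omega
  have hcomm := sum_mul_sq_comm hsymm hdiag hent hnet hAA hpos hneg hnon habc
  have hrel := fun {u v : Fin n} (huv : A u v = 1) =>
    pairCount_relations hsymm hdiag hent hnet hAA hpos hcomm huv
  obtain ⟨u, v, w, huv, huw, hvw⟩ : ∃ u v w, A u v = 1 ∧ A u w = -1 ∧ A v w = 1 := by
    obtain ⟨i, j, k, ⟨h1, h2, h3⟩ | ⟨h1, h2, h3⟩ | ⟨h1, h2, h3⟩⟩ := htri1
    · exact ⟨j, k, i, h2, (hsymm j i).trans h1, (hsymm k i).trans h3⟩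
    · exact ⟨j, i, k, (hsymm j i).trans h1, h2, h3⟩
    · exact ⟨i, j, k, h1, h3, h2⟩
  have ha1 : a ≠ 1 := by
    rintro rfl
    refine false_of_rigid_triangle hsymm hdiag hent (card_neg_eq_two hsymm hent hnet hAA)
      (fun u v w huv huw hvw => ?_) huv huw hvw
    obtain ⟨h1, h2, h3, h4, h5, h6, h7, h8⟩ := hrel huv
    have h9 := pairCount_pos.2 ⟨w, huw, hvw⟩
    exact ⟨closed_neighborhood_eq hsymm hdiag hent huv (by omega) (by omega) (by omega) (by omega),
      pairCount_pos.1 (by omega), pairCount_pos.1 (by omega), pairCount_pos.1 (by omega)⟩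
  have ha3 : a ≠ -3 := by
    rintro rfl
    have hN : ∀ {i j}, A i j = 1 → ∀ w, (w = i ∨ A i w ≠ 0) ↔ (w = j ∨ A j w ≠ 0) := by
      intro i j hij
      obtain ⟨h1, h2, h3, h4, h5, h6, h7, h8⟩ := hrel hij
      have hz : pairCount A i j (-1) 1 = 2 := by omega
      exact closed_neighborhood_eq hsymm hdiag hent hij (by omega) (by omega) (by omega) (by omega)
    refine hncomp (complete_of_closed_neighborhood_eq hsymm hconn fun i j hij => ?_)
    rcases hent i j with h | h | h
    · obtain ⟨k, -, hk⟩ : ∃ k ∈ Finset.univ, 0 < A i k :=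
        Finset.exists_lt_of_sum_lt (f := fun _ => (0 : ℤ)) (by simp [hnet])
      have hik : A i k = 1 := by have := hent i k; omega
      obtain ⟨h1, h2, h3, h4, h5, h6, h7, h8⟩ := hrel hik
      have hkj : A k j = 1 := by
        rcases hent k j with h' | h' | h'
        · have := pairCount_pos.2 ⟨j, h, h'⟩
          omega
        · have := pairCount_pos.2 ⟨j, h, h'⟩
          omega
        · exact h'
      exact fun w => (hN hik w).trans (hN hkj w)
    · exact absurd h hij
    · exact hN h
  obtain ⟨h1, h2, h3, h4, h5, h6, h7, h8⟩ := hrel huv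
  have h9 := pairCount_pos.2 ⟨w, huw, hvw⟩
  omega
end

section
/- Let A be the adjacency matrix of a connected, non-complete, inhomogeneous, 6-regular and 2 net-regular strongly regular signed graph with parameters (n, 6, a, b, c) lying in the class C1 ∪ C4 ∪ C5. Then (a, b) ≠ (-1, -1) and (a, b) ≠ (0, -1). -/
open Finset Matrix

/-- The indicator matrix of the entries of `A` that are equal to `s`. -/
def levelMatrix {n : ℕ} (A : Matrix (Fin n) (Fin n) ℤ) (s : ℤ) : Matrix (Fin n) (Fin n) ℤ :=
  Matrix.of fun i j => if A i j = s then 1 else 0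

/-- The middle vertices of the walks `i, k, j` with signs `s` and `t`. -/
def walks {n : ℕ} (A : Matrix (Fin n) (Fin n) ℤ) (s t : ℤ) (i j : Fin n) : Finset (Fin n) :=
  univ.filter fun k => A i k = s ∧ A k j = t

theorem mem_walks {n : ℕ} {A : Matrix (Fin n) (Fin n) ℤ} {s t : ℤ} {i j k : Fin n} :
    k ∈ walks A s t i j ↔ A i k = s ∧ A k j = t := by
  simp [walks]

theorem levelMatrix_mul_apply {n : ℕ} (A : Matrix (Fin n) (Fin n) ℤ) (s t : ℤ) (i j : Fin n) :
    (levelMatrix A s * levelMatrix A t) i j = (walks A s t i j).card := by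
  simp only [Matrix.mul_apply, levelMatrix, Matrix.of_apply, walks, Finset.card_filter]
  push_cast
  refine Finset.sum_congr rfl fun k _ => ?_
  split_ifs <;> simp_all

theorem eq_levelMatrix_sub {n : ℕ} {A : Matrix (Fin n) (Fin n) ℤ}
    (hent : ∀ i j, A i j = -1 ∨ A i j = 0 ∨ A i j = 1) :
    A = levelMatrix A 1 - levelMatrix A (-1) := by
  ext i j
  rcases hent i j with h | h | h <;> simp [levelMatrix, h]

/-- In a net-regular strongly regular signed graph with `2c ≠ a + b`, the positive and negative
adjacency matrices commute. -/
theorem levelMatrix_commute {n : ℕ} {A : Matrix (Fin n) (Fin n) ℤ} {a b c r ρ : ℤ}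
    (hsymm : ∀ i j, A i j = A j i)
    (hdiag : ∀ i, A i i = 0)
    (hent : ∀ i j, A i j = -1 ∨ A i j = 0 ∨ A i j = 1)
    (hnet : ∀ i, ∑ j, A i j = ρ)
    (hAA : ∀ i, (A * A) i i = r)
    (hpos : ∀ i j, A i j = 1 → (A * A) i j = a)
    (hneg : ∀ i j, A i j = -1 → (A * A) i j = b)
    (hnon : ∀ i j, i ≠ j → A i j = 0 → (A * A) i j = c)
    (hc : 2 * c ≠ a + b) :
    levelMatrix A 1 * levelMatrix A (-1) = levelMatrix A (-1) * levelMatrix A 1 := by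
  set P := levelMatrix A 1 with hP
  set N := levelMatrix A (-1) with hN
  let J : Matrix (Fin n) (Fin n) ℤ := Matrix.of fun _ _ => 1
  have hA : A = P - N := eq_levelMatrix_sub hent
  have hJ : A * J = J * A := by
    ext i j
    simp only [Matrix.mul_apply, J, Matrix.of_apply, mul_one, one_mul]
    rw [hnet i, ← hnet j]
    exact Finset.sum_congr rfl fun k _ => hsymm j k
  have hsq : A * A = (r - c) • (1 : Matrix (Fin n) (Fin n) ℤ) + (a - c) • P + (b - c) • N
      + c • J := by
    ext i j
    simp only [Matrix.add_apply, Matrix.smul_apply, Matrix.one_apply, smul_eq_mul, hP, hN,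
      levelMatrix, J, Matrix.of_apply]
    by_cases hij : i = j
    · subst hij
      simp [hAA, hdiag]
    · rcases hent i j with h | h | h
      · simp [hneg i j h, h, hij]
      · simp [hnon i j hij h, h, hij]
      · simp [hpos i j h, h, hij]
  have hcomm : A * (A * A) = (A * A) * A := (mul_assoc A A A).symm
  have hz : (a + b - 2 * c) • (P * N - N * P) = 0 := by
    have hAP : A * P - P * A = P * N - N * P := by rw [hA]; noncomm_ring
    have hAN : A * N - N * A = P * N - N * P := by rw [hA]; noncomm_ring
    have h1 : (a - c) • (A * P - P * A) + (b - c) • (A * N - N * A) = 0 := by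
      rw [hsq] at hcomm
      simp only [mul_add, add_mul, mul_smul_comm, smul_mul_assoc, mul_one, one_mul, hJ] at hcomm
      rw [← sub_eq_zero] at hcomm
      rw [← hcomm]
      module
    rw [hAP, hAN] at h1
    rw [← h1]
    module
  rcases smul_eq_zero.mp hz with h | h
  · exact absurd (by linarith) hc
  · exact sub_eq_zero.mp h

theorem mul_self_apply_eq_card_walks {n : ℕ} {A : Matrix (Fin n) (Fin n) ℤ}
    (hent : ∀ i j, A i j = -1 ∨ A i j = 0 ∨ A i j = 1)
    (hcomm : levelMatrix A 1 * levelMatrix A (-1) = levelMatrix A (-1) * levelMatrix A 1)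
    (i j : Fin n) :
    (A * A) i j = (walks A 1 1 i j).card + (walks A (-1) (-1) i j).card
      - 2 * (walks A 1 (-1) i j).card := by
  have h : A * A = levelMatrix A 1 * levelMatrix A 1 + levelMatrix A (-1) * levelMatrix A (-1)
      - (2 : ℤ) • (levelMatrix A 1 * levelMatrix A (-1)) := by
    conv_lhs => rw [eq_levelMatrix_sub hent]
    rw [sub_mul, mul_sub, mul_sub, ← hcomm]
    module
  rw [h]
  simp only [Matrix.sub_apply, Matrix.add_apply, Matrix.smul_apply, levelMatrix_mul_apply,
    smul_eq_mul]

theorem card_filter_eq_of_regular {n : ℕ} {A : Matrix (Fin n) (Fin n) ℤ}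
    (hent : ∀ i j, A i j = -1 ∨ A i j = 0 ∨ A i j = 1)
    (hreg : ∀ i, (univ.filter (fun j => A i j ≠ 0)).card = 6)
    (hnet : ∀ i, ∑ j, A i j = 2) (i : Fin n) :
    (univ.filter (fun j => A i j = 1)).card = 4 ∧
      (univ.filter (fun j => A i j = -1)).card = 2 := by
  have hr : ((univ.filter (fun j => A i j = 1)).card : ℤ)
      + (univ.filter (fun j => A i j = -1)).card = 6 := by
    rw [← Nat.cast_ofNat (R := ℤ) (n := 6), ← hreg i]
    simp only [Finset.card_filter]
    push_cast
    rw [← Finset.sum_add_distrib]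
    refine Finset.sum_congr rfl fun j _ => ?_
    rcases hent i j with h | h | h <;> simp [h]
  have hs : ((univ.filter (fun j => A i j = 1)).card : ℤ)
      - (univ.filter (fun j => A i j = -1)).card = 2 := by
    rw [← hnet i]
    simp only [Finset.card_filter]
    push_cast
    rw [← Finset.sum_sub_distrib]
    refine Finset.sum_congr rfl fun j _ => ?_
    rcases hent i j with h | h | h <;> simp [h]
  omega

/-- A signed graph whose negative edges form a 2-regular graph, whose positive edges form a graph
of minimum degree at least 3, and whose positive and negative adjacency matrices commute has no
negative edge if `A ^ 2` is `-1` on negative edges and constantly `-1` or `0` on positive edges. -/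
theorem no_negative_edge {n : ℕ} {A : Matrix (Fin n) (Fin n) ℤ} {a : ℤ}
    (ha : a = -1 ∨ a = 0)
    (hsymm : ∀ i j, A i j = A j i)
    (hdiag : ∀ i, A i i = 0)
    (hP : ∀ i, 2 < (univ.filter (fun j => A i j = 1)).card)
    (hN : ∀ i, (univ.filter (fun j => A i j = -1)).card = 2)
    (hpos : ∀ i j, A i j = 1 → ((walks A 1 1 i j).card + (walks A (-1) (-1) i j).card
      - 2 * (walks A 1 (-1) i j).card : ℤ) = a)
    (hneg : ∀ i j, A i j = -1 → ((walks A 1 1 i j).card + (walks A (-1) (-1) i j).card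
      - 2 * (walks A 1 (-1) i j).card : ℤ) = -1)
    (i j : Fin n) : A i j ≠ -1 := by
  intro hij
  have other : ∀ u v, A u v = -1 →
      ∃ w, w ≠ u ∧ A v w = -1 ∧ ∀ x, A v x = -1 → x = u ∨ x = w := by
    intro u v huv
    obtain ⟨x, y, hxy, he⟩ := Finset.card_eq_two.mp (hN v)
    have hmem : ∀ z, A v z = -1 ↔ z = x ∨ z = y := fun z => by
      simpa using Finset.ext_iff.mp he z
    rcases (hmem u).mp (hsymm u v ▸ huv) with rfl | rfl
    · exact ⟨y, hxy.symm, (hmem y).mpr (.inr rfl), fun z => (hmem z).mp⟩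
    · exact ⟨x, hxy, (hmem x).mpr (.inl rfl), fun z hz => ((hmem z).mp hz).symm⟩
  have nbrs : ∀ u v w, A u v = -1 → A v w = -1 → w ≠ u →
      ∀ x, A v x = -1 → x = u ∨ x = w := by
    intro u v w huv hvw hwu x hx
    obtain ⟨w', -, -, h⟩ := other u v huv
    rcases h w hvw with rfl | rfl
    · exact absurd rfl hwu
    · exact h x hx
  have sub_walks : ∀ u v w, A u v = -1 → A v w = -1 → w ≠ u →
      walks A 1 (-1) u v ⊆ {w} := by
    intro u v w huv hvw hwu x hx
    rw [mem_walks] at hx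
    rcases nbrs u v w huv hvw hwu x (hsymm x v ▸ hx.2) with rfl | rfl
    · have := hdiag x; omega
    · simp
  have two_step : ∀ u v w, A u v = -1 → A v w = -1 → w ≠ u → A u w = 1 := by
    intro u v w huv hvw hwu
    have h := hneg u v huv
    obtain ⟨x, hx⟩ := Finset.card_pos.mp (show 0 < (walks A 1 (-1) u v).card by omega)
    have := Finset.mem_singleton.mp (sub_walks u v w huv hvw hwu hx)
    exact this ▸ (mem_walks.mp hx).1
  have unique : ∀ u v x y, A u v = -1 → A u x = 1 → A v x = 1 → A u y = 1 → A v y = 1 →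
      x = y := by
    intro u v x y huv hux hvx huy hvy
    obtain ⟨w, hwu, hvw, -⟩ := other u v huv
    have hle := Finset.card_le_card (sub_walks u v w huv hvw hwu)
    have h := hneg u v huv
    rw [Finset.card_singleton] at hle
    exact Finset.card_le_one.mp (show (walks A 1 1 u v).card ≤ 1 by omega) x
      (mem_walks.mpr ⟨hux, hsymm x v ▸ hvx⟩) y (mem_walks.mpr ⟨huy, hsymm y v ▸ hvy⟩)
  have mixed : ∀ u x, A u x = 1 →
      (a = -1 ∨ (walks A 1 1 u x).Nonempty ∨ (walks A (-1) (-1) u x).Nonempty) →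
      ∃ l, A u l = 1 ∧ A l x = -1 := by
    intro u x hux h
    simp only [← Finset.card_pos] at h
    have h' := hpos u x hux
    obtain ⟨l, hl⟩ := Finset.card_pos.mp (show 0 < (walks A 1 (-1) u x).card by omega)
    exact ⟨l, mem_walks.mp hl⟩
  have three_step : ∀ u v w x, A u v = -1 → A v w = -1 → A w x = -1 → w ≠ u → x ≠ v →
      A u x = 1 := by
    intro u v w x huv hvw hwx hwu hxv
    obtain ⟨l, hl, hl'⟩ := mixed u w (two_step u v w huv hvw hwu)
      (.inr (.inr ⟨v, mem_walks.mpr ⟨huv, hvw⟩⟩))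
    rcases nbrs v w x hvw hwx hxv l (hsymm l w ▸ hl') with rfl | rfl
    · omega
    · exact hl
  obtain ⟨u, v, h01⟩ : ∃ u v, A u v = -1 := ⟨i, j, hij⟩
  obtain ⟨w, n02, h12, -⟩ := other u v h01
  obtain ⟨x, n13, h23, -⟩ := other v w h12
  obtain ⟨y, n24, h34, -⟩ := other w x h23
  obtain ⟨z, n35, h45, -⟩ := other x y h34
  have h02 := two_step u v w h01 h12 n02
  have h13 := two_step v w x h12 h23 n13
  have h24 := two_step w x y h23 h34 n24
  have h35 := two_step x y z h34 h45 n35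
  have h03 := three_step u v w x h01 h12 h23 n02 n13
  have h14 := three_step v w x y h12 h23 h34 n13 n24
  have h25 := three_step w x y z h23 h34 h45 n24 n35
  obtain rfl : u = z := unique w x u z h23 (hsymm u w ▸ h02) (hsymm u x ▸ h03) h25 h35
  have key : ∀ t, A w t = 1 →
      (a = -1 ∨ (walks A 1 1 w t).Nonempty ∨ (walks A (-1) (-1) w t).Nonempty) →
      t = u ∨ t = y := by
    intro t hwt ht
    have swap : ∀ s, (walks A s s w t).Nonempty → (walks A s s t w).Nonempty :=
      fun s ⟨k, hk⟩ => ⟨k, mem_walks.mpr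
        ⟨hsymm k t ▸ (mem_walks.mp hk).2, hsymm w k ▸ (mem_walks.mp hk).1⟩⟩
    obtain ⟨l, htl, hlw⟩ := mixed t w (hsymm w t ▸ hwt) (ht.imp_right (Or.imp (swap 1) (swap (-1))))
    rw [hsymm] at htl
    rcases nbrs v w x h12 h23 n13 l (hsymm l w ▸ hlw) with rfl | rfl
    · exact .inr (unique w l t y (hsymm l w ▸ hlw) hwt htl h24 h14)
    · exact .inl (unique w l t u h23 hwt htl h25 h35)
  rcases ha with ha | ha
  · have hsub : univ.filter (fun j => A w j = 1) ⊆ {u, y} := fun t ht => by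
      simpa using key t (by simpa using ht) (.inl ha)
    exact absurd (Finset.card_le_card hsub |>.trans Finset.card_le_two) (hP w).not_ge
  · have hsub : walks A (-1) (-1) w y ⊆ {x} := fun t ht => by
      obtain ⟨hwt, hty⟩ := mem_walks.mp ht
      rcases nbrs v w x h12 h23 n13 t hwt with rfl | rfl
      · omega
      · simp
    have hle := Finset.card_le_card hsub
    have hlt := Finset.card_pos.mpr
      ⟨x, (mem_walks.mpr ⟨h23, h34⟩ : x ∈ walks A (-1) (-1) w y)⟩
    have h := hpos w y h24
    rw [Finset.card_singleton] at hle
    obtain ⟨t, ht⟩ := Finset.card_pos.mp (show 0 < (walks A 1 1 w y).card by omega)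
    obtain ⟨hwt, hty⟩ := mem_walks.mp ht
    rcases key t hwt (.inr (.inl ⟨y, mem_walks.mpr ⟨h24, hsymm t y ▸ hty⟩⟩)) with rfl | rfl
    · rw [hsymm] at hty; omega
    · have := hdiag t; omega


theorem stmt7 {n : ℕ} (A : Matrix (Fin n) (Fin n) ℤ) (a b c : ℤ)
    (hsymm : ∀ i j, A i j = A j i)
    (hdiag : ∀ i, A i i = 0)
    (hent : ∀ i j, A i j = -1 ∨ A i j = 0 ∨ A i j = 1)
    (hconn : (SimpleGraph.fromRel (fun i j => A i j ≠ 0)).Connected)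
    (hncomp : ¬ ∀ i j : Fin n, i ≠ j → A i j ≠ 0)
    (hinhom : (∃ i j, A i j = 1) ∧ (∃ i j, A i j = -1))
    (hreg : ∀ i, (Finset.univ.filter (fun j => A i j ≠ 0)).card = 6)
    (hnet : ∀ i, ∑ j, A i j = 2)
    (hAA : ∀ i, (A * A) i i = 6)
    (hpos : ∀ i j, A i j = 1 → (A * A) i j = a)
    (hneg : ∀ i j, A i j = -1 → (A * A) i j = b)
    (hnon : ∀ i j, i ≠ j → A i j = 0 → (A * A) i j = c)
    (hclass : ¬(a = -b ∧ c = 0) ∧ ¬(a ≠ -b ∧ 2 * c = a + b)) :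
    ¬(a = -1 ∧ b = -1) ∧ ¬(a = 0 ∧ b = -1) := by
  obtain ⟨-, i, j, hij⟩ := hinhom
  have hdeg := card_filter_eq_of_regular hent hreg hnet
  have main : (a = -1 ∨ a = 0) → b ≠ -1 := by
    rintro ha rfl
    have hsq := mul_self_apply_eq_card_walks hent
      (levelMatrix_commute hsymm hdiag hent hnet hAA hpos hneg hnon (by omega))
    exact no_negative_edge ha hsymm hdiag (fun i => by rw [(hdeg i).1]; norm_num)
      (fun i => (hdeg i).2) (fun i j h => (hsq i j).symm.trans (hpos i j h))
      (fun i j h => (hsq i j).symm.trans (hneg i j h)) i j hij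
  exact ⟨fun h => main (.inl h.1) h.2, fun h => main (.inr h.1) h.2⟩
end

section
/- Let A be the adjacency matrix of a connected, non-complete, inhomogeneous, 6-regular and 2 net-regular strongly regular signed graph with parameters (n, 6, a, b, c) lying in the class C1 ∪ C4 ∪ C5. If A contains an unbalanced triangle of the first type, then (a, b) ≠ (0, 1), (a, b) ≠ (0, 2) and (a, b) ≠ (0, 3). -/
/-- The positive part `P` and the negative part `N` of a signed graph on `n` vertices in which every
vertex has four positive and two negative neighbours, where `P` and `N` commute and the square of
`P - N` is `6` on the diagonal, `0` on positive edges, `b` on negative edges and `c` elsewhere. -/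
structure SignedSplit {n : ℕ} (P N : Matrix (Fin n) (Fin n) ℤ) (b c : ℤ) : Prop where
  symm_pos : ∀ i j, P i j = P j i
  symm_neg : ∀ i j, N i j = N j i
  diag_pos : ∀ i, P i i = 0
  diag_neg : ∀ i, N i i = 0
  entry : ∀ i j, P i j = 0 ∧ N i j = 0 ∨ P i j = 1 ∧ N i j = 0 ∨ P i j = 0 ∧ N i j = 1
  sum_pos : ∀ i, ∑ j, P i j = 4
  sum_neg : ∀ i, ∑ j, N i j = 2
  comm : P * N = N * P
  sq : ∀ i j, (P * P) i j + (N * N) i j - 2 * (N * P) i j =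
    6 * (if j = i then 1 else 0) + b * N i j + c * (1 - (if j = i then 1 else 0) - P i j - N i j)

namespace SignedSplit

variable {n : ℕ} {P N : Matrix (Fin n) (Fin n) ℤ} {b c : ℤ}

theorem pos_nonneg (h : SignedSplit P N b c) (i j : Fin n) : 0 ≤ P i j := by
  have := h.entry i j; omega

theorem neg_nonneg (h : SignedSplit P N b c) (i j : Fin n) : 0 ≤ N i j := by
  have := h.entry i j; omega

theorem sum_pos_col (h : SignedSplit P N b c) (j : Fin n) : ∑ i, P i j = 4 := by
  simp_rw [h.symm_pos _ j, h.sum_pos]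

theorem sum_neg_col (h : SignedSplit P N b c) (j : Fin n) : ∑ i, N i j = 2 := by
  simp_rw [h.symm_neg _ j, h.sum_neg]

theorem card_mul (h : SignedSplit P N b c) (i : Fin n) : ((n : ℤ) - 7) * c = -2 - 2 * b := by
  have h1 : ∑ j, ((P * P) i j + (N * N) i j - 2 * (N * P) i j) = 4 := by
    have e : ∀ X Y : Matrix (Fin n) (Fin n) ℤ, ∑ j, (X * Y) i j = ∑ k, X i k * ∑ j, Y k j := by
      intro X Y
      simp_rw [Matrix.mul_apply, Finset.mul_sum]
      exact Finset.sum_comm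
    simp_rw [Finset.sum_sub_distrib, Finset.sum_add_distrib, ← Finset.mul_sum, e, h.sum_pos,
      h.sum_neg, ← Finset.sum_mul, h.sum_pos, h.sum_neg]
    norm_num
  simp_rw [h.sq, Finset.sum_add_distrib, ← Finset.mul_sum, Finset.sum_sub_distrib, h.sum_pos,
    h.sum_neg] at h1
  simp at h1
  linarith

theorem mul_add_mul_le (h : SignedSplit P N b c) (i j : Fin n) :
    (N * P) i j + (N * N) i j ≤ 2 := by
  rw [← h.sum_neg i, Matrix.mul_apply, Matrix.mul_apply, ← Finset.sum_add_distrib]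
  refine Finset.sum_le_sum fun k _ => ?_
  rcases h.entry i k with ⟨_, e⟩ | ⟨_, e⟩ | ⟨_, e⟩ <;>
    rcases h.entry k j with ⟨e1, e2⟩ | ⟨e1, e2⟩ | ⟨e1, e2⟩ <;> simp [*]

theorem neg_mul_pos_nonneg (h : SignedSplit P N b c) (i j : Fin n) : 0 ≤ (N * P) i j := by
  rw [Matrix.mul_apply]
  exact Finset.sum_nonneg fun k _ => mul_nonneg (h.neg_nonneg i k) (h.pos_nonneg k j)

theorem neg_mul_neg_nonneg (h : SignedSplit P N b c) (i j : Fin n) : 0 ≤ (N * N) i j := by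
  rw [Matrix.mul_apply]
  exact Finset.sum_nonneg fun k _ => mul_nonneg (h.neg_nonneg i k) (h.neg_nonneg k j)

theorem pos_mul_pos_nonneg (h : SignedSplit P N b c) (i j : Fin n) : 0 ≤ (P * P) i j := by
  rw [Matrix.mul_apply]
  exact Finset.sum_nonneg fun k _ => mul_nonneg (h.pos_nonneg i k) (h.pos_nonneg k j)

/-- The number of common neighbours of `i` and `j`. -/
theorem common_eq (h : SignedSplit P N b c) (i j : Fin n) :
    ∑ k, (P i k + N i k) * (P k j + N k j) =
      (P * P) i j + (N * N) i j + 2 * (N * P) i j := by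
  have e : (P * N) i j = (N * P) i j := by rw [h.comm]
  have : ∑ k, (P i k + N i k) * (P k j + N k j) =
      (P * P) i j + (N * N) i j + (P * N) i j + (N * P) i j := by
    simp only [Matrix.mul_apply, ← Finset.sum_add_distrib]
    exact Finset.sum_congr rfl fun k _ => by ring
  rw [this, e]; ring

theorem common_le (h : SignedSplit P N b c) (i j : Fin n) :
    (P * P) i j + (N * N) i j + 2 * (N * P) i j ≤ 6 := by
  rw [← h.common_eq]
  calc _ ≤ ∑ k, (P i k + N i k) := by
        refine Finset.sum_le_sum fun k _ => ?_
        rcases h.entry i k with ⟨e, e'⟩ | ⟨e, e'⟩ | ⟨e, e'⟩ <;>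
          rcases h.entry k j with ⟨e1, e2⟩ | ⟨e1, e2⟩ | ⟨e1, e2⟩ <;> simp [*]
    _ = 6 := by rw [Finset.sum_add_distrib, h.sum_pos, h.sum_neg]; norm_num

theorem le_common (h : SignedSplit P N b c) {i j : Fin n} (hij : i ≠ j) (hP : P i j = 0)
    (hN : N i j = 0) : 14 - (n : ℤ) ≤ (P * P) i j + (N * N) i j + 2 * (N * P) i j := by
  rw [← h.common_eq]
  have h1 : ∑ k, (1 - P i k - N i k) * (1 - P k j - N k j) =
      (n : ℤ) - 12 + ∑ k, (P i k + N i k) * (P k j + N k j) := by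
    have : ∀ k, (1 - P i k - N i k) * (1 - P k j - N k j) =
        1 - P i k - N i k - P k j - N k j + (P i k + N i k) * (P k j + N k j) := fun k => by ring
    simp_rw [this, Finset.sum_add_distrib, Finset.sum_sub_distrib, h.sum_pos, h.sum_neg,
      h.sum_pos_col, h.sum_neg_col]
    simp; ring
  have h2 : ∑ k ∈ {i, j}, (1 - P i k - N i k) * (1 - P k j - N k j) ≤
      ∑ k, (1 - P i k - N i k) * (1 - P k j - N k j) := by
    refine Finset.sum_le_sum_of_subset_of_nonneg (Finset.subset_univ _) fun k _ _ => ?_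
    have := h.entry i k
    have := h.entry k j
    exact mul_nonneg (by omega) (by omega)
  rw [Finset.sum_pair hij] at h2
  simp only [h.diag_pos, h.diag_neg, hP, hN] at h2
  linarith

theorem nonadj_bounds (h : SignedSplit P N b c) {i j : Fin n} (hij : i ≠ j) (hP : P i j = 0)
    (hN : N i j = 0) :
    -c ≤ 2 * (N * P) i j ∧ (N * P) i j ≤ 2 ∧ 4 * (N * P) i j + c ≤ 6 ∧
      14 - (n : ℤ) ≤ 4 * (N * P) i j + c := by
  have h1 := h.sq i j
  have h2 := h.mul_add_mul_le i j
  have h3 := h.neg_mul_neg_nonneg i j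
  have h4 := h.pos_mul_pos_nonneg i j
  have h5 := h.common_le i j
  have h6 := h.le_common hij hP hN
  simp only [hP, hN, if_neg hij.symm] at h1
  refine ⟨?_, ?_, ?_, ?_⟩ <;> linarith

theorem exists_neg_neighbors (h : SignedSplit P N b c) (i : Fin n) :
    ∃ k l, k ≠ l ∧ ∀ j, N i j = (if j = k then 1 else 0) + (if j = l then 1 else 0) := by
  have hc : (Finset.univ.filter fun j => N i j = 1).card = 2 := by
    have : ∑ j, N i j = ∑ j, if N i j = 1 then 1 else 0 :=
      Finset.sum_congr rfl fun j _ => by have := h.entry i j; split_ifs <;> omega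
    rw [h.sum_neg, Finset.sum_boole] at this
    exact_mod_cast this.symm
  obtain ⟨k, l, hkl, e⟩ := Finset.card_eq_two.mp hc
  refine ⟨k, l, hkl, fun j => ?_⟩
  have hj : N i j = 1 ↔ j = k ∨ j = l := by simpa using Finset.ext_iff.mp e j
  have := h.entry i j
  by_cases h1 : j = k
  · subst h1; simp [hkl, hj.mpr]
  · by_cases h2 : j = l
    · subst h2; simp [h1, hj.mpr]
    · simp only [h1, h2, or_self, iff_false] at hj
      simp [h1, h2]; omega

theorem neg_row_eq (h : SignedSplit P N b c) {i k l : Fin n} (hkl : k ≠ l) (hk : N i k = 1)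
    (hl : N i l = 1) (j : Fin n) :
    N i j = (if j = k then 1 else 0) + (if j = l then 1 else 0) := by
  obtain ⟨u, v, huv, e⟩ := h.exists_neg_neighbors i
  have h1 := e k
  have h2 := e l
  rw [hk] at h1
  rw [hl] at h2
  rw [e]
  grind

/-- The sums of `P * P` over the negative neighbours of `i`, and of `N * P` over the vertices that
are not adjacent to `i`, in terms of the two negative neighbours `k` and `l` of `i`. -/
theorem sum_eq (h : SignedSplit P N b c) {i k l : Fin n}
    (hN : ∀ j, N i j = (if j = k then 1 else 0) + (if j = l then 1 else 0)) :
    ∑ j, N i j * (P * P) i j = 2 * b - 2 * N k l + 4 * P k l ∧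
    ∑ j, (1 - (if j = i then 1 else 0) - P i j - N i j) * (N * P) i j =
      8 - 2 * b + 2 * N k l - 6 * P k l := by
  have hsum : ∀ f : Fin n → ℤ, ∑ j, N i j * f j = f k + f l := fun f => by
    simp [hN, add_mul, Finset.sum_add_distrib]
  have hik : N i k = 1 ∧ N i l = 1 := by
    have h1 := hN k
    have h2 := hN l
    have h3 := h.entry i k
    have h4 := h.entry i l
    simp only [if_true] at h1 h2
    grind
  have hNX : ∑ j, N i j * (N * P) i j = 2 * P k l := by
    rw [hsum]
    simp_rw [Matrix.mul_apply, hsum, h.diag_pos, h.symm_pos l k]; ring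
  have hNM : ∑ j, N i j * (N * N) i j = 2 * N k l := by
    rw [hsum]
    simp_rw [Matrix.mul_apply, hsum, h.diag_neg, h.symm_neg l k]; ring
  have hNsq : ∑ j, N i j * ((P * P) i j + (N * N) i j - 2 * (N * P) i j) = 2 * b := by
    have hi : N i i = 0 := h.diag_neg i
    have h1 := h.entry i k
    have h2 := h.entry i l
    have h3 : k ≠ i := by rintro rfl; omega
    have h4 : l ≠ i := by rintro rfl; omega
    rw [hsum, h.sq, h.sq, if_neg h3, if_neg h4, hik.1, hik.2, show P i k = 0 by omega,
      show P i l = 0 by omega]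
    ring
  have hT : ∑ j, N i j * (P * P) i j = 2 * b - 2 * N k l + 4 * P k l := by
    have : ∑ j, N i j * ((P * P) i j + (N * N) i j - 2 * (N * P) i j) =
        ∑ j, N i j * (P * P) i j + ∑ j, N i j * (N * N) i j - 2 * ∑ j, N i j * (N * P) i j := by
      rw [Finset.mul_sum, ← Finset.sum_add_distrib, ← Finset.sum_sub_distrib]
      exact Finset.sum_congr rfl fun j _ => by ring
    linarith
  have hPX : ∑ j, P i j * (N * P) i j = ∑ j, N i j * (P * P) i j := by
    simp_rw [Matrix.mul_apply, Finset.mul_sum]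
    rw [Finset.sum_comm]
    refine Finset.sum_congr rfl fun k _ => Finset.sum_congr rfl fun j _ => ?_
    rw [h.symm_pos k j]; ring
  have hX : ∑ j, (N * P) i j = 8 := by
    simp_rw [Matrix.mul_apply, hsum, Finset.sum_add_distrib, h.sum_pos]; norm_num
  have hXi : (N * P) i i = 0 := by
    rw [Matrix.mul_apply, Finset.sum_eq_zero]
    intro j _
    rw [h.symm_pos j i, mul_eq_zero]
    have := h.entry i j
    omega
  refine ⟨hT, ?_⟩
  simp_rw [sub_mul, Finset.sum_sub_distrib, hPX, hNX, hT]
  simp only [one_mul, hX, ite_mul, zero_mul, Finset.sum_ite_eq', Finset.mem_univ, if_true, hXi]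
  ring

/-- The weights of the vertices that are not adjacent to `i` add up to `n - 7`. -/
theorem sum_nonadj (h : SignedSplit P N b c) (i : Fin n) :
    ∑ j, (1 - (if j = i then 1 else 0) - P i j - N i j) = (n : ℤ) - 7 := by
  simp_rw [Finset.sum_sub_distrib, h.sum_pos, h.sum_neg]
  simp; ring

theorem nonadj_sum_bounds (h : SignedSplit P N b c) (i : Fin n) {u v : ℤ}
    (huv : ∀ x : ℤ, -c ≤ 2 * x → x ≤ 2 → 4 * x + c ≤ 6 → 14 - (n : ℤ) ≤ 4 * x + c → u ≤ x ∧ x ≤ v) :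
    ((n : ℤ) - 7) * u ≤ ∑ j, (1 - (if j = i then 1 else 0) - P i j - N i j) * (N * P) i j ∧
    ∑ j, (1 - (if j = i then 1 else 0) - P i j - N i j) * (N * P) i j ≤ ((n : ℤ) - 7) * v := by
  rw [← h.sum_nonadj i, Finset.sum_mul, Finset.sum_mul]
  have key : ∀ j, (1 - (if j = i then 1 else 0) - P i j - N i j) * u ≤
      (1 - (if j = i then 1 else 0) - P i j - N i j) * (N * P) i j ∧
      (1 - (if j = i then 1 else 0) - P i j - N i j) * (N * P) i j ≤
      (1 - (if j = i then 1 else 0) - P i j - N i j) * v := by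
    intro j
    by_cases hj : j = i
    · subst hj; simp [h.diag_pos, h.diag_neg]
    · rcases h.entry i j with ⟨e, e'⟩ | ⟨e, e'⟩ | ⟨e, e'⟩
      · obtain ⟨h1, h2, h3, h4⟩ := h.nonadj_bounds (Ne.symm hj) e e'
        simpa [hj, e, e'] using huv _ h1 h2 h3 h4
      · simp [hj, e, e']
      · simp [hj, e, e']
  exact ⟨Finset.sum_le_sum fun j _ => (key j).1, Finset.sum_le_sum fun j _ => (key j).2⟩

/-- If every vertex lies in a negative triangle, then the negative graph is a disjoint union of
triangles. -/
theorem three_dvd (h : SignedSplit P N b c)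
    (htri : ∀ i k l, k ≠ l → N i k = 1 → N i l = 1 → N k l = 1) : 3 ∣ n := by
  have hB : (N + 1) * (N + 1) = (3 : ℤ) • (N + 1) := by
    have hNN : N * N = N + 2 := by
      ext i j
      obtain ⟨k, l, hkl, e⟩ := h.exists_neg_neighbors i
      have hk : N i k = 1 := by simp [e, hkl]
      have hl : N i l = 1 := by simp [e, hkl.symm]
      have hkl' := htri i k l hkl hk hl
      have hil : i ≠ l := by rintro rfl; simp [h.diag_neg] at hl
      have hik : i ≠ k := by rintro rfl; simp [h.diag_neg] at hk
      have e1 := h.neg_row_eq hil ((h.symm_neg k i).trans hk) hkl' j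
      have e2 := h.neg_row_eq hik ((h.symm_neg l i).trans hl) ((h.symm_neg l k).trans hkl') j
      have : (N * N) i j = N k j + N l j := by
        simp [Matrix.mul_apply, e, add_mul, Finset.sum_add_distrib]
      rw [this, e1, e2, Matrix.add_apply, e, Matrix.ofNat_apply]
      simp only [eq_comm (a := j)]
      split_ifs <;> norm_num
    rw [add_mul, mul_add, hNN, mul_one, one_mul, ← one_add_one_eq_two]
    module
  let f : ℤ →+* ZMod 3 := Int.castRingHom (ZMod 3)
  have hnil : IsNilpotent ((N + 1).map f) := by
    refine ⟨2, ?_⟩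
    rw [pow_two, ← Matrix.map_mul, hB]
    ext i j
    rw [Matrix.map_apply, Matrix.smul_apply, smul_eq_mul, map_mul, show f 3 = 0 from rfl, zero_mul,
      Matrix.zero_apply]
  have htr := (Matrix.isNilpotent_trace_of_isNilpotent hnil).eq_zero
  have : ((N + 1).map f).trace = (n : ZMod 3) := by
    simp [Matrix.trace, h.diag_neg, f]
  rw [this] at htr
  exact (ZMod.natCast_eq_zero_iff n 3).mp htr

theorem lt_card (h : SignedSplit P N b c) (hb : 0 < b) (i : Fin n) : 7 < n := by
  have h1 : (0 : ℤ) ≤ (n : ℤ) - 7 := by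
    rw [← h.sum_nonadj i]
    refine Finset.sum_nonneg fun j _ => ?_
    have := h.entry i j
    by_cases hj : j = i
    · subst hj; simp [h.diag_pos, h.diag_neg]
    · simp only [hj, if_false]; omega
  have h2 := h.card_mul i
  have h3 : (n : ℤ) ≠ 7 := by
    intro e
    rw [e] at h2
    omega
  omega

theorem params (h : SignedSplit P N b c) (hb : b = 1 ∨ b = 2 ∨ b = 3) (i : Fin n) :
    b = 1 ∧ (n = 8 ∧ c = -4 ∨ n = 9 ∧ c = -2 ∨ n = 11 ∧ c = -1) ∨
    b = 2 ∧ (n = 8 ∧ c = -6 ∨ n = 9 ∧ c = -3 ∨ n = 10 ∧ c = -2 ∨ n = 13 ∧ c = -1) ∨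
    b = 3 ∧ (n = 8 ∧ c = -8 ∨ n = 9 ∧ c = -4 ∨ n = 11 ∧ c = -2 ∨ n = 15 ∧ c = -1) := by
  have hn := h.lt_card (by omega) i
  have hc := h.card_mul i
  have hc0 : c < 0 := by
    by_contra! h0
    have : 0 ≤ ((n : ℤ) - 7) * c := mul_nonneg (by omega) h0
    omega
  have hn' : n ≤ 15 := by
    by_contra! h0
    have : 0 ≤ ((n : ℤ) - 16) * (-1 - c) := mul_nonneg (by omega) (by omega)
    rcases hb with rfl | rfl | rfl <;> linarith
  clear h
  interval_cases n <;> norm_num at hc ⊢ <;> omega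

/-- The two negative neighbours of a vertex are joined by a negative edge, and only few parameters
remain. -/
theorem neg_triangle (h : SignedSplit P N b c) (hb : b = 1 ∨ b = 2 ∨ b = 3) {i k l : Fin n}
    (hkl : k ≠ l) (hk : N i k = 1) (hl : N i l = 1) :
    N k l = 1 ∧ (b = 1 ∨ b = 2 ∧ (n = 10 ∨ n = 13)) := by
  have hY := (h.sum_eq (h.neg_row_eq hkl hk hl)).2
  have hent := h.entry k l
  have hbd := fun u v => h.nonadj_sum_bounds i (u := u) (v := v)
  have hM : 1 ≤ (N * N) k l := by
    rw [Matrix.mul_apply]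
    calc (1 : ℤ) = N k i * N i l := by rw [h.symm_neg k i, hk, hl]; rfl
      _ ≤ _ := Finset.single_le_sum (f := fun j => N k j * N j l)
        (fun j _ => mul_nonneg (h.neg_nonneg k j) (h.neg_nonneg j l)) (Finset.mem_univ i)
  have hXM := h.mul_add_mul_le k l
  have hX : P k l = 0 → N k l = 0 → -c ≤ 2 * (N * P) k l :=
    fun e e' => (h.nonadj_bounds hkl e e').1
  rcases h.params hb i with ⟨rfl, h'⟩ | ⟨rfl, h'⟩ | ⟨rfl, h'⟩
  · rcases h' with ⟨hn, rfl⟩ | ⟨hn, rfl⟩ | ⟨hn, rfl⟩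
    · have := hbd 2 2 (by omega); rw [hY, hn] at this; omega
    · have := hbd 1 2 (by omega); rw [hY, hn] at this; omega
    · have := hbd 1 1 (by omega); rw [hY, hn] at this; omega
  · rcases h' with ⟨hn, rfl⟩ | ⟨hn, rfl⟩ | ⟨hn, rfl⟩ | ⟨hn, rfl⟩
    · have := hbd 3 2 (by omega); rw [hY, hn] at this; omega
    · have := hbd 2 2 (by omega); rw [hY, hn] at this; omega
    · have := hbd 2 2 (by omega); rw [hY, hn] at this; omega
    · have := hbd 1 1 (by omega); rw [hY, hn] at this; omega
  · rcases h' with ⟨hn, rfl⟩ | ⟨hn, rfl⟩ | ⟨hn, rfl⟩ | ⟨hn, rfl⟩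
    · have := hbd 3 2 (by omega); rw [hY, hn] at this; omega
    · have := hbd 3 2 (by omega); rw [hY, hn] at this; omega
    · have := hbd 2 2 (by omega); rw [hY, hn] at this; omega
    · have := hbd 1 2 (by omega); rw [hY, hn] at this; omega

theorem not_unbalanced_triangle (h : SignedSplit P N b c) (hb : b = 1 ∨ b = 2 ∨ b = 3)
    {i j m : Fin n} (hij : N i j = 1) (him : P i m = 1) (hjm : P j m = 1) : False := by
  obtain ⟨k, l, hkl, e⟩ := h.exists_neg_neighbors i
  obtain ⟨hN, hb'⟩ := h.neg_triangle hb hkl (i := i) (by simp [e, hkl]) (by simp [e, hkl.symm])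
  rcases hb' with rfl | ⟨rfl, hn⟩
  · have hT := (h.sum_eq e).1
    have hP : P k l = 0 := by have := h.entry k l; omega
    have h1 : 1 ≤ (P * P) i j := by
      rw [Matrix.mul_apply]
      calc (1 : ℤ) = P i m * P m j := by rw [h.symm_pos m j, him, hjm]; rfl
        _ ≤ _ := Finset.single_le_sum (f := fun x => P i x * P x j)
          (fun x _ => mul_nonneg (h.pos_nonneg i x) (h.pos_nonneg x j)) (Finset.mem_univ m)
    have h2 : N i j * (P * P) i j ≤ ∑ x, N i x * (P * P) i x :=
      Finset.single_le_sum (f := fun x => N i x * (P * P) i x)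
        (fun x _ => mul_nonneg (h.neg_nonneg i x) (h.pos_mul_pos_nonneg i x)) (Finset.mem_univ j)
    rw [hT, hij, hN, hP] at h2
    omega
  · have := h.three_dvd fun i k l hkl hk hl => (h.neg_triangle (.inr (.inl rfl)) hkl hk hl).1
    omega

end SignedSplit

/-- The indicator matrix of the entries of `A` that are equal to `x`. -/
def entryIndicator {n : ℕ} (A : Matrix (Fin n) (Fin n) ℤ) (x : ℤ) : Matrix (Fin n) (Fin n) ℤ :=
  Matrix.of fun i j => if A i j = x then 1 else 0

theorem signedSplit_entryIndicator {n : ℕ} {A : Matrix (Fin n) (Fin n) ℤ} {b c : ℤ}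
    (hsymm : ∀ i j, A i j = A j i)
    (hdiag : ∀ i, A i i = 0)
    (hent : ∀ i j, A i j = -1 ∨ A i j = 0 ∨ A i j = 1)
    (hreg : ∀ i, (Finset.univ.filter (fun j => A i j ≠ 0)).card = 6)
    (hnet : ∀ i, ∑ j, A i j = 2)
    (hAA : ∀ i, (A * A) i i = 6)
    (hpos : ∀ i j, A i j = 1 → (A * A) i j = 0)
    (hneg : ∀ i j, A i j = -1 → (A * A) i j = b)
    (hnon : ∀ i j, i ≠ j → A i j = 0 → (A * A) i j = c)
    (hbc : b - 2 * c ≠ 0) :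
    SignedSplit (entryIndicator A 1) (entryIndicator A (-1)) b c := by
  set P := entryIndicator A 1 with hP
  set N := entryIndicator A (-1) with hN
  have entry : ∀ i j, P i j = 0 ∧ N i j = 0 ∧ A i j = 0 ∨ P i j = 1 ∧ N i j = 0 ∧ A i j = 1 ∨
      P i j = 0 ∧ N i j = 1 ∧ A i j = -1 := by
    intro i j
    rcases hent i j with e | e | e <;> simp [hP, hN, entryIndicator, e]
  have hA : A = P - N := by
    ext i j
    have := entry i j
    rw [Matrix.sub_apply]
    omega
  have hsq : A * A = (6 : ℤ) • 1 + b • N + c • (Matrix.of (fun _ _ => 1) - 1 - P - N) := by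
    ext i j
    simp only [Matrix.add_apply, Matrix.sub_apply, Matrix.smul_apply, Matrix.of_apply,
      Matrix.one_apply, smul_eq_mul]
    by_cases hij : i = j
    · subst hij
      have := entry i i
      have := hdiag i
      rw [hAA, show P i i = 0 by omega, show N i i = 0 by omega]
      simp
    · rcases entry i j with ⟨e1, e2, e3⟩ | ⟨e1, e2, e3⟩ | ⟨e1, e2, e3⟩
      · simp [hij, e1, e2, hnon i j hij e3]
      · simp [hij, e1, e2, hpos i j e3]
      · simp [hij, e1, e2, hneg i j e3]
  have hJ : A * Matrix.of (fun _ _ => (1 : ℤ)) = Matrix.of (fun _ _ => (1 : ℤ)) * A := by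
    ext i j
    simp only [Matrix.mul_apply, Matrix.of_apply, mul_one, one_mul, hnet]
    simp_rw [hsymm _ j, hnet]
  have hAN : A * N = N * A := by
    have e1 : (b - 2 * c) • N =
        A * A - (6 : ℤ) • 1 - c • (Matrix.of (fun _ _ => 1) - 1) + c • A := by
      rw [hsq]
      nth_rw 1 [hA]
      module
    have e2 : (b - 2 * c) • (A * N) = (b - 2 * c) • (N * A) := by
      rw [← Matrix.mul_smul, ← Matrix.smul_mul, e1]
      simp only [mul_add, mul_sub, add_mul, sub_mul, Matrix.mul_smul, Matrix.smul_mul, hJ, mul_one,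
        one_mul, mul_assoc]
    exact smul_right_injective _ hbc e2
  have comm : P * N = N * P := by
    rw [hA, sub_mul, mul_sub] at hAN
    exact sub_left_injective hAN
  have hsum : ∀ i, ∑ j, P i j + ∑ j, N i j = 6 ∧ ∑ j, P i j - ∑ j, N i j = 2 := by
    intro i
    rw [← hnet i, ← Finset.sum_add_distrib, ← Finset.sum_sub_distrib]
    constructor
    · rw [← Nat.cast_ofNat (R := ℤ), ← hreg i, ← Finset.sum_boole]
      refine Finset.sum_congr rfl fun j _ => ?_
      have := entry i j
      split_ifs <;> omega
    · refine Finset.sum_congr rfl fun j _ => ?_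
      have := entry i j
      omega
  refine ⟨?_, ?_, ?_, ?_, ?_, ?_, ?_, comm, ?_⟩
  · intro i j; simp [hP, entryIndicator, hsymm i j]
  · intro i j; simp [hN, entryIndicator, hsymm i j]
  · intro i; simp [hP, entryIndicator, hdiag]
  · intro i; simp [hN, entryIndicator, hdiag]
  · intro i j; have := entry i j; omega
  · intro i; have := hsum i; omega
  · intro i; have := hsum i; omega
  · intro i j
    have e1 : A * A = P * P + N * N - (2 : ℤ) • (N * P) := by
      rw [hA, sub_mul, mul_sub, mul_sub, comm]
      module
    have e2 := congrFun (congrFun (e1.symm.trans hsq) i) j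
    simp only [Matrix.add_apply, Matrix.sub_apply, Matrix.smul_apply, Matrix.of_apply,
      Matrix.one_apply, smul_eq_mul] at e2
    simp only [eq_comm (a := j)]
    exact e2

theorem stmt8 {n : ℕ} (A : Matrix (Fin n) (Fin n) ℤ) (a b c : ℤ)
    (hsymm : ∀ i j, A i j = A j i)
    (hdiag : ∀ i, A i i = 0)
    (hent : ∀ i j, A i j = -1 ∨ A i j = 0 ∨ A i j = 1)
    (hconn : (SimpleGraph.fromRel (fun i j => A i j ≠ 0)).Connected)
    (hncomp : ¬ ∀ i j : Fin n, i ≠ j → A i j ≠ 0)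
    (hinhom : (∃ i j, A i j = 1) ∧ (∃ i j, A i j = -1))
    (hreg : ∀ i, (Finset.univ.filter (fun j => A i j ≠ 0)).card = 6)
    (hnet : ∀ i, ∑ j, A i j = 2)
    (hAA : ∀ i, (A * A) i i = 6)
    (hpos : ∀ i j, A i j = 1 → (A * A) i j = a)
    (hneg : ∀ i j, A i j = -1 → (A * A) i j = b)
    (hnon : ∀ i j, i ≠ j → A i j = 0 → (A * A) i j = c)
    (hclass : ¬(a = -b ∧ c = 0) ∧ ¬(a ≠ -b ∧ 2 * c = a + b))
    (htri1 : ∃ i j k : Fin n,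
      (A i j = -1 ∧ A j k = 1 ∧ A i k = 1) ∨
      (A i j = 1 ∧ A j k = -1 ∧ A i k = 1) ∨
      (A i j = 1 ∧ A j k = 1 ∧ A i k = -1)) :
    ¬(a = 0 ∧ b = 1) ∧ ¬(a = 0 ∧ b = 2) ∧ ¬(a = 0 ∧ b = 3) := by
  suffices key : a = 0 → ¬(b = 1 ∨ b = 2 ∨ b = 3) by
    refine ⟨fun h => key h.1 ?_, fun h => key h.1 ?_, fun h => key h.1 ?_⟩ <;> simp [h.2]
  rintro rfl hb
  have h := signedSplit_entryIndicator hsymm hdiag hent hreg hnet hAA hpos hneg hnon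
    (fun e => hclass.2 ⟨by omega, by omega⟩)
  have hI : ∀ {i j x}, A i j = x → entryIndicator A x i j = 1 := fun e => by
    simp [entryIndicator, e]
  obtain ⟨i, j, k, ⟨h1, h2, h3⟩ | ⟨h1, h2, h3⟩ | ⟨h1, h2, h3⟩⟩ := htri1
  · exact h.not_unbalanced_triangle hb (hI h1) (hI h3) (hI h2)
  · exact h.not_unbalanced_triangle hb (hI h2) (hI ((hsymm j i).trans h1))
      (hI ((hsymm k i).trans h3))
  · exact h.not_unbalanced_triangle hb (hI h3) (hI h1) (hI ((hsymm k j).trans h2))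
end

section
/- Let A be the adjacency matrix of a connected, non-complete, inhomogeneous, 6-regular and 2 net-regular strongly regular signed graph with parameters (n, 6, a, b, c) lying in the class C1 ∪ C4 ∪ C5. If A contains an unbalanced triangle of the first type and b = 3, then A also contains an unbalanced triangle of the second type. -/
/-- A row with six nonzero entries `±1` summing to `2` has two entries `-1` and four entries `1`. -/
lemma exists_neighbors {n : ℕ} (A : Matrix (Fin n) (Fin n) ℤ)
    (hent : ∀ i j, A i j = -1 ∨ A i j = 0 ∨ A i j = 1) (i : Fin n)
    (hreg : (Finset.univ.filter (fun j => A i j ≠ 0)).card = 6)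
    (hnet : ∑ j, A i j = 2) :
    (Finset.univ.filter (fun j => A i j = 1)).card = 4 ∧
    (Finset.univ.filter (fun j => A i j = -1)).card = 2 ∧
    ∃ x y p q r s : Fin n, x ≠ y ∧ p ≠ q ∧ p ≠ r ∧ p ≠ s ∧ q ≠ r ∧ q ≠ s ∧ r ≠ s ∧
      (∀ k, A i k = -1 ↔ k = x ∨ k = y) ∧
      (∀ k, A i k = 1 ↔ k = p ∨ k = q ∨ k = r ∨ k = s) ∧
      ∀ f : Fin n → ℤ, ∑ k, A i k * f k = f p + f q + f r + f s - f x - f y := by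
  have hsplit : ∀ f : Fin n → ℤ, ∑ k, A i k * f k =
      ∑ k ∈ Finset.univ.filter (fun j => A i j = 1), f k -
        ∑ k ∈ Finset.univ.filter (fun j => A i j = -1), f k := by
    intro f
    rw [Finset.sum_filter, Finset.sum_filter, ← Finset.sum_sub_distrib]
    refine Finset.sum_congr rfl fun k _ => ?_
    rcases hent i k with h | h | h <;> simp [h]
  have hdiff := hsplit (fun _ => 1)
  have hsum : (Finset.univ.filter (fun j => A i j = 1)).card +
      (Finset.univ.filter (fun j => A i j = -1)).card = 6 := by
    rw [← hreg, ← Finset.card_union_of_disjoint]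
    · congr 1
      ext k
      rcases hent i k with h | h | h <;> simp [h]
    · rw [Finset.disjoint_filter]
      intro k _ h
      omega
  simp only [mul_one, hnet, Finset.sum_const, nsmul_eq_mul] at hdiff
  have hP : (Finset.univ.filter (fun j => A i j = 1)).card = 4 := by omega
  have hN : (Finset.univ.filter (fun j => A i j = -1)).card = 2 := by omega
  refine ⟨hP, hN, ?_⟩
  obtain ⟨x, y, hxy, hNe⟩ := Finset.card_eq_two.mp hN
  obtain ⟨p, t, hpt, hPe, ht⟩ := Finset.card_eq_succ.mp hP
  obtain ⟨q, r, s, hqr, hqs, hrs, rfl⟩ := Finset.card_eq_three.mp ht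
  simp only [Finset.mem_insert, Finset.mem_singleton, not_or] at hpt
  obtain ⟨hpq, hpr, hps⟩ := hpt
  refine ⟨x, y, p, q, r, s, hxy, hpq, hpr, hps, hqr, hqs, hrs, ?_, ?_, ?_⟩
  · intro k
    simpa using congrArg (k ∈ ·) hNe
  · intro k
    simpa using (congrArg (k ∈ ·) hPe).symm
  · intro f
    rw [hsplit, hNe, ← hPe, Finset.sum_pair hxy, Finset.sum_insert (by simp [hpq, hpr, hps]),
      Finset.sum_insert (by simp [hqr, hqs]), Finset.sum_pair hrs]
    ring

/-- The adjacency matrix of a 6-regular and 2 net-regular strongly regular signed graph with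
`b = 3` in which no triangle has three negative edges. -/
structure IsNegTriangleFreeSRSG {n : ℕ} (A : Matrix (Fin n) (Fin n) ℤ) (a c : ℤ) : Prop where
  symm : ∀ i j, A i j = A j i
  diag : ∀ i, A i i = 0
  ent : ∀ i j, A i j = -1 ∨ A i j = 0 ∨ A i j = 1
  reg : ∀ i, (Finset.univ.filter (fun j => A i j ≠ 0)).card = 6
  net : ∀ i, ∑ j, A i j = 2
  sq_diag : ∀ i, (A * A) i i = 6
  pos : ∀ i j, A i j = 1 → (A * A) i j = a
  neg : ∀ i j, A i j = -1 → (A * A) i j = 3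
  non : ∀ i j, i ≠ j → A i j = 0 → (A * A) i j = c
  triangle : ∀ i j k, A i j = -1 → A j k = -1 → A i k ≠ -1

namespace IsNegTriangleFreeSRSG

variable {n : ℕ} {A : Matrix (Fin n) (Fin n) ℤ} {a c : ℤ}

/-- No triangle has exactly two negative edges. -/
lemma ne_one_of_neg_of_neg (h : IsNegTriangleFreeSRSG A a c) :
    ∀ i j k, A i j = -1 → A i k = -1 → A j k ≠ 1 := by
  have hnb := fun i => exists_neighbors A h.ent i (h.reg i) (h.net i)
  have hmul : ∀ i j, (A * A) i j = ∑ k, A i k * A k j := fun i j => Matrix.mul_apply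
  intro i j k hij hik hjk
  obtain ⟨-, -, x, y, p, q, r, s, -, hpq, hpr, hps, hqr, hqs, hrs, hn, hp, hf⟩ := hnb i
  have h3 := h.neg i j hij
  have hkj : A k j = 1 := by rw [h.symm]; exact hjk
  have hs : A p j + A q j + A r j + A s j = 4 := by
    rw [hmul, hf] at h3
    have hjj := h.diag j
    rcases (hn j).1 hij with rfl | rfl <;> rcases (hn k).1 hik with rfl | rfl <;> linarith
  have hle : ∀ l, A l j ≤ 1 := fun l => by rcases h.ent l j with h0 | h0 | h0 <;> simp [h0]
  have e1 := hle p
  have e2 := hle q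
  have e3 := hle r
  have e4 := hle s
  have hk : A i k ≠ 1 := by rw [hik]; decide
  rw [Ne, hp] at hk
  push Not at hk
  obtain ⟨k1, k2, k3, k4⟩ := hk
  have hsub : ({k, p, q, r, s} : Finset (Fin n)) ⊆
      Finset.univ.filter (fun l => A j l = 1) := by
    intro l hl
    simp only [Finset.mem_insert, Finset.mem_singleton] at hl
    simp only [Finset.mem_filter, Finset.mem_univ, true_and]
    rw [h.symm]
    rcases hl with rfl | rfl | rfl | rfl | rfl <;> linarith
  have hc := Finset.card_le_card hsub
  rw [(hnb j).1] at hc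
  simp [*] at hc

/-- The endpoints of a negative path of length two are not adjacent. -/
lemma eq_zero_of_neg_of_neg (h : IsNegTriangleFreeSRSG A a c) :
    ∀ i j k, A i j = -1 → A j k = -1 → A i k = 0 := by
  intro i j k hij hjk
  have h1 := h.triangle i j k hij hjk
  have h2 := h.ne_one_of_neg_of_neg j i k (by rw [h.symm]; exact hij) hjk
  have := h.ent i k
  omega

/-- The neighbours of an endpoint `x` of a negative edge `x i`: exactly three of
the positive ones are positively adjacent to `i`. -/
lemma exists_edge (h : IsNegTriangleFreeSRSG A a c) :
    ∀ x i, A x i = -1 → ∃ v u p q r, A x v = -1 ∧ v ≠ i ∧ A x u = 1 ∧ A x p = 1 ∧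
      A x q = 1 ∧ A x r = 1 ∧ p ≠ q ∧ p ≠ r ∧ q ≠ r ∧ A p i = 1 ∧ A q i = 1 ∧ A r i = 1 ∧
      A u i = 0 ∧ (∀ k, A x k = 1 → k = p ∨ k = q ∨ k = r ∨ k = u) ∧
      (∀ k, A x k = -1 → k = i ∨ k = v) ∧
      ∀ f : Fin n → ℤ, ∑ k, A x k * f k = f p + f q + f r + f u - f i - f v := by
  have hnb := fun i => exists_neighbors A h.ent i (h.reg i) (h.net i)
  have hmul : ∀ i j, (A * A) i j = ∑ k, A i k * A k j := fun i j => Matrix.mul_apply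
  intro x i hxi
  obtain ⟨-, -, y, z, p, q, r, s, hyz, hpq, hpr, hps, hqr, hqs, hrs, hn, hp, hf⟩ := hnb x
  obtain ⟨v, hvi, hn', hf'⟩ : ∃ v, v ≠ i ∧ (∀ k, A x k = -1 ↔ k = i ∨ k = v) ∧
      ∀ f : Fin n → ℤ, ∑ k, A x k * f k = f p + f q + f r + f s - f i - f v := by
    rcases (hn i).1 hxi with rfl | rfl
    · exact ⟨z, hyz.symm, hn, hf⟩
    · exact ⟨y, hyz, fun k => by rw [hn, or_comm], fun f => by rw [hf]; ring⟩
  have hv : A x v = -1 := (hn' v).2 (Or.inr rfl)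
  have h3 := h.neg x i hxi
  rw [hmul, hf', h.diag, h.eq_zero_of_neg_of_neg v x i (by rw [h.symm]; exact hv) hxi] at h3
  have hpos' : ∀ k, A x k = 1 → A k i = 0 ∨ A k i = 1 := by
    intro k hk
    have h1 := h.eq_zero_of_neg_of_neg x i k hxi
    have h2 := h.symm i k
    have := h.ent k i
    omega
  have p1 : A x p = 1 := (hp p).2 (by simp)
  have q1 : A x q = 1 := (hp q).2 (by simp)
  have r1 : A x r = 1 := (hp r).2 (by simp)
  have s1 : A x s = 1 := (hp s).2 (by simp)
  have p2 := hpos' p p1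
  have q2 := hpos' q q1
  have r2 := hpos' r r1
  have s2 := hpos' s s1
  have haux : ∀ w x y z : ℤ, (w = 0 ∨ w = 1) → (x = 0 ∨ x = 1) → (y = 0 ∨ y = 1) →
      (z = 0 ∨ z = 1) → w + x + y + z = 3 → w = 0 ∧ x = 1 ∧ y = 1 ∧ z = 1 ∨
        x = 0 ∧ w = 1 ∧ y = 1 ∧ z = 1 ∨ y = 0 ∧ w = 1 ∧ x = 1 ∧ z = 1 ∨
        z = 0 ∧ w = 1 ∧ x = 1 ∧ y = 1 := by
    rintro w x y z (rfl | rfl) (rfl | rfl) (rfl | rfl) (rfl | rfl) <;> simp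
  rcases haux _ _ _ _ p2 q2 r2 s2 (by linarith) with
    ⟨h0, h1, h2, h3⟩ | ⟨h0, h1, h2, h3⟩ | ⟨h0, h1, h2, h3⟩ | ⟨h0, h1, h2, h3⟩
  · exact ⟨v, p, q, r, s, hv, hvi, p1, q1, r1, s1, hqr, hqs, hrs, h1, h2, h3, h0,
      fun k hk => by rcases (hp k).1 hk with rfl | rfl | rfl | rfl <;> simp, fun k => (hn' k).1,
      fun f => by rw [hf']; ring⟩
  · exact ⟨v, q, p, r, s, hv, hvi, q1, p1, r1, s1, hpr, hps, hrs, h1, h2, h3, h0,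
      fun k hk => by rcases (hp k).1 hk with rfl | rfl | rfl | rfl <;> simp, fun k => (hn' k).1,
      fun f => by rw [hf']; ring⟩
  · exact ⟨v, r, p, q, s, hv, hvi, r1, p1, q1, s1, hpq, hps, hqs, h1, h2, h3, h0,
      fun k hk => by rcases (hp k).1 hk with rfl | rfl | rfl | rfl <;> simp, fun k => (hn' k).1,
      fun f => by rw [hf']; ring⟩
  · exact ⟨v, s, p, q, r, hv, hvi, s1, p1, q1, r1, hpq, hpr, hqr, h1, h2, h3, h0,
      fun k hk => by rcases (hp k).1 hk with rfl | rfl | rfl | rfl <;> simp, fun k => (hn' k).1,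
      hf'⟩

/-- Given a negative edge `i y`, only one positive neighbour of `i` is not adjacent to `y`. -/
lemma eq_of_eq_zero (h : IsNegTriangleFreeSRSG A a c) :
    ∀ i y p q, A i y = -1 → A i p = 1 → A i q = 1 → A p y = 0 → A q y = 0 → p = q := by
  intro i y p q hiy hip hiq hpy hqy
  obtain ⟨v, u, p', q', r', -, -, -, -, -, -, -, -, -, h1, h2, h3, -, hk, -, -⟩ :=
    h.exists_edge i y hiy
  have key : ∀ k, A i k = 1 → A k y = 0 → k = u := by
    intro k hik hky
    rcases hk k hik with rfl | rfl | rfl | rfl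
    · omega
    · omega
    · omega
    · rfl
  rw [key p hip hpy, key q hiq hqy]

/-- A lower bound for `c` from the walks of length two between two negative neighbours of `i`. -/
lemma exists_le (h : IsNegTriangleFreeSRSG A a c) :
    ∀ i x y, A x i = -1 → A i y = -1 → x ≠ y → ∃ u v, A x u = 1 ∧ A x v = -1 ∧ v ≠ i ∧
      (∀ k, A x k = -1 → k = i ∨ k = v) ∧ 3 + A u y - A v y ≤ c := by
  have hmul : ∀ i j, (A * A) i j = ∑ k, A i k * A k j := fun i j => Matrix.mul_apply
  intro i x y hxi hiy hxy
  obtain ⟨v, u, p, q, r, hv, hvi, hu, hp, hq, hr, hpq, hpr, hqr, hpi, hqi, hri, -, -, hn, hf⟩ :=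
    h.exists_edge x i hxi
  refine ⟨u, v, hu, hv, hvi, hn, ?_⟩
  have hc := h.non x y hxy (h.eq_zero_of_neg_of_neg x i y hxi hiy)
  rw [hmul, hf, hiy] at hc
  rw [h.symm _ i] at hpi hqi hri
  have hnn : ∀ k, A i k = 1 → A k y = 0 ∨ A k y = 1 := by
    intro k hk
    have h1 := h.eq_zero_of_neg_of_neg i y k hiy
    have h2 := h.symm y k
    have := h.ent k y
    omega
  have e1 := hnn p hpi
  have e2 := hnn q hqi
  have e3 := hnn r hri
  have f1 : ¬(A p y = 0 ∧ A q y = 0) := fun h0 =>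
    hpq (h.eq_of_eq_zero i y p q hiy hpi hqi h0.1 h0.2)
  have f2 : ¬(A p y = 0 ∧ A r y = 0) := fun h0 =>
    hpr (h.eq_of_eq_zero i y p r hiy hpi hri h0.1 h0.2)
  have f3 : ¬(A q y = 0 ∧ A r y = 0) := fun h0 =>
    hqr (h.eq_of_eq_zero i y q r hiy hqi hri h0.1 h0.2)
  omega

/-- Every row has `n - 6` zero entries. -/
lemma card_nonadj (h : IsNegTriangleFreeSRSG A a c) :
    ∀ i, (Finset.univ.filter (fun j => A i j = 0)).card + 6 = n := by
  intro i
  have := Finset.card_filter_add_card_filter_not (s := (Finset.univ : Finset (Fin n)))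
    (fun j => A i j = 0)
  rw [Finset.card_univ, Fintype.card_fin] at this
  have h6 := h.reg i
  simp only [ne_eq] at h6
  omega

/-- The row sums of `A ^ 2` relate the parameters. -/
lemma count (h : IsNegTriangleFreeSRSG A a c) (i₀ : Fin n) :
    4 * a + (n - 7) * c = -8 := by
  have hnb := fun i => exists_neighbors A h.ent i (h.reg i) (h.net i)
  have hmul : ∀ i j, (A * A) i j = ∑ k, A i k * A k j := fun i j => Matrix.mul_apply
  have h1 : ∑ j, (A * A) i₀ j = 4 := by
    simp only [hmul]
    rw [Finset.sum_comm]
    simp only [← Finset.mul_sum, h.net, ← Finset.sum_mul]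
    norm_num
  have h2 : ∀ j, (A * A) i₀ j = (if j = i₀ then 6 - c else 0) +
      (if A i₀ j = 1 then a - c else 0) + (if A i₀ j = -1 then 3 - c else 0) + c := by
    intro j
    by_cases hj : j = i₀
    · subst hj
      simp [h.sq_diag, h.diag]
    · rcases h.ent i₀ j with h0 | h0 | h0
      · simp [h0, hj, h.neg i₀ j h0]
      · simp [h0, hj, h.non i₀ j (Ne.symm hj) h0]
      · simp [h0, hj, h.pos i₀ j h0]
  simp only [h2, Finset.sum_add_distrib, ← Finset.sum_filter, Finset.sum_const, (hnb i₀).1,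
    (hnb i₀).2.1] at h1
  rw [Finset.filter_eq' Finset.univ i₀] at h1
  simp at h1
  linarith

/-- There are nonadjacent vertices, and `c` is positive. -/
lemma one_le (h : IsNegTriangleFreeSRSG A a c) (i₀ : Fin n) :
    1 ≤ c ∧ 8 ≤ n := by
  have hnb := fun i => exists_neighbors A h.ent i (h.reg i) (h.net i)
  obtain ⟨-, -, x, y, -, -, -, -, hxy, -, -, -, -, -, -, hn, -, -⟩ := hnb i₀
  have hx := (hn x).2 (by simp)
  have hy := (hn y).2 (by simp)
  have hx' : A x i₀ = -1 := by rw [h.symm]; exact hx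
  obtain ⟨u, v, -, -, -, -, hle⟩ := h.exists_le i₀ x y hx' hy hxy
  have h1 := h.ent u y
  have h2 := h.ent v y
  refine ⟨by omega, ?_⟩
  have hsub : ({x, y} : Finset (Fin n)) ⊆ Finset.univ.filter (fun l => A x l = 0) := by
    intro l hl
    simp only [Finset.mem_insert, Finset.mem_singleton] at hl
    simp only [Finset.mem_filter, Finset.mem_univ, true_and]
    rcases hl with rfl | rfl
    · exact h.diag _
    · exact h.eq_zero_of_neg_of_neg _ i₀ _ hx' hy
  have hc := Finset.card_le_card hsub
  rw [Finset.card_pair hxy] at hc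
  have := h.card_nonadj x
  omega

/-- A vertex has only two negative neighbours. -/
lemma eq_or_eq_of_neg (h : IsNegTriangleFreeSRSG A a c) (i j k l : Fin n) (hjk : j ≠ k)
    (hj : A i j = -1) (hk : A i k = -1) (hl : A i l = -1) : l = j ∨ l = k := by
  obtain ⟨-, -, x, y, -, -, -, -, hxy, -, -, -, -, -, -, hn, -, -⟩ :=
    exists_neighbors A h.ent i (h.reg i) (h.net i)
  rw [hn] at hj hk hl
  grind

set_option synthInstance.maxSize 1024 in
set_option synthInstance.maxHeartbeats 200000 in
/-- A triangle-free signed graph on four vertices with all net-degrees `-1` or `-2` and with sum of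
the edge weights `-3` has a negative path on four vertices. -/
lemma four_vertex_path : ∀ u₁ ∈ ({-1, 0, 1} : Finset ℤ),
      ∀ u₂ ∈ ({-1, 0, 1} : Finset ℤ), ∀ u₃ ∈ ({-1, 0, 1} : Finset ℤ),
      ∀ u₄ ∈ ({-1, 0, 1} : Finset ℤ), ∀ u₅ ∈ ({-1, 0, 1} : Finset ℤ),
      ∀ u₆ ∈ ({-1, 0, 1} : Finset ℤ),
    -2 ≤ u₁ + u₂ + u₃ →
    u₁ + u₂ + u₃ ≤ -1 →
    -2 ≤ u₁ + u₄ + u₅ →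
    u₁ + u₄ + u₅ ≤ -1 →
    -2 ≤ u₂ + u₄ + u₆ →
    u₂ + u₄ + u₆ ≤ -1 →
    -2 ≤ u₃ + u₅ + u₆ →
    u₃ + u₅ + u₆ ≤ -1 →
    u₁ + u₂ + u₃ + u₄ + u₅ + u₆ = -3 →
    ¬(u₁ = -1 ∧ u₂ = -1 ∧ u₄ ≠ 0) →
    ¬(u₂ = -1 ∧ u₄ = -1 ∧ u₁ ≠ 0) →
    ¬(u₁ = -1 ∧ u₄ = -1 ∧ u₂ ≠ 0) →
    ¬(u₁ = -1 ∧ u₃ = -1 ∧ u₅ ≠ 0) →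
    ¬(u₃ = -1 ∧ u₅ = -1 ∧ u₁ ≠ 0) →
    ¬(u₁ = -1 ∧ u₅ = -1 ∧ u₃ ≠ 0) →
    ¬(u₂ = -1 ∧ u₃ = -1 ∧ u₆ ≠ 0) →
    ¬(u₃ = -1 ∧ u₆ = -1 ∧ u₂ ≠ 0) →
    ¬(u₂ = -1 ∧ u₆ = -1 ∧ u₃ ≠ 0) →
    ¬(u₄ = -1 ∧ u₅ = -1 ∧ u₆ ≠ 0) →
    ¬(u₅ = -1 ∧ u₆ = -1 ∧ u₄ ≠ 0) →
    ¬(u₄ = -1 ∧ u₆ = -1 ∧ u₅ ≠ 0) →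
      u₁ = -1 ∧ u₄ = -1 ∧ u₆ = -1 ∧ u₃ = 0 ∨
      u₁ = -1 ∧ u₅ = -1 ∧ u₆ = -1 ∧ u₂ = 0 ∨
      u₂ = -1 ∧ u₄ = -1 ∧ u₅ = -1 ∧ u₃ = 0 ∨
      u₂ = -1 ∧ u₆ = -1 ∧ u₅ = -1 ∧ u₁ = 0 ∨
      u₃ = -1 ∧ u₅ = -1 ∧ u₄ = -1 ∧ u₂ = 0 ∨
      u₃ = -1 ∧ u₆ = -1 ∧ u₄ = -1 ∧ u₁ = 0 ∨
      u₁ = -1 ∧ u₂ = -1 ∧ u₆ = -1 ∧ u₅ = 0 ∨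
      u₁ = -1 ∧ u₃ = -1 ∧ u₆ = -1 ∧ u₄ = 0 ∨
      u₄ = -1 ∧ u₂ = -1 ∧ u₃ = -1 ∧ u₅ = 0 ∨
      u₅ = -1 ∧ u₃ = -1 ∧ u₂ = -1 ∧ u₄ = 0 ∨
      u₂ = -1 ∧ u₁ = -1 ∧ u₅ = -1 ∧ u₆ = 0 ∨
      u₄ = -1 ∧ u₁ = -1 ∧ u₃ = -1 ∧ u₆ = 0 := by
  decide +kernel

/-- The positive neighbours of a vertex span a negative path. -/
lemma exists_path (h : IsNegTriangleFreeSRSG A a c) (ha : a ≤ -3) (i₀ : Fin n) :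
    a = -3 ∧ ∃ p r s q, p ≠ q ∧ A p r = -1 ∧ A r s = -1 ∧ A s q = -1 ∧ A p q = 0 := by
  have hnb := fun i => exists_neighbors A h.ent i (h.reg i) (h.net i)
  have hmul : ∀ i j, (A * A) i j = ∑ k, A i k * A k j := fun i j => Matrix.mul_apply
  obtain ⟨-, -, x, y, p, q, r, s, hxy, hpq, hpr, hps, hqr, hqs, hrs, hn, hp, hf⟩ := hnb i₀
  have hx := (hn x).2 (by simp)
  have hy := (hn y).2 (by simp)
  have hyx := h.eq_zero_of_neg_of_neg y i₀ x (by rw [h.symm]; exact hy) hx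
  have hxx := h.neg i₀ x hx
  have hyy := h.neg i₀ y hy
  rw [hmul, hf] at hxx hyy
  have p1 := (hp p).2 (by simp)
  have q1 := (hp q).2 (by simp)
  have r1 := (hp r).2 (by simp)
  have s1 := (hp s).2 (by simp)
  have hm : ∀ k z, A i₀ k = 1 → A i₀ z = -1 → A k z = 0 ∨ A k z = 1 := by
    intro k z hk hz
    have h1 := h.eq_zero_of_neg_of_neg i₀ z k hz
    have h2 := h.symm z k
    have := h.ent k z
    omega
  have hb : ∀ k z, A i₀ k = 1 → A i₀ z = -1 → 0 ≤ A k z ∧ A k z ≤ 1 := by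
    intro k z hk hz
    rcases hm k z hk hz with h0 | h0 <;> simp [h0]
  obtain ⟨px, px'⟩ := hb p x p1 hx
  obtain ⟨py, py'⟩ := hb p y p1 hy
  obtain ⟨qx, qx'⟩ := hb q x q1 hx
  obtain ⟨qy, qy'⟩ := hb q y q1 hy
  obtain ⟨rx, rx'⟩ := hb r x r1 hx
  obtain ⟨ry, ry'⟩ := hb r y r1 hy
  obtain ⟨sx, sx'⟩ := hb s x s1 hx
  obtain ⟨sy, sy'⟩ := hb s y s1 hy
  have dp := h.pos i₀ p p1
  have dq := h.pos i₀ q q1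
  have dr := h.pos i₀ r r1
  have ds := h.pos i₀ s s1
  rw [hmul, hf] at dp dq dr ds
  rw [h.symm x, h.symm y, h.diag] at dp dq dr ds
  rw [h.symm y x] at hyx
  rw [h.diag, h.symm y x] at hxx
  rw [h.diag] at hyy
  rw [h.symm q p, h.symm r p, h.symm s p] at dp
  rw [h.symm r q, h.symm s q] at dq
  rw [h.symm s r] at dr
  have hdeg : ∀ i j k l, j ≠ k → j ≠ l → k ≠ l → -2 ≤ A i j + A i k + A i l := by
    intro i j k l hjk hjl hkl
    have h0 : ¬(A i j = -1 ∧ A i k = -1 ∧ A i l = -1) := by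
      rintro ⟨h1, h2, h3⟩
      rcases h.eq_or_eq_of_neg i j k l hjk h1 h2 h3 with rfl | rfl
      · exact hjl rfl
      · exact hkl rfl
    have h1 := h.ent i j
    have h2 := h.ent i k
    have h3 := h.ent i l
    clear hjk hjl hkl hpq hpr hps hqr hqs hrs hxy
    omega
  have cp := hdeg p q r s hqr hqs hrs
  have cq := hdeg q p r s hpr hps hrs
  have cr := hdeg r p q s hpq hps hqs
  have cs := hdeg s p q r hpq hpr hqr
  rw [h.symm q p] at cq
  rw [h.symm r p, h.symm r q] at cr
  rw [h.symm s p, h.symm s q, h.symm s r] at cs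
  obtain rfl : a = -3 := le_antisymm ha (by
    by_contra hlt
    have : a ≤ -4 := by lia
    linarith)
  refine ⟨rfl, ?_⟩
  have up : A p q + A p r + A p s ≤ -1 := by linarith
  have uq : A p q + A q r + A q s ≤ -1 := by linarith
  have ur : A p r + A q r + A r s ≤ -1 := by linarith
  have us : A p s + A q s + A r s ≤ -1 := by linarith
  have hsum : A p q + A p r + A p s + A q r + A q s + A r s = -3 := by linarith
  have hB : ∀ i j k, ¬(A i j = -1 ∧ A i k = -1 ∧ A j k ≠ 0) := fun i j k h0 =>
    h0.2.2 (h.eq_zero_of_neg_of_neg j i k (by rw [h.symm]; exact h0.1) h0.2.1)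
  have hC : ∀ i j k, ¬(A i k = -1 ∧ A j k = -1 ∧ A i j ≠ 0) := fun i j k h0 =>
    h0.2.2 (h.eq_zero_of_neg_of_neg i k j h0.1 (by rw [h.symm]; exact h0.2.1))
  have hD : ∀ i j k, ¬(A i j = -1 ∧ A j k = -1 ∧ A i k ≠ 0) := fun i j k h0 =>
    h0.2.2 (h.eq_zero_of_neg_of_neg i j k h0.1 h0.2.1)
  have hmem : ∀ i j, A i j ∈ ({-1, 0, 1} : Finset ℤ) := fun i j => by simpa using h.ent i j
  rcases four_vertex_path _ (hmem p q) _ (hmem p r) _ (hmem p s) _ (hmem q r) _ (hmem q s) _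
    (hmem r s)
    cp up cq uq cr ur cs us hsum
    (hB p q r) (hC p q r) (hD p q r) (hB p q s) (hC p q s) (hD p q s)
    (hB p r s) (hC p r s) (hD p r s) (hB q r s) (hC q r s) (hD q r s) with
    ⟨h1, h2, h3, h4⟩ | ⟨h1, h2, h3, h4⟩ | ⟨h1, h2, h3, h4⟩ | ⟨h1, h2, h3, h4⟩ |
    ⟨h1, h2, h3, h4⟩ | ⟨h1, h2, h3, h4⟩ | ⟨h1, h2, h3, h4⟩ | ⟨h1, h2, h3, h4⟩ |
    ⟨h1, h2, h3, h4⟩ | ⟨h1, h2, h3, h4⟩ | ⟨h1, h2, h3, h4⟩ | ⟨h1, h2, h3, h4⟩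
  · exact ⟨p, q, r, s, hps, h1, h2, h3, h4⟩
  · exact ⟨p, q, s, r, hpr, h1, h2, by rw [h.symm]; exact h3, h4⟩
  · exact ⟨p, r, q, s, hps, h1, by rw [h.symm]; exact h2, h3, h4⟩
  · exact ⟨p, r, s, q, hpq, h1, h2, by rw [h.symm]; exact h3, h4⟩
  · exact ⟨p, s, q, r, hpr, h1, by rw [h.symm]; exact h2, h3, h4⟩
  · exact ⟨p, s, r, q, hpq, h1, by rw [h.symm]; exact h2, by rw [h.symm]; exact h3, h4⟩
  · exact ⟨q, p, r, s, hqs, by rw [h.symm]; exact h1, h2, h3, h4⟩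
  · exact ⟨q, p, s, r, hqr, by rw [h.symm]; exact h1, h2, by rw [h.symm]; exact h3, h4⟩
  · exact ⟨q, r, p, s, hqs, h1, by rw [h.symm]; exact h2, h3, h4⟩
  · exact ⟨q, s, p, r, hqr, h1, by rw [h.symm]; exact h2, h3, h4⟩
  · exact ⟨r, p, q, s, hrs, by rw [h.symm]; exact h1, h2, h3, h4⟩
  · exact ⟨r, q, p, s, hrs, by rw [h.symm]; exact h1, by rw [h.symm]; exact h2, h3, h4⟩

/-- Such a graph has no vertices. -/
lemma false_of_vertex (h : IsNegTriangleFreeSRSG A a c) (i₀ : Fin n) : False := by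
  obtain ⟨hc1, hn8⟩ := h.one_le i₀
  have hcount := h.count i₀
  have hn8' : (8 : ℤ) ≤ n := by exact_mod_cast hn8
  obtain ⟨rfl, p, r, s, q, hpq, hpr, hrs, hsq, hpq0⟩ := h.exists_path (by nlinarith) i₀
  have hps := h.eq_zero_of_neg_of_neg p r s hpr hrs
  have hps' : p ≠ s := by rintro rfl; omega
  have hqs' : q ≠ s := by rintro rfl; have := h.diag q; omega
  have hqr' : q ≠ r := by rintro rfl; omega
  obtain ⟨u, v, hpu, hpv, hvr, hnp, hle⟩ := h.exists_le r p s hpr hrs hps'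
  have hqs : A q s = -1 := by rw [h.symm]; exact hsq
  have hsr : A s r = -1 := by rw [h.symm]; exact hrs
  have hrp : A r p = -1 := by rw [h.symm]; exact hpr
  obtain ⟨u', v', hqu, hqv, hvs, hnq, hle'⟩ := h.exists_le s q r hqs hsr hqr'
  have hus : A u s ≠ -1 := by
    intro h0
    rcases h.eq_or_eq_of_neg s r q u hqr'.symm hsr hsq (by rw [h.symm]; exact h0) with
      rfl | rfl <;> omega
  have hur : A u' r ≠ -1 := by
    intro h0
    have hqp := h.symm q p
    rcases h.eq_or_eq_of_neg r s p u' hps'.symm hrs hrp (by rw [h.symm]; exact h0) with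
      rfl | rfl <;> omega
  have g1 := h.ent u s
  have g2 := h.ent v s
  have g3 := h.ent u' r
  have g4 := h.ent v' r
  have hc2 : 2 ≤ c := by omega
  -- `p` has a third nonneighbour, at distance two in the other direction
  have hvp : A v p = -1 := by rw [h.symm]; exact hpv
  obtain ⟨w, -, -, -, -, hvw, hwp, -⟩ := h.exists_edge v p hvp
  have hpw := h.eq_zero_of_neg_of_neg p v w hpv hvw
  have hsub : ({p, s, q} : Finset (Fin n)) ⊆ Finset.univ.filter (fun l => A p l = 0) := by
    intro l hl
    simp only [Finset.mem_insert, Finset.mem_singleton] at hl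
    simp only [Finset.mem_filter, Finset.mem_univ, true_and]
    rcases hl with rfl | rfl | rfl
    · exact h.diag _
    · exact hps
    · exact hpq0
  have hcard := Finset.card_le_card hsub
  rw [Finset.card_eq_three.mpr ⟨p, s, q, hps', hpq, hqs'.symm, rfl⟩] at hcard
  have hzp := h.card_nonadj p
  have hn9 : (9 : ℤ) ≤ n := by exact_mod_cast (by omega : 9 ≤ n)
  have hc2' : c = 2 := by nlinarith
  have hnn : n = 9 := by subst hc2'; omega
  have hvs1 : A v s = 1 := by omega
  have hvr1 : A v' r = 1 := by omega
  have hws : w ≠ s := by rintro rfl; omega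
  have hwq : w ≠ q := by
    rintro rfl
    rcases hnq v (by rw [h.symm]; exact hvw) with rfl | rfl
    · have := h.diag v
      omega
    · have := h.eq_zero_of_neg_of_neg v p r hvp hpr
      omega
  have hsub' : insert w ({p, s, q} : Finset (Fin n)) ⊆
      Finset.univ.filter (fun l => A p l = 0) := by
    refine Finset.insert_subset ?_ hsub
    simpa using hpw
  have hcard' := Finset.card_le_card hsub'
  rw [Finset.card_insert_of_notMem (by simp [hwp, hws, hwq]),
    Finset.card_eq_three.mpr ⟨p, s, q, hps', hpq, hqs'.symm, rfl⟩] at hcard'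
  omega

end IsNegTriangleFreeSRSG


theorem stmt10 {n : ℕ} (A : Matrix (Fin n) (Fin n) ℤ) (a b c : ℤ)
    (hsymm : ∀ i j, A i j = A j i)
    (hdiag : ∀ i, A i i = 0)
    (hent : ∀ i j, A i j = -1 ∨ A i j = 0 ∨ A i j = 1)
    (hconn : (SimpleGraph.fromRel (fun i j => A i j ≠ 0)).Connected)
    (hncomp : ¬ ∀ i j : Fin n, i ≠ j → A i j ≠ 0)
    (hinhom : (∃ i j, A i j = 1) ∧ (∃ i j, A i j = -1))
    (hreg : ∀ i, (Finset.univ.filter (fun j => A i j ≠ 0)).card = 6)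
    (hnet : ∀ i, ∑ j, A i j = 2)
    (hAA : ∀ i, (A * A) i i = 6)
    (hpos : ∀ i j, A i j = 1 → (A * A) i j = a)
    (hneg : ∀ i j, A i j = -1 → (A * A) i j = b)
    (hnon : ∀ i j, i ≠ j → A i j = 0 → (A * A) i j = c)
    (hclass : ¬(a = -b ∧ c = 0) ∧ ¬(a ≠ -b ∧ 2 * c = a + b))
    (htri1 : ∃ i j k : Fin n,
      (A i j = -1 ∧ A j k = 1 ∧ A i k = 1) ∨
      (A i j = 1 ∧ A j k = -1 ∧ A i k = 1) ∨
      (A i j = 1 ∧ A j k = 1 ∧ A i k = -1))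
    (hb : b = 3) :
    ∃ i j k : Fin n, A i j = -1 ∧ A j k = -1 ∧ A i k = -1 := by
  subst hb
  by_contra hno
  obtain ⟨⟨i₀, -⟩, -⟩ := hinhom
  exact IsNegTriangleFreeSRSG.false_of_vertex (A := A) (a := a) (c := c)
    ⟨hsymm, hdiag, hent, hreg, hnet, hAA, hpos, hneg, hnon,
      fun i j k h₁ h₂ h₃ => hno ⟨i, j, k, h₁, h₂, h₃⟩⟩ i₀
end
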